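/- Let D be the time-dependent operator Dξ = ∂_sξ + J₀∂_tξ + S(s,t)ξ. (i) For I = [a,b] there exists a constant c > 0 such that for all ξ ∈ H²_{bc}(I×[0,1]): ‖ξ‖_{W^{2,2}} ≤ c·( ‖Dξ‖_{W^{1,2}} + ‖ξ(a,·)‖_{3/2} + ‖ξ(b,·)‖_{3/2} ). (ii) For I = ℝ^±, assuming hypothesis (H1), there exists a constant c > 0 such that for all ξ ∈ H²_{bc}(ℝ^±×[0,1]): ‖ξ‖_{W^{2,2}} ≤ c·( ‖Dξ‖_{W^{1,2}} + ‖ξ(0,·)‖_{3/2} ). -/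

import Mathlib

open scoped RealInnerProductSpace Classical
open MeasureTheory Set

noncomputable section

variable {E : Type*} [NormedAddCommGroup E] [InnerProductSpace ℝ E]

/-- The strip `I × [0,1] ⊆ ℝ²`. -/
def Strip (I : Set ℝ) : Set (ℝ × ℝ) := I ×ˢ Icc (0:ℝ) 1

/-- Strong representative of a `W^{1,2}` function on the strip over `I`,
with total derivative `Du`. -/
def W12On (I : Set ℝ) (u : ℝ × ℝ → E) (Du : ℝ × ℝ → ℝ × ℝ →L[ℝ] E) : Prop :=
  (∀ p ∈ Strip I, HasFDerivWithinAt u (Du p) (Strip I) p) ∧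
  IntegrableOn (fun p => ‖u p‖ ^ 2) (Strip I) volume ∧
  IntegrableOn (fun p => ‖Du p (1, 0)‖ ^ 2) (Strip I) volume ∧
  IntegrableOn (fun p => ‖Du p (0, 1)‖ ^ 2) (Strip I) volume

/-- Strong representative of a `W^{2,2}` function on the strip over `I`. -/
def W22On (I : Set ℝ) (u : ℝ × ℝ → E) (Du : ℝ × ℝ → ℝ × ℝ →L[ℝ] E)
    (D2u : ℝ × ℝ → ℝ × ℝ →L[ℝ] ℝ × ℝ →L[ℝ] E) : Prop :=
  W12On I u Du ∧
  (∀ p ∈ Strip I, HasFDerivWithinAt Du (D2u p) (Strip I) p) ∧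
  IntegrableOn (fun p => ‖D2u p (1, 0) (1, 0)‖ ^ 2) (Strip I) volume ∧
  IntegrableOn (fun p => ‖D2u p (1, 0) (0, 1)‖ ^ 2) (Strip I) volume ∧
  IntegrableOn (fun p => ‖D2u p (0, 1) (0, 1)‖ ^ 2) (Strip I) volume

/-- The Lagrangian boundary condition `u(s,0), u(s,1) ∈ Λ`. -/
def LagBC (Λ : Submodule ℝ E) (I : Set ℝ) (u : ℝ × ℝ → E) : Prop :=
  ∀ s ∈ I, u (s, 0) ∈ Λ ∧ u (s, 1) ∈ Λ

/-- The second boundary condition `Aξ(s,0), Aξ(s,1) ∈ Λ` for `A = J∂_t + S₁(t)`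
(part of membership in `H²_bc`). -/
def LagBC2 (Λ : Submodule ℝ E) (J : E →L[ℝ] E) (S1 : ℝ → E →L[ℝ] E)
    (I : Set ℝ) (u : ℝ × ℝ → E) (Du : ℝ × ℝ → ℝ × ℝ →L[ℝ] E) : Prop :=
  ∀ s ∈ I, J (Du (s, 0) (0, 1)) + S1 0 (u (s, 0)) ∈ Λ ∧
           J (Du (s, 1) (0, 1)) + S1 1 (u (s, 1)) ∈ Λ

/-- Hypothesis (HA) for `A = J∂_t + S₁(t)` on paths with boundary conditions in `Λ`,
encoded through a complete orthonormal family `(x i)` of eigenfunctions with nonzero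
eigenvalues `μ i`. -/
def EigenData (J : E →L[ℝ] E) (Λ : Submodule ℝ E) (S1 : ℝ → E →L[ℝ] E)
    {ι : Type*} (x : ι → ℝ → E) (μ : ι → ℝ) : Prop :=
  (∀ i, ContDiff ℝ (⊤ : ℕ∞) (x i)) ∧
  (∀ i, μ i ≠ 0) ∧
  (∀ i, x i 0 ∈ Λ ∧ x i 1 ∈ Λ) ∧
  (∀ i t, J (deriv (x i) t) + S1 t (x i t) = μ i • x i t) ∧
  (∀ i j, (∫ t in (0:ℝ)..1, ⟪x i t, x j t⟫) = if i = j then 1 else 0) ∧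
  (∀ y : ℝ → E, ContinuousOn y (Icc 0 1) →
    (∀ i, (∫ t in (0:ℝ)..1, ⟪y t, x i t⟫) = 0) → ∀ t ∈ Icc 0 1, y t = 0)

/-- The coefficient of a path `γ : [0,1] → E` on the eigenfunction `x i`. -/
def coeff {ι : Type*} (x : ι → ℝ → E) (γ : ℝ → E) (i : ι) : ℝ :=
  ∫ t in (0:ℝ)..1, ⟪γ t, x i t⟫

/-- Membership in the negative spectral subspace `E⁻`. -/
def InEneg {ι : Type*} (x : ι → ℝ → E) (μ : ι → ℝ) (γ : ℝ → E) : Prop :=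
  ∀ i, 0 < μ i → coeff x γ i = 0

/-- Membership in the positive spectral subspace `E⁺`. -/
def InEpos {ι : Type*} (x : ι → ℝ → E) (μ : ι → ℝ) (γ : ℝ → E) : Prop :=
  ∀ i, μ i < 0 → coeff x γ i = 0

/-- The operator `D u = ∂_s u + J ∂_t u + S(s,t) u` (evaluated pointwise using the
derivative data `Du`). -/
def Dop (J : E →L[ℝ] E) (S : ℝ → ℝ → E →L[ℝ] E) (u : ℝ × ℝ → E)
    (Du : ℝ × ℝ → ℝ × ℝ →L[ℝ] E) (p : ℝ × ℝ) : E :=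
  Du p (1, 0) + J (Du p (0, 1)) + S p.1 p.2 (u p)

/-- The `E^{3/2}`-norm `‖γ‖_{3/2}` of a path, via the eigenvector expansion. -/
def norm32 {ι : Type*} (x : ι → ℝ → E) (μ : ι → ℝ) (γ : ℝ → E) : ℝ :=
  Real.sqrt (∑' i, |μ i| ^ 3 * coeff x γ i ^ 2)

/-- `‖π_P γ‖_{3/2}`, where `π_P` is the spectral projection keeping the eigenmodes
with `P (μ i)`. -/
def norm32P {ι : Type*} (x : ι → ℝ → E) (μ : ι → ℝ) (P : ℝ → Prop) (γ : ℝ → E) : ℝ :=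
  Real.sqrt (∑' i, if P (μ i) then |μ i| ^ 3 * coeff x γ i ^ 2 else 0)

/-- The `L²`-norm over the strip. -/
def normL2 (I : Set ℝ) (v : ℝ × ℝ → E) : ℝ :=
  Real.sqrt (∫ p in Strip I, ‖v p‖ ^ 2)

/-- The `W^{1,2}`-norm over the strip. -/
def normW12 (I : Set ℝ) (v : ℝ × ℝ → E) (Dv : ℝ × ℝ → ℝ × ℝ →L[ℝ] E) : ℝ :=
  Real.sqrt (∫ p in Strip I,
    (‖v p‖ ^ 2 + ‖Dv p (1, 0)‖ ^ 2 + ‖Dv p (0, 1)‖ ^ 2))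

/-- The `W^{2,2}`-norm over the strip. -/
def normW22 (I : Set ℝ) (v : ℝ × ℝ → E) (Dv : ℝ × ℝ → ℝ × ℝ →L[ℝ] E)
    (D2v : ℝ × ℝ → ℝ × ℝ →L[ℝ] ℝ × ℝ →L[ℝ] E) : ℝ :=
  Real.sqrt (∫ p in Strip I,
    (‖v p‖ ^ 2 + ‖Dv p (1, 0)‖ ^ 2 + ‖Dv p (0, 1)‖ ^ 2
      + ‖D2v p (1, 0) (1, 0)‖ ^ 2 + ‖D2v p (1, 0) (0, 1)‖ ^ 2
      + ‖D2v p (0, 1) (0, 1)‖ ^ 2))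

/-- The derivative of `Dop J (S₁ + R) u` in the direction `w`, computed by the chain and
Leibniz rules from the data `(u, Du, D2u)` and `(R, DR)`. -/
def DDop (J : E →L[ℝ] E) (S1 : ℝ → E →L[ℝ] E) (R : ℝ × ℝ → E →L[ℝ] E)
    (DR : ℝ × ℝ → ℝ × ℝ →L[ℝ] E →L[ℝ] E) (u : ℝ × ℝ → E)
    (Du : ℝ × ℝ → ℝ × ℝ →L[ℝ] E) (D2u : ℝ × ℝ → ℝ × ℝ →L[ℝ] ℝ × ℝ →L[ℝ] E)
    (q : ℝ × ℝ) (w : ℝ × ℝ) : E :=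
  D2u q w (1, 0) + J (D2u q w (0, 1))
    + (w.2 • deriv S1 q.2 + DR q w) (u q)
    + (S1 q.2 + R q) (Du q w)

/-- A nondegenerate closed interval `I` with set of endpoints `B`: integrals of derivatives over
`I` are controlled by endpoint values, and values are controlled by integrals. -/
structure TraceInterval (I : Set ℝ) (B : Finset ℝ) : Prop where
  closed : IsClosed I
  convex : Convex ℝ I
  subset : ∀ b ∈ B, b ∈ I
  neg_integral_le : ∀ F F' : ℝ → ℝ, ContinuousOn F I →
    (∀ s ∈ interior I, HasDerivAt F (F' s) s) → IntegrableOn F I → IntegrableOn F' I →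
    -∫ s in I, F' s ≤ ∑ b ∈ B, |F b|
  exists_bound : ∃ L : ℝ, 0 ≤ L ∧ ∀ F F' : ℝ → ℝ, ContinuousOn F I →
    (∀ s ∈ interior I, HasDerivAt F (F' s) s) → IntegrableOn F I → IntegrableOn F' I →
    ∀ s ∈ I, F s ≤ L * (∫ r in I, |F r|) + ∫ r in I, |F' r|

theorem le_integral_add_integral_deriv {I : Set ℝ} {F F' : ℝ → ℝ} (hc : ContinuousOn F I)
    (hd : ∀ s ∈ interior I, HasDerivAt F (F' s) s) (hF : IntegrableOn F I)
    (hF' : IntegrableOn F' I) {a b : ℝ} (hab : a < b) (hI : Icc a b ⊆ I) {s : ℝ}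
    (hs : s ∈ Icc a b) :
    F s ≤ (b - a)⁻¹ * (∫ r in I, |F r|) + ∫ r in I, |F' r| := by
  have hint : Ioo a b ⊆ interior I := by
    rw [← interior_Icc]; exact interior_mono hI
  have key : ∀ r ∈ Icc a b, ∀ u ∈ Icc a b, r ≤ u → |F u - F r| ≤ ∫ r in I, |F' r| := by
    intro r hr u hu hru
    have hsub : Icc r u ⊆ Icc a b := Icc_subset_Icc hr.1 hu.2
    have h1 : ∫ y in r..u, F' y = F u - F r := by
      apply intervalIntegral.integral_eq_sub_of_hasDerivAt_of_le hru
        (hc.mono (hsub.trans hI))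
      · intro y hy
        exact hd y (hint ⟨lt_of_le_of_lt hr.1 hy.1, lt_of_lt_of_le hy.2 hu.2⟩)
      · rw [intervalIntegrable_iff_integrableOn_Icc_of_le hru]
        exact hF'.mono_set (hsub.trans hI)
    rw [← h1, intervalIntegral.integral_of_le hru]
    refine (abs_integral_le_integral_abs).trans ?_
    apply setIntegral_mono_set hF'.abs (Filter.Eventually.of_forall fun _ => abs_nonneg _)
    exact (Ioc_subset_Icc_self.trans (hsub.trans hI)).eventuallyLE
  have key2 : ∀ r ∈ Icc a b, F s ≤ |F r| + ∫ r in I, |F' r| := by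
    intro r hr
    rcases le_total r s with h | h
    · have := key r hr s hs h
      have h3 := le_abs_self (F s - F r); have h4 := le_abs_self (F r); linarith
    · have := key s hs r hr h
      have h3 := neg_abs_le (F r - F s); have h4 := le_abs_self (F r); linarith
  have hFi : IntegrableOn (fun r => |F r|) (Icc a b) := (hF.mono_set hI).abs
  have h5 : ∫ _ in Icc a b, F s ≤ ∫ r in Icc a b, (|F r| + ∫ r in I, |F' r|) := by
    apply setIntegral_mono_on _ _ measurableSet_Icc key2
    · exact integrableOn_const (by simp)
    · exact hFi.add (integrableOn_const (by simp))
  have h6 : ∫ r in Icc a b, |F r| ≤ ∫ r in I, |F r| :=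
    setIntegral_mono_set hF.abs (Filter.Eventually.of_forall fun _ => abs_nonneg _)
      hI.eventuallyLE
  rw [integral_add hFi (integrableOn_const (by simp))] at h5
  simp only [integral_const, MeasurableSet.univ, measureReal_restrict_apply, univ_inter,
    Real.volume_real_Icc_of_le hab.le, smul_eq_mul] at h5
  have hba : 0 < b - a := sub_pos.2 hab
  have h7 : F s = (b - a)⁻¹ * ((b - a) * F s) := by field_simp
  rw [h7]
  calc _ ≤ (b - a)⁻¹ * ((∫ r in I, |F r|) + (b - a) * ∫ r in I, |F' r|) := by
        gcongr; linarith
    _ = _ := by field_simp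

theorem traceInterval_Icc {a b : ℝ} (hab : a < b) : TraceInterval (Icc a b) {a, b} where
  closed := isClosed_Icc
  convex := convex_Icc a b
  subset := by simp [hab.le]
  neg_integral_le F F' hc hd hF hF' := by
    have h1 : ∫ y in a..b, F' y = F b - F a := by
      apply intervalIntegral.integral_eq_sub_of_hasDerivAt_of_le hab.le hc
      · intro y hy
        exact hd y (by rwa [interior_Icc])
      · rwa [intervalIntegrable_iff_integrableOn_Icc_of_le hab.le]
    rw [integral_Icc_eq_integral_Ioc, ← intervalIntegral.integral_of_le hab.le, h1,
      Finset.sum_pair hab.ne]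
    have h3 := le_abs_self (F a); have h4 := neg_abs_le (F b); linarith
  exists_bound := ⟨(b - a)⁻¹, (inv_pos.2 (sub_pos.2 hab)).le, fun _ _ hc hd hF hF' _ hs =>
    le_integral_add_integral_deriv hc hd hF hF' hab subset_rfl hs⟩

theorem traceInterval_Ici : TraceInterval (Ici 0) {0} where
  closed := isClosed_Ici
  convex := convex_Ici 0
  subset := by simp
  neg_integral_le F F' hc hd hF hF' := by
    rw [interior_Ici] at hd
    have hF1 := hF.mono_set Ioi_subset_Ici_self
    have hF2 := hF'.mono_set Ioi_subset_Ici_self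
    have h0 := tendsto_zero_of_hasDerivAt_of_integrableOn_Ioi hd hF2 hF1
    have h1 := integral_Ioi_of_hasDerivAt_of_tendsto (hc 0 self_mem_Ici) hd hF2 h0
    rw [integral_Ici_eq_integral_Ioi, h1]
    simpa using le_abs_self (F 0)
  exists_bound := ⟨1, zero_le_one, fun _ _ hc hd hF hF' s hs => by
    simpa using le_integral_add_integral_deriv hc hd hF hF' (lt_add_one s)
      (fun r hr => le_trans hs hr.1) (left_mem_Icc.2 (lt_add_one s).le)⟩

theorem traceInterval_Iic : TraceInterval (Iic 0) {0} where
  closed := isClosed_Iic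
  convex := convex_Iic 0
  subset := by simp
  neg_integral_le F F' hc hd hF hF' := by
    rw [interior_Iic] at hd
    have hsub : Iic (-1 : ℝ) ⊆ Iic 0 := Iic_subset_Iic.2 (by norm_num)
    have h0 := tendsto_zero_of_hasDerivAt_of_integrableOn_Iic
      (fun r (hr : r ∈ Iic (-1 : ℝ)) => hd r (lt_of_le_of_lt hr (by norm_num : (-1 : ℝ) < 0)))
      (hF'.mono_set hsub) (hF.mono_set hsub)
    have h1 := integral_Iic_of_hasDerivAt_of_tendsto (hc 0 self_mem_Iic) hd hF' h0
    rw [h1]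
    simpa using neg_le_abs (F 0)
  exists_bound := ⟨1, zero_le_one, fun _ _ hc hd hF hF' s hs => by
    simpa using le_integral_add_integral_deriv hc hd hF hF' (sub_one_lt s)
      (fun r hr => le_trans hr.2 hs) (right_mem_Icc.2 (sub_one_lt s).le)⟩

theorem integrableOn_mul_of_bounded {I : Set ℝ} (hI : IsClosed I) {g f : ℝ → ℝ} {C : ℝ}
    (hg : ContinuousOn g I) (hb : ∀ s ∈ I, |g s| ≤ C) (hf : IntegrableOn f I) :
    IntegrableOn (fun s => g s * f s) I := by
  refine Integrable.bdd_mul hf (hg.aestronglyMeasurable hI.measurableSet) (c := C) ?_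
  exact (ae_restrict_iff' hI.measurableSet).2 (Filter.Eventually.of_forall hb)

theorem integrableOn_mul_of_sq {I : Set ℝ} (hI : IsClosed I) {g f : ℝ → ℝ}
    (hg : ContinuousOn g I) (hf : ContinuousOn f I)
    (hg2 : IntegrableOn (fun s => g s ^ 2) I) (hf2 : IntegrableOn (fun s => f s ^ 2) I) :
    IntegrableOn (fun s => g s * f s) I := by
  refine (hg2.add hf2).mono' ((hg.mul hf).aestronglyMeasurable hI.measurableSet) ?_
  refine Filter.Eventually.of_forall fun s => ?_
  simp only [Pi.add_apply, Real.norm_eq_abs, abs_mul]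
  nlinarith [sq_nonneg (|g s| - |f s|), sq_abs (g s), sq_abs (f s)]

/-- A weighted `L²` estimate for the ordinary differential operator `w ↦ w' + μ w`, with the
convex weight `exp (2 φ)`, where `φ' = -σ φ` and `σ² = 1`. -/
theorem TraceInterval.weighted_mode_estimate {I : Set ℝ} {B : Finset ℝ} (hT : TraceInterval I B)
    {σ μ M : ℝ} {φ κ w w' : ℝ → ℝ} (hσ : σ ^ 2 = 1) (hφ : ∀ s, HasDerivAt φ (-σ * φ s) s)
    (hφ0 : ∀ s, 0 ≤ φ s) (hφM : ∀ s ∈ I, φ s ≤ M)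
    (hκ : ContinuousOn κ I) (hκ0 : ∀ s, 0 ≤ κ s) (hκle : ∀ s, κ s ≤ (μ + σ * φ s) ^ 2 + φ s)
    (hw : ContinuousOn w I) (hw' : ContinuousOn w' I)
    (hd : ∀ s ∈ interior I, HasDerivAt w (w' s) s)
    (hw2 : IntegrableOn (fun s => w s ^ 2) I) (hw'2 : IntegrableOn (fun s => w' s ^ 2) I) :
    ∫ s in I, κ s * Real.exp (2 * φ s) * w s ^ 2 ≤
      (∫ s in I, Real.exp (2 * φ s) * (w' s + μ * w s) ^ 2) +
        ∑ b ∈ B, |μ + σ * φ b| * Real.exp (2 * φ b) * w b ^ 2 := by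
  have hφc : Continuous φ := continuous_iff_continuousAt.2 fun s => (hφ s).continuousAt
  have hσ1 : |σ| = 1 := by rwa [← sq_eq_sq₀ (abs_nonneg _) zero_le_one, sq_abs, one_pow]
  have hE : ∀ s ∈ I, |Real.exp (2 * φ s)| ≤ Real.exp (2 * M) := fun s hs => by
    rw [abs_of_pos (Real.exp_pos _)]
    exact Real.exp_le_exp.2 (by linarith [hφM s hs])
  have hμσ : ∀ s ∈ I, |μ + σ * φ s| ≤ |μ| + M := fun s hs => by
    refine (abs_add_le _ _).trans ?_
    rw [abs_mul, hσ1, one_mul, abs_of_nonneg (hφ0 s)]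
    linarith [hφM s hs]
  have hww' := integrableOn_mul_of_sq hT.closed hw hw' hw2 hw'2
  have hκi : IntegrableOn (fun s => κ s * Real.exp (2 * φ s) * w s ^ 2) I := by
    refine integrableOn_mul_of_bounded hT.closed (C := ((|μ| + M) ^ 2 + M) * Real.exp (2 * M))
      (hκ.mul (by fun_prop)) (fun s hs => ?_) hw2
    rw [abs_mul, abs_of_nonneg (hκ0 s)]
    have h1 : (μ + σ * φ s) ^ 2 ≤ (|μ| + M) ^ 2 := by
      rw [← sq_abs (μ + σ * φ s)]
      exact pow_le_pow_left₀ (abs_nonneg _) (hμσ s hs) 2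
    exact mul_le_mul ((hκle s).trans (add_le_add h1 (hφM s hs))) (hE s hs) (abs_nonneg _)
      (add_nonneg (sq_nonneg _) ((hφ0 s).trans (hφM s hs)))
  have hRi : IntegrableOn (fun s => Real.exp (2 * φ s) * (w' s + μ * w s) ^ 2) I := by
    refine integrableOn_mul_of_bounded hT.closed (C := Real.exp (2 * M)) (by fun_prop) hE ?_
    have : IntegrableOn (fun s => w' s ^ 2 + (2 * μ) * (w s * w' s) + μ ^ 2 * w s ^ 2) I :=
      (hw'2.add (hww'.const_mul _)).add (hw2.const_mul _)
    refine this.congr_fun (fun s _ => ?_) hT.closed.measurableSet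
    ring
  set F : ℝ → ℝ := fun s => (μ + σ * φ s) * Real.exp (2 * φ s) * w s ^ 2 with hF
  set F' : ℝ → ℝ := fun s => (-φ s + (μ + σ * φ s) * (-2 * σ * φ s)) * Real.exp (2 * φ s) * w s ^ 2
    + 2 * (μ + σ * φ s) * Real.exp (2 * φ s) * (w s * w' s) with hF'
  have hFi : IntegrableOn F I := by
    refine integrableOn_mul_of_bounded hT.closed (C := (|μ| + M) * Real.exp (2 * M))
      (by fun_prop) (fun s hs => ?_) hw2
    rw [abs_mul]
    exact mul_le_mul (hμσ s hs) (hE s hs) (abs_nonneg _) ((abs_nonneg _).trans (hμσ s hs))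
  have hF'i : IntegrableOn F' I := by
    refine Integrable.add ?_ ?_
    · refine integrableOn_mul_of_bounded hT.closed
        (C := (M + (|μ| + M) * (2 * M)) * Real.exp (2 * M)) (by fun_prop) (fun s hs => ?_) hw2
      rw [abs_mul]
      refine mul_le_mul ?_ (hE s hs) (abs_nonneg _) ?_
      · refine (abs_add_le _ _).trans (add_le_add ?_ ?_)
        · rw [abs_neg, abs_of_nonneg (hφ0 s)]; exact hφM s hs
        · rw [abs_mul]
          refine mul_le_mul (hμσ s hs) ?_ (abs_nonneg _) ((abs_nonneg _).trans (hμσ s hs))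
          rw [abs_mul, abs_mul, hσ1, abs_of_nonneg (hφ0 s)]
          norm_num
          exact hφM s hs
      · have := (hφ0 s).trans (hφM s hs); positivity
    · refine integrableOn_mul_of_bounded hT.closed
        (C := 2 * (|μ| + M) * Real.exp (2 * M)) (by fun_prop) (fun s hs => ?_) hww'
      rw [abs_mul, abs_mul, abs_two]
      have := (abs_nonneg _).trans (hμσ s hs)
      exact mul_le_mul (mul_le_mul_of_nonneg_left (hμσ s hs) zero_le_two) (hE s hs)
        (abs_nonneg _) (by positivity)
  have hFd : ∀ s ∈ interior I, HasDerivAt F (F' s) s := by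
    intro s hs
    have h1 : HasDerivAt (fun s => μ + σ * φ s) (σ * (-σ * φ s)) s :=
      ((hφ s).const_mul σ).const_add μ
    have h2 : HasDerivAt (fun s => Real.exp (2 * φ s))
      (Real.exp (2 * φ s) * (2 * (-σ * φ s))) s := ((hφ s).const_mul 2).exp
    have h3 : HasDerivAt (fun s => w s ^ 2) (2 * w s * w' s) s := by
      simpa using (hd s hs).fun_pow 2
    refine ((h1.mul h2).mul h3).congr_deriv ?_
    simp only [hF', Pi.mul_apply]
    have : σ * (-σ * φ s) = -φ s := by linear_combination (-φ s) * hσ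
    rw [this]
    ring
  have hFc : ContinuousOn F I := by fun_prop
  have h1 := hT.neg_integral_le F F' hFc hFd hFi hF'i
  have h2 : ∫ s in I, κ s * Real.exp (2 * φ s) * w s ^ 2 ≤
      ∫ s in I, (Real.exp (2 * φ s) * (w' s + μ * w s) ^ 2 - F' s) := by
    refine setIntegral_mono_on hκi (hRi.sub hF'i) hT.closed.measurableSet fun s _ => ?_
    have h4 : Real.exp (2 * φ s) * (w' s + μ * w s) ^ 2 - F' s =
        Real.exp (2 * φ s) * (w' s - σ * φ s * w s) ^ 2 +
        ((μ + σ * φ s) ^ 2 + φ s) * (Real.exp (2 * φ s) * w s ^ 2) := by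
      simp only [hF']
      ring
    rw [h4, mul_assoc]
    have h5 : 0 ≤ Real.exp (2 * φ s) * w s ^ 2 := by positivity
    have h6 : 0 ≤ Real.exp (2 * φ s) * (w' s - σ * φ s * w s) ^ 2 := by positivity
    nlinarith [mul_le_mul_of_nonneg_right (hκle s) h5]
  rw [integral_sub hRi hF'i] at h2
  have h3 : ∑ b ∈ B, |F b| = ∑ b ∈ B, |μ + σ * φ b| * Real.exp (2 * φ b) * w b ^ 2 := by
    refine Finset.sum_congr rfl fun b _ => ?_
    rw [hF, abs_mul, abs_mul, abs_of_pos (Real.exp_pos _), abs_sq]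
  linarith

theorem TraceInterval.mode_estimate {I : Set ℝ} {B : Finset ℝ} (hT : TraceInterval I B)
    {μ : ℝ} {w w' : ℝ → ℝ} (hw : ContinuousOn w I) (hw' : ContinuousOn w' I)
    (hd : ∀ s ∈ interior I, HasDerivAt w (w' s) s)
    (hw2 : IntegrableOn (fun s => w s ^ 2) I) (hw'2 : IntegrableOn (fun s => w' s ^ 2) I) :
    μ ^ 2 * ∫ s in I, w s ^ 2 ≤ (∫ s in I, (w' s + μ * w s) ^ 2) + ∑ b ∈ B, |μ| * w b ^ 2 := by
  have := hT.weighted_mode_estimate (σ := 1) (μ := μ) (M := 0) (φ := fun _ => 0)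
    (κ := fun _ => μ ^ 2) (by norm_num) (fun s => by simpa using hasDerivAt_const s (0 : ℝ))
    (fun _ => le_rfl) (fun _ _ => le_rfl) continuousOn_const (fun _ => sq_nonneg _)
    (fun _ => by simp) hw hw' hd hw2 hw'2
  simpa [integral_const_mul] using this

theorem TraceInterval.sq_le {I : Set ℝ} {B : Finset ℝ} (hT : TraceInterval I B) :
    ∃ L : ℝ, 0 ≤ L ∧ ∀ (ε : ℝ) (w w' : ℝ → ℝ), 0 < ε → ContinuousOn w I → ContinuousOn w' I →
    (∀ s ∈ interior I, HasDerivAt w (w' s) s) → IntegrableOn (fun s => w s ^ 2) I →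
    IntegrableOn (fun s => w' s ^ 2) I → ∀ s ∈ I,
    w s ^ 2 ≤ (L + ε⁻¹) * (∫ r in I, w r ^ 2) + ε * ∫ r in I, w' r ^ 2 := by
  obtain ⟨L, hL, h⟩ := hT.exists_bound
  refine ⟨L, hL, fun ε w w' hε hw hw' hd hw2 hw'2 s hs => ?_⟩
  have hww' := integrableOn_mul_of_sq hT.closed hw hw' hw2 hw'2
  have h1 := h (fun s => w s ^ 2) (fun s => 2 * (w s * w' s)) (hw.pow 2)
    (fun s hs => by simpa [mul_assoc] using (hd s hs).fun_pow 2) hw2 (hww'.const_mul _) s hs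
  simp only [abs_sq] at h1
  have h2 : ∫ r in I, |2 * (w r * w' r)| ≤ ∫ r in I, (ε⁻¹ * w r ^ 2 + ε * w' r ^ 2) := by
    refine integral_mono (hww'.const_mul _).abs ((hw2.const_mul _).add (hw'2.const_mul _))
      fun r => ?_
    have h3 : 0 ≤ ε⁻¹ * (|w r| - ε * |w' r|) ^ 2 := by positivity
    have h4 : ε⁻¹ * (|w r| - ε * |w' r|) ^ 2 =
        ε⁻¹ * |w r| ^ 2 + ε * |w' r| ^ 2 - 2 * (|w r| * |w' r|) := by field_simp; ring
    simp only [abs_mul, abs_two]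
    rw [h4, sq_abs, sq_abs] at h3
    linarith
  rw [integral_add (hw2.const_mul _) (hw'2.const_mul _), integral_const_mul,
    integral_const_mul] at h2
  linarith

/-- A lower bound for the quadratic weight attached to an eigenvalue `μ` with `m ≤ |μ|`. -/
theorem weight_lower_bound {m μ σ p : ℝ} (hm : 0 < m) (hμ : m ≤ |μ|) (hσ : σ ^ 2 = 1)
    (hp : 0 ≤ p) : (min (m / 2) (m ^ 2 / 4) + p) / 2 ≤ (μ + σ * p) ^ 2 + p := by
  rcases le_total (m / 2) p with h | h
  · have := min_le_left (m / 2) (m ^ 2 / 4)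
    nlinarith [sq_nonneg (μ + σ * p)]
  · have h1 := min_le_right (m / 2) (m ^ 2 / 4)
    have hσ1 : |σ| = 1 := by rwa [← sq_eq_sq₀ (abs_nonneg _) zero_le_one, sq_abs, one_pow]
    have h2 : m / 2 ≤ |μ + σ * p| := by
      have h3 := abs_sub_abs_le_abs_sub μ (-(σ * p))
      rw [abs_neg, abs_mul, hσ1, one_mul, abs_of_nonneg hp, sub_neg_eq_add] at h3
      linarith
    have h3 : (m / 2) ^ 2 ≤ (μ + σ * p) ^ 2 := by
      rw [← sq_abs (μ + σ * p)]; exact pow_le_pow_left₀ (by positivity) h2 2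
    nlinarith [sq_nonneg m]

section SquareIntegrable

variable {α : Type*} {mα : MeasurableSpace α} {ν : Measure α}

theorem MemLp.integrable_inner_two {f g : α → E} (hf : MemLp f 2 ν) (hg : MemLp g 2 ν) :
    Integrable (fun a => ⟪f a, g a⟫) ν := by
  refine ((hf.integrable_norm_pow two_ne_zero).add (hg.integrable_norm_pow two_ne_zero)).mono'
    (hf.1.inner hg.1) (Filter.Eventually.of_forall fun a => ?_)
  have := norm_inner_le_norm (𝕜 := ℝ) (f a) (g a)
  simp only [Pi.add_apply]
  nlinarith [sq_nonneg (‖f a‖ - ‖g a‖), sq_nonneg ‖f a‖, sq_nonneg ‖g a‖]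

theorem integral_norm_sub_sq {f g : α → E} (hf : MemLp f 2 ν) (hg : MemLp g 2 ν) :
    ∫ a, ‖f a - g a‖ ^ 2 ∂ν =
      (∫ a, ‖f a‖ ^ 2 ∂ν) - 2 * (∫ a, ⟪f a, g a⟫ ∂ν) + ∫ a, ‖g a‖ ^ 2 ∂ν := by
  have h1 := hf.integrable_norm_pow two_ne_zero
  have h2 := hg.integrable_norm_pow two_ne_zero
  have h3 := (MemLp.integrable_inner_two hf hg).const_mul 2
  have h4 : Integrable (fun a => ‖f a‖ ^ 2 - 2 * ⟪f a, g a⟫) ν := h1.sub h3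
  simp only [norm_sub_sq_real]
  rw [integral_add h4 h2, integral_sub h1 h3, integral_const_mul]

theorem integral_inner_le {f g : α → E} (hf : MemLp f 2 ν) (hg : MemLp g 2 ν) :
    2 * ∫ a, ⟪f a, g a⟫ ∂ν ≤ (∫ a, ‖f a‖ ^ 2 ∂ν) + ∫ a, ‖g a‖ ^ 2 ∂ν := by
  have h := integral_norm_sub_sq hf hg
  have : 0 ≤ ∫ a, ‖f a - g a‖ ^ 2 ∂ν := integral_nonneg fun _ => sq_nonneg _
  linarith

end SquareIntegrable

theorem intervalIntegral_eq_setIntegral_Icc (g : ℝ → ℝ) :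
    ∫ t in (0 : ℝ)..1, g t = ∫ t in Icc (0 : ℝ) 1, g t := by
  rw [intervalIntegral.integral_of_le zero_le_one, integral_Icc_eq_integral_Ioc]

theorem coeff_eq {ι : Type*} (x : ι → ℝ → E) (γ : ℝ → E) (i : ι) :
    coeff x γ i = ∫ t in Icc (0 : ℝ) 1, ⟪γ t, x i t⟫ :=
  intervalIntegral_eq_setIntegral_Icc _

theorem memLp_of_continuousOn {G : Type*} [NormedAddCommGroup G] {f : ℝ → G} (hf : ContinuousOn f (Icc 0 1)) :
    MemLp f 2 (volume.restrict (Icc (0 : ℝ) 1)) := by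
  obtain ⟨C, hC⟩ := isCompact_Icc.exists_bound_of_continuousOn hf
  have hm : AEStronglyMeasurable f (volume.restrict (Icc (0 : ℝ) 1)) :=
    hf.aestronglyMeasurable_of_isCompact isCompact_Icc measurableSet_Icc
  exact MemLp.of_bound hm C ((ae_restrict_iff' measurableSet_Icc).2
    (Filter.Eventually.of_forall hC))

/-- The self-adjoint boundary value problem `J ∂ₜ + S` on paths with ends in `Λ`, together with
a complete orthonormal system of eigenfunctions. -/
structure SpectralProblem (J : E →L[ℝ] E) (Λ : Submodule ℝ E) (S : ℝ → E →L[ℝ] E)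
    {ι : Type*} (x : ι → ℝ → E) (μ : ι → ℝ) : Prop where
  norm_map : ∀ v, ‖J v‖ = ‖v‖
  map_map : ∀ v, J (J v) = -v
  lagrangian : ∀ v ∈ Λ, J v ∈ Λᗮ
  smooth : ContDiff ℝ (⊤ : ℕ∞) S
  symm : ∀ (t : ℝ) (v w : E), ⟪S t v, w⟫ = ⟪v, S t w⟫
  eigen : EigenData J Λ S x μ

/-- Paths on `[0,1]` that are differentiable with square integrable derivative and have their ends
in `Λ`. -/
structure AdmissiblePath (Λ : Submodule ℝ E) (f f' : ℝ → E) : Prop where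
  deriv : ∀ t ∈ Icc (0 : ℝ) 1, HasDerivWithinAt f (f' t) (Icc 0 1) t
  memLp : MemLp f' 2 (volume.restrict (Icc (0 : ℝ) 1))
  left : f 0 ∈ Λ
  right : f 1 ∈ Λ

theorem AdmissiblePath.continuousOn {Λ : Submodule ℝ E} {f f' : ℝ → E}
    (h : AdmissiblePath Λ f f') : ContinuousOn f (Icc 0 1) :=
  fun t ht => (h.deriv t ht).continuousWithinAt

namespace SpectralProblem

variable {J : E →L[ℝ] E} {Λ : Submodule ℝ E} {S : ℝ → E →L[ℝ] E} {ι : Type*} {x : ι → ℝ → E}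
  {μ : ι → ℝ}

theorem inner_map_left (h : SpectralProblem J Λ S x μ) (v w : E) : ⟪J v, w⟫ = -⟪v, J w⟫ := by
  have h1 : ∀ v w : E, ⟪J v, J w⟫ = ⟪v, w⟫ :=
    (LinearMap.norm_map_iff_inner_map_map J).1 h.norm_map
  have h2 := h1 v (J w)
  rw [h.map_map, inner_neg_right] at h2
  linarith

theorem continuous_eigenfunction (h : SpectralProblem J Λ S x μ) (i : ι) : Continuous (x i) :=
  (h.eigen.1 i).continuous

theorem memLp_eigenfunction (h : SpectralProblem J Λ S x μ) (i : ι) :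
    MemLp (x i) 2 (volume.restrict (Icc (0 : ℝ) 1)) :=
  memLp_of_continuousOn (h.continuous_eigenfunction i).continuousOn

theorem hasDerivAt_eigenfunction (h : SpectralProblem J Λ S x μ) (i : ι) (t : ℝ) :
    HasDerivAt (x i) (deriv (x i) t) t :=
  ((h.eigen.1 i).differentiable (by simp)).differentiableAt.hasDerivAt

theorem continuous_deriv_eigenfunction (h : SpectralProblem J Λ S x μ) (i : ι) :
    Continuous (deriv (x i)) :=
  (h.eigen.1 i).continuous_deriv (by simp)

theorem orthonormal (h : SpectralProblem J Λ S x μ) (i j : ι) :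
    ∫ t in Icc (0 : ℝ) 1, ⟪x i t, x j t⟫ = if i = j then 1 else 0 := by
  rw [← intervalIntegral_eq_setIntegral_Icc, h.eigen.2.2.2.2.1]

theorem memLp_sum (h : SpectralProblem J Λ S x μ) (c : ι → ℝ) (F : Finset ι) :
    MemLp (fun t => ∑ i ∈ F, c i • x i t) 2 (volume.restrict (Icc (0 : ℝ) 1)) :=
  memLp_finsetSum _ fun i _ => (h.memLp_eigenfunction i).const_smul (c i)

theorem integral_inner_sum (h : SpectralProblem J Λ S x μ) {f : ℝ → E}
    (hf : MemLp f 2 (volume.restrict (Icc (0 : ℝ) 1))) (c : ι → ℝ) (F : Finset ι) :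
    ∫ t in Icc (0 : ℝ) 1, ⟪f t, ∑ i ∈ F, c i • x i t⟫ = ∑ i ∈ F, c i * coeff x f i := by
  simp only [inner_sum, real_inner_smul_right]
  rw [integral_finsetSum _ fun i _ =>
    (MemLp.integrable_inner_two hf (h.memLp_eigenfunction i)).const_mul _]
  simp only [integral_const_mul, coeff_eq]

theorem coeff_sum (h : SpectralProblem J Λ S x μ) (c : ι → ℝ) (F : Finset ι) (j : ι) :
    coeff x (fun t => ∑ i ∈ F, c i • x i t) j = if j ∈ F then c j else 0 := by
  rw [coeff_eq]
  simp only [real_inner_comm (x j _)]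
  rw [h.integral_inner_sum (h.memLp_eigenfunction j)]
  simp only [coeff_eq, h.orthonormal]
  simp

theorem integral_norm_sum_sq (h : SpectralProblem J Λ S x μ) (c : ι → ℝ) (F : Finset ι) :
    ∫ t in Icc (0 : ℝ) 1, ‖∑ i ∈ F, c i • x i t‖ ^ 2 = ∑ i ∈ F, c i ^ 2 := by
  simp only [← real_inner_self_eq_norm_sq]
  rw [h.integral_inner_sum (h.memLp_sum c F)]
  refine Finset.sum_congr rfl fun i hi => ?_
  rw [h.coeff_sum, if_pos hi, sq]

theorem integral_norm_residual_sq (h : SpectralProblem J Λ S x μ) {f : ℝ → E}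
    (hf : MemLp f 2 (volume.restrict (Icc (0 : ℝ) 1))) (F : Finset ι) :
    ∫ t in Icc (0 : ℝ) 1, ‖f t - ∑ i ∈ F, coeff x f i • x i t‖ ^ 2 =
      (∫ t in Icc (0 : ℝ) 1, ‖f t‖ ^ 2) - ∑ i ∈ F, coeff x f i ^ 2 := by
  rw [integral_norm_sub_sq hf (h.memLp_sum _ F), h.integral_inner_sum hf, h.integral_norm_sum_sq]
  simp only [← sq]
  ring

theorem sum_coeff_sq_le (h : SpectralProblem J Λ S x μ) {f : ℝ → E}
    (hf : MemLp f 2 (volume.restrict (Icc (0 : ℝ) 1))) (F : Finset ι) :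
    ∑ i ∈ F, coeff x f i ^ 2 ≤ ∫ t in Icc (0 : ℝ) 1, ‖f t‖ ^ 2 := by
  have h1 := h.integral_norm_residual_sq hf F
  have : 0 ≤ ∫ t in Icc (0 : ℝ) 1, ‖f t - ∑ i ∈ F, coeff x f i • x i t‖ ^ 2 :=
    integral_nonneg fun _ => sq_nonneg _
  linarith

theorem summable_coeff_sq (h : SpectralProblem J Λ S x μ) {f : ℝ → E}
    (hf : MemLp f 2 (volume.restrict (Icc (0 : ℝ) 1))) : Summable fun i => coeff x f i ^ 2 :=
  summable_of_sum_le (fun _ => sq_nonneg _) (h.sum_coeff_sq_le hf)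

theorem continuous_coefficient (h : SpectralProblem J Λ S x μ) : Continuous S :=
  h.smooth.continuous

theorem memLp_op (h : SpectralProblem J Λ S x μ) {f f' : ℝ → E}
    (hf : ContinuousOn f (Icc 0 1)) (hf' : MemLp f' 2 (volume.restrict (Icc (0 : ℝ) 1))) :
    MemLp (fun t => J (f' t) + S t (f t)) 2 (volume.restrict (Icc (0 : ℝ) 1)) :=
  (J.comp_memLp' hf').add
    (memLp_of_continuousOn (h.continuous_coefficient.continuousOn.clm_apply hf))

/-- Integration by parts for `J ∂ₜ + S`. -/
theorem green (h : SpectralProblem J Λ S x μ) {f f' g g' : ℝ → E}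
    (hd : ∀ t ∈ Icc (0 : ℝ) 1, HasDerivWithinAt f (f' t) (Icc 0 1) t)
    (hf' : MemLp f' 2 (volume.restrict (Icc (0 : ℝ) 1)))
    (hg : ∀ t, HasDerivAt g (g' t) t) (hg' : Continuous g') :
    ∫ t in Icc (0 : ℝ) 1, ⟪J (f' t) + S t (f t), g t⟫ =
      ⟪J (f 1), g 1⟫ - ⟪J (f 0), g 0⟫ + ∫ t in Icc (0 : ℝ) 1, ⟪f t, J (g' t) + S t (g t)⟫ := by
  have hgc : Continuous g := continuous_iff_continuousAt.2 fun t => (hg t).continuousAt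
  have hfc : ContinuousOn f (Icc 0 1) := fun t ht => (hd t ht).continuousWithinAt
  have i1 := MemLp.integrable_inner_two (h.memLp_op hfc hf')
    (memLp_of_continuousOn hgc.continuousOn)
  have i2 := MemLp.integrable_inner_two (memLp_of_continuousOn hfc)
    (h.memLp_op hgc.continuousOn (memLp_of_continuousOn hg'.continuousOn))
  have h1 : ∫ t in (0 : ℝ)..1, (⟪J (f' t) + S t (f t), g t⟫ - ⟪f t, J (g' t) + S t (g t)⟫) =
      ⟪J (f 1), g 1⟫ - ⟪J (f 0), g 0⟫ := by
    apply intervalIntegral.integral_eq_sub_of_hasDerivAt_of_le zero_le_one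
      (f := fun t => ⟪J (f t), g t⟫)
    · exact (J.continuous.comp_continuousOn hfc).inner hgc.continuousOn
    · intro t ht
      have h2 : HasDerivAt (fun t => J (f t)) (J (f' t)) t :=
        J.hasFDerivAt.comp_hasDerivAt t
          ((hd t (Ioo_subset_Icc_self ht)).hasDerivAt (Icc_mem_nhds ht.1 ht.2))
      refine (h2.inner ℝ (hg t)).congr_deriv ?_
      simp only [inner_add_left, inner_add_right, h.symm t, h.inner_map_left]
      ring
    · rw [intervalIntegrable_iff_integrableOn_Icc_of_le zero_le_one]
      exact i1.sub i2
  rw [intervalIntegral_eq_setIntegral_Icc, integral_sub i1 i2] at h1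
  linarith

theorem eigen_boundary (h : SpectralProblem J Λ S x μ) {f f' : ℝ → E}
    (hf : AdmissiblePath Λ f f') (i : ι) :
    ⟪J (f 1), x i 1⟫ = 0 ∧ ⟪J (f 0), x i 0⟫ = 0 :=
  ⟨Submodule.inner_left_of_mem_orthogonal (h.eigen.2.2.1 i).2 (h.lagrangian _ hf.right),
    Submodule.inner_left_of_mem_orthogonal (h.eigen.2.2.1 i).1 (h.lagrangian _ hf.left)⟩

theorem coeff_op (h : SpectralProblem J Λ S x μ) {f f' : ℝ → E} (hf : AdmissiblePath Λ f f')
    (i : ι) : coeff x (fun t => J (f' t) + S t (f t)) i = μ i * coeff x f i := by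
  rw [coeff_eq, h.green hf.deriv hf.memLp (h.hasDerivAt_eigenfunction i)
    (h.continuous_deriv_eigenfunction i), (h.eigen_boundary hf i).1, (h.eigen_boundary hf i).2]
  simp only [h.eigen.2.2.2.1, real_inner_smul_right, integral_const_mul, coeff_eq]
  ring

end SpectralProblem

namespace SpectralProblem

variable {J : E →L[ℝ] E} {Λ : Submodule ℝ E} {S : ℝ → E →L[ℝ] E} {ι : Type*} {x : ι → ℝ → E}
  {μ : ι → ℝ}

theorem op_sum (h : SpectralProblem J Λ S x μ) (c : ι → ℝ) (F : Finset ι) (t : ℝ) :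
    J (∑ i ∈ F, c i • deriv (x i) t) + S t (∑ i ∈ F, c i • x i t) =
      ∑ i ∈ F, (μ i * c i) • x i t := by
  simp only [map_sum, map_smul, ← Finset.sum_add_distrib, ← smul_add, h.eigen.2.2.2.1, smul_smul,
    mul_comm]

theorem hasDerivAt_sum (h : SpectralProblem J Λ S x μ) (c : ι → ℝ) (F : Finset ι) (t : ℝ) :
    HasDerivAt (fun t => ∑ i ∈ F, c i • x i t) (∑ i ∈ F, c i • deriv (x i) t) t :=
  HasDerivAt.fun_sum fun i _ => (h.hasDerivAt_eigenfunction i t).const_smul (c i)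

theorem memLp_sum_deriv (h : SpectralProblem J Λ S x μ) (c : ι → ℝ) (F : Finset ι) :
    MemLp (fun t => ∑ i ∈ F, c i • deriv (x i) t) 2 (volume.restrict (Icc (0 : ℝ) 1)) :=
  memLp_finsetSum _ fun i _ =>
    (memLp_of_continuousOn (h.continuous_deriv_eigenfunction i).continuousOn).const_smul (c i)

theorem exists_norm_coefficient_le (h : SpectralProblem J Λ S x μ) :
    ∃ K : ℝ, 0 ≤ K ∧ ∀ t ∈ Icc (0 : ℝ) 1, ‖S t‖ ≤ K := by
  obtain ⟨K, hK⟩ := (isCompact_Icc (a := (0 : ℝ)) (b := 1)).exists_bound_of_continuousOn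
    h.continuous_coefficient.continuousOn
  exact ⟨K, (norm_nonneg _).trans (hK 0 (by simp)), hK⟩

theorem exists_norm_sq_le (h : SpectralProblem J Λ S x μ) :
    ∃ C : ℝ, 0 ≤ C ∧ ∀ f f' : ℝ → E,
      (∀ t ∈ Icc (0 : ℝ) 1, HasDerivWithinAt f (f' t) (Icc 0 1) t) →
      MemLp f' 2 (volume.restrict (Icc (0 : ℝ) 1)) → ∀ t ∈ Icc (0 : ℝ) 1,
      ‖f t‖ ^ 2 ≤ C * ((∫ t in Icc (0 : ℝ) 1, ‖f t‖ ^ 2) +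
        ∫ t in Icc (0 : ℝ) 1, ‖J (f' t) + S t (f t)‖ ^ 2) := by
  obtain ⟨K, hK0, hK⟩ := h.exists_norm_coefficient_le
  refine ⟨2 + 2 * K ^ 2, by positivity, fun f f' hd hf' t ht => ?_⟩
  have hfc : ContinuousOn f (Icc 0 1) := fun t ht => (hd t ht).continuousWithinAt
  have hf := memLp_of_continuousOn hfc
  have hA := h.memLp_op hfc hf'
  have i1 : IntegrableOn (fun t => ‖f t‖ ^ 2) (Icc (0 : ℝ) 1) :=
    hf.integrable_norm_pow two_ne_zero
  have i2 : IntegrableOn (fun t => ‖J (f' t) + S t (f t)‖ ^ 2) (Icc (0 : ℝ) 1) :=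
    hA.integrable_norm_pow two_ne_zero
  have i3 : IntegrableOn (fun t => 2 * ⟪f t, f' t⟫) (Icc (0 : ℝ) 1) :=
    (MemLp.integrable_inner_two hf hf').const_mul 2
  have h1 := le_integral_add_integral_deriv (I := Icc (0 : ℝ) 1) (F := fun t => ‖f t‖ ^ 2)
    (F' := fun t => 2 * ⟪f t, f' t⟫) (hfc.norm.pow 2) (fun s hs => ?_) i1 i3 zero_lt_one
    subset_rfl ht
  · have h2 : ∫ t in Icc (0 : ℝ) 1, |2 * ⟪f t, f' t⟫| ≤ ∫ t in Icc (0 : ℝ) 1,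
        ((1 + 2 * K ^ 2) * ‖f t‖ ^ 2 + 2 * ‖J (f' t) + S t (f t)‖ ^ 2) := by
      refine setIntegral_mono_on i3.abs ((i1.const_mul _).add (i2.const_mul _)) measurableSet_Icc
        fun s hs => ?_
      have h3 : ‖f' s‖ ≤ ‖J (f' s) + S s (f s)‖ + K * ‖f s‖ := by
        rw [← h.norm_map (f' s)]
        have h4 := norm_sub_le (J (f' s) + S s (f s)) (S s (f s))
        rw [add_sub_cancel_right] at h4
        have h5 := (S s).le_of_opNorm_le (hK s hs) (f s)
        linarith
      have h6 := abs_real_inner_le_norm (f s) (f' s)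
      rw [abs_mul, abs_two]
      have h7 : ‖f' s‖ ^ 2 ≤ (‖J (f' s) + S s (f s)‖ + K * ‖f s‖) ^ 2 :=
        pow_le_pow_left₀ (norm_nonneg _) h3 2
      nlinarith [sq_nonneg (‖f s‖ - ‖f' s‖), sq_nonneg (‖J (f' s) + S s (f s)‖ - K * ‖f s‖)]
    rw [integral_add (i1.const_mul _) (i2.const_mul _), integral_const_mul,
      integral_const_mul] at h2
    simp only [abs_sq, sub_zero, inv_one, one_mul] at h1
    have h8 : 0 ≤ ∫ t in Icc (0 : ℝ) 1, ‖J (f' t) + S t (f t)‖ ^ 2 :=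
      integral_nonneg fun _ => sq_nonneg _
    nlinarith [mul_nonneg (sq_nonneg K) h8]
  · rw [interior_Icc] at hs
    exact ((hd s (Ioo_subset_Icc_self hs)).hasDerivAt (Icc_mem_nhds hs.1 hs.2)).norm_sq

theorem exists_norm_sum_sq_le (h : SpectralProblem J Λ S x μ) :
    ∃ C : ℝ, 0 ≤ C ∧ ∀ (c : ι → ℝ) (F : Finset ι), ∀ t ∈ Icc (0 : ℝ) 1,
      ‖∑ i ∈ F, c i • x i t‖ ^ 2 ≤ C * ∑ i ∈ F, (1 + μ i ^ 2) * c i ^ 2 := by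
  obtain ⟨C, hC, hb⟩ := h.exists_norm_sq_le
  refine ⟨C, hC, fun c F t ht => ?_⟩
  have h1 := hb _ _ (fun t _ => (h.hasDerivAt_sum c F t).hasDerivWithinAt)
    (h.memLp_sum_deriv c F) t ht
  simp only [h.op_sum, h.integral_norm_sum_sq] at h1
  rw [← Finset.sum_add_distrib] at h1
  convert h1 using 3
  ring

theorem finite_abs_eigenvalue_le [FiniteDimensional ℝ E] (h : SpectralProblem J Λ S x μ) (N : ℝ) :
    {i | |μ i| ≤ N}.Finite := by
  obtain ⟨C, hC, hb⟩ := h.exists_norm_sum_sq_le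
  set D : ℝ := C * (1 + N ^ 2) with hD
  have hD0 : 0 ≤ D := by positivity
  set n := Module.finrank ℝ E
  have key : ∀ F : Finset ι, (∀ i ∈ F, |μ i| ≤ N) → (F.card : ℝ) ≤ n * D := by
    intro F hF
    have h1 : ∀ t ∈ Icc (0 : ℝ) 1, ∀ e : E, ‖e‖ = 1 → ∑ i ∈ F, ⟪x i t, e⟫ ^ 2 ≤ D := by
      intro t ht e he
      set Q := ∑ i ∈ F, ⟪x i t, e⟫ ^ 2 with hQ
      have hQ0 : 0 ≤ Q := Finset.sum_nonneg fun _ _ => sq_nonneg _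
      have h2 := hb (fun i => ⟪x i t, e⟫) F t ht
      have h3 : ∑ i ∈ F, (1 + μ i ^ 2) * ⟪x i t, e⟫ ^ 2 ≤ (1 + N ^ 2) * Q := by
        rw [hQ, Finset.mul_sum]
        refine Finset.sum_le_sum fun i hi => mul_le_mul_of_nonneg_right ?_ (sq_nonneg _)
        have := pow_le_pow_left₀ (abs_nonneg _) (hF i hi) 2
        rw [sq_abs] at this
        linarith
      have h4 : Q = ⟪∑ i ∈ F, ⟪x i t, e⟫ • x i t, e⟫ := by
        simp only [sum_inner, real_inner_smul_left, hQ, sq]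
      have h5 : Q ≤ ‖∑ i ∈ F, ⟪x i t, e⟫ • x i t‖ := by
        rw [h4]
        simpa [he] using real_inner_le_norm (∑ i ∈ F, ⟪x i t, e⟫ • x i t) e
      have h6 : Q ^ 2 ≤ D * Q := by
        calc Q ^ 2 ≤ ‖∑ i ∈ F, ⟪x i t, e⟫ • x i t‖ ^ 2 := pow_le_pow_left₀ hQ0 h5 2
          _ ≤ C * ((1 + N ^ 2) * Q) := h2.trans (mul_le_mul_of_nonneg_left h3 hC)
          _ = D * Q := by rw [hD]; ring
      by_contra hlt
      push Not at hlt
      nlinarith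
    have h2 : ∀ t ∈ Icc (0 : ℝ) 1, ∑ i ∈ F, ‖x i t‖ ^ 2 ≤ n * D := by
      intro t ht
      have h3 : ∀ i, ‖x i t‖ ^ 2 = ∑ k, ⟪x i t, stdOrthonormalBasis ℝ E k⟫ ^ 2 := fun i => by
        rw [← OrthonormalBasis.sum_sq_norm_inner_left (stdOrthonormalBasis ℝ E) (x i t)]
        simp
      simp only [h3]
      rw [Finset.sum_comm]
      refine (Finset.sum_le_card_nsmul _ _ D fun k _ => h1 t ht _ (by simp)).trans ?_
      simp [n]
    have i0 : ∀ i, Integrable (fun t => ‖x i t‖ ^ 2) (volume.restrict (Icc (0 : ℝ) 1)) :=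
      fun i => (h.memLp_eigenfunction i).integrable_norm_pow two_ne_zero
    have h3 : ∫ t in Icc (0 : ℝ) 1, ∑ i ∈ F, ‖x i t‖ ^ 2 ≤ ∫ t in Icc (0 : ℝ) 1, n * D :=
      setIntegral_mono_on (integrable_finsetSum _ fun i _ => i0 i)
        (integrableOn_const (by simp)) measurableSet_Icc h2
    rw [integral_finsetSum _ fun i _ => i0 i] at h3
    simp only [← real_inner_self_eq_norm_sq, h.orthonormal] at h3
    simpa using h3
  by_contra hinf
  obtain ⟨m, hm⟩ := exists_nat_gt (n * D)
  obtain ⟨F, hF1, hF2⟩ := Set.Infinite.exists_subset_card_eq hinf m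
  have := key F fun i hi => hF1 hi
  rw [hF2] at this
  linarith

theorem countable_index [FiniteDimensional ℝ E] (h : SpectralProblem J Λ S x μ) : Countable ι := by
  have h1 : (univ : Set ι) = ⋃ k : ℕ, {i | |μ i| ≤ k} := by
    ext i
    simpa using exists_nat_ge |μ i|
  rw [← countable_univ_iff, h1]
  exact countable_iUnion fun k => (h.finite_abs_eigenvalue_le k).countable

theorem exists_le_abs_eigenvalue [FiniteDimensional ℝ E] (h : SpectralProblem J Λ S x μ) :
    ∃ m : ℝ, 0 < m ∧ ∀ i, m ≤ |μ i| := by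
  have hfin := h.finite_abs_eigenvalue_le 1
  set T := insert 1 (hfin.toFinset.image fun i => |μ i|) with hT
  have hne : T.Nonempty := ⟨1, by simp [hT]⟩
  refine ⟨T.min' hne, ?_, fun i => ?_⟩
  · rw [Finset.lt_min'_iff]
    intro y hy
    rw [hT, Finset.mem_insert, Finset.mem_image] at hy
    rcases hy with rfl | ⟨i, _, rfl⟩
    · exact one_pos
    · exact abs_pos.2 (h.eigen.2.1 i)
  · by_cases hi : |μ i| ≤ 1
    · refine Finset.min'_le _ _ ?_
      rw [hT, Finset.mem_insert, Finset.mem_image]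
      exact Or.inr ⟨i, hfin.mem_toFinset.2 hi, rfl⟩
    · exact (Finset.min'_le _ 1 (by simp [hT])).trans (not_le.1 hi).le

end SpectralProblem

theorem integral_norm_sq_le_of_eLpNorm_le {G : Type*} [NormedAddCommGroup G] {α : Type*}
    {mα : MeasurableSpace α} {ν : Measure α} {f : α → G} (hf : MemLp f 2 ν) {ε : ℝ} (hε : 0 ≤ ε)
    (h : eLpNorm f 2 ν ≤ ENNReal.ofReal ε) : ∫ a, ‖f a‖ ^ 2 ∂ν ≤ ε ^ 2 := by
  rw [hf.eLpNorm_eq_integral_rpow_norm two_ne_zero ENNReal.ofNat_ne_top,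
    ENNReal.ofReal_le_ofReal_iff hε] at h
  simp only [ENNReal.toReal_ofNat, Real.rpow_two] at h
  have h0 : 0 ≤ ∫ a, ‖f a‖ ^ 2 ∂ν := integral_nonneg fun _ => sq_nonneg _
  have h1 := pow_le_pow_left₀ (Real.rpow_nonneg h0 _) h 2
  rwa [← Real.rpow_natCast, ← Real.rpow_mul h0, show (2 : ℝ)⁻¹ * (2 : ℕ) = 1 by norm_num,
    Real.rpow_one] at h1

theorem integral_Icc_norm_sq_le {G : Type*} [NormedAddCommGroup G] {f : ℝ → G} {ε : ℝ}
    (h : ∀ t ∈ Icc (0 : ℝ) 1, ‖f t‖ ≤ ε) : ∫ t in Icc (0 : ℝ) 1, ‖f t‖ ^ 2 ≤ ε ^ 2 := by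
  have h1 := norm_setIntegral_le_of_norm_le_const (μ := volume) (s := Icc (0 : ℝ) 1)
    (f := fun t => ‖f t‖ ^ 2) (C := ε ^ 2) (by simp) fun t ht => by
      rw [Real.norm_of_nonneg (sq_nonneg _)]
      exact pow_le_pow_left₀ (norm_nonneg _) (h t ht) 2
  rw [Real.volume_real_Icc_of_le zero_le_one, sub_zero, mul_one] at h1
  exact (le_abs_self _).trans h1

theorem hasSum_of_forall_exists_sub_le {ι : Type*} {c : ι → ℝ} {a : ℝ}
    (hle : ∀ F : Finset ι, ∑ i ∈ F, c i ≤ a)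
    (h : ∀ ε > 0, ∃ F₀ : Finset ι, ∀ F, F₀ ⊆ F → a - ∑ i ∈ F, c i ≤ ε) : HasSum c a := by
  rw [HasSum, SummationFilter.unconditional_filter, Metric.tendsto_atTop]
  intro ε hε
  obtain ⟨F₀, hF₀⟩ := h (ε / 2) (half_pos hε)
  refine ⟨F₀, fun F hF => ?_⟩
  rw [Real.dist_eq, abs_sub_comm, abs_of_nonneg (sub_nonneg.2 (hle F))]
  linarith [hF₀ F hF]

namespace SpectralProblem

variable {J : E →L[ℝ] E} {Λ : Submodule ℝ E} {S : ℝ → E →L[ℝ] E} {ι : Type*} {x : ι → ℝ → E}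
  {μ : ι → ℝ}

theorem coeff_sub (h : SpectralProblem J Λ S x μ) {f g : ℝ → E}
    (hf : MemLp f 2 (volume.restrict (Icc (0 : ℝ) 1)))
    (hg : MemLp g 2 (volume.restrict (Icc (0 : ℝ) 1))) (i : ι) :
    coeff x (fun t => f t - g t) i = coeff x f i - coeff x g i := by
  simp only [coeff_eq, inner_sub_left]
  exact integral_sub (MemLp.integrable_inner_two hf (h.memLp_eigenfunction i))
    (MemLp.integrable_inner_two hg (h.memLp_eigenfunction i))

theorem coeff_add (h : SpectralProblem J Λ S x μ) {f g : ℝ → E}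
    (hf : MemLp f 2 (volume.restrict (Icc (0 : ℝ) 1)))
    (hg : MemLp g 2 (volume.restrict (Icc (0 : ℝ) 1))) (i : ι) :
    coeff x (fun t => f t + g t) i = coeff x f i + coeff x g i := by
  simp only [coeff_eq, inner_add_left]
  exact integral_add (MemLp.integrable_inner_two hf (h.memLp_eigenfunction i))
    (MemLp.integrable_inner_two hg (h.memLp_eigenfunction i))

/-- The eigenfunction expansion of an admissible path converges uniformly. -/
theorem exists_norm_sub_sum_le [CompleteSpace E] (h : SpectralProblem J Λ S x μ) {f f' : ℝ → E}
    (hf : AdmissiblePath Λ f f') {ε : ℝ} (hε : 0 < ε) :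
    ∃ F₀ : Finset ι, ∀ F, F₀ ⊆ F → ∀ t ∈ Icc (0 : ℝ) 1,
      ‖f t - ∑ i ∈ F, coeff x f i • x i t‖ ≤ ε := by
  have hfm := memLp_of_continuousOn hf.continuousOn
  set c := coeff x f with hc
  have hs : Summable fun i => (1 + μ i ^ 2) * c i ^ 2 := by
    refine ((h.summable_coeff_sq hfm).add
      (h.summable_coeff_sq (h.memLp_op hf.continuousOn hf.memLp))).congr fun i => ?_
    rw [h.coeff_op hf]
    ring
  obtain ⟨C, hC, hb⟩ := h.exists_norm_sum_sq_le
  let g : ι → C(Icc (0 : ℝ) 1, E) := fun i =>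
    ⟨fun t => c i • x i t, ((h.continuous_eigenfunction i).comp continuous_subtype_val).const_smul _⟩
  have hg : ∀ (F : Finset ι) (t : Icc (0 : ℝ) 1), (∑ i ∈ F, g i) t = ∑ i ∈ F, c i • x i t := by
    intro F t
    rw [ContinuousMap.sum_apply]
    rfl
  have hsum : Summable g := by
    rw [summable_iff_vanishing_norm]
    intro δ hδ
    obtain ⟨F₀, hF₀⟩ := summable_iff_vanishing_norm.1 hs (δ ^ 2 / (4 * (C + 1))) (by positivity)
    refine ⟨F₀, fun F hF => ?_⟩
    have h1 := (le_abs_self _).trans_lt (hF₀ F hF)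
    refine lt_of_le_of_lt ?_ (half_lt_self hδ)
    rw [ContinuousMap.norm_le _ (half_pos hδ).le]
    intro t
    rw [hg]
    refine abs_le_of_sq_le_sq' ?_ (half_pos hδ).le |>.2
    refine (hb c F t t.2).trans ?_
    rw [lt_div_iff₀ (by positivity)] at h1
    have h2 : 0 ≤ ∑ i ∈ F, (1 + μ i ^ 2) * c i ^ 2 :=
      Finset.sum_nonneg fun i _ => by positivity
    nlinarith
  obtain ⟨y, hy⟩ := hsum
  have hconv : ∀ δ > 0, ∃ F₀ : Finset ι, ∀ F, F₀ ⊆ F → ∀ t : Icc (0 : ℝ) 1,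
      ‖y t - ∑ i ∈ F, c i • x i t‖ ≤ δ := by
    intro δ hδ
    rw [HasSum, SummationFilter.unconditional_filter, Metric.tendsto_atTop] at hy
    obtain ⟨F₀, hF₀⟩ := hy δ hδ
    refine ⟨F₀, fun F hF t => ?_⟩
    have h1 := hF₀ F hF
    rw [dist_comm, dist_eq_norm] at h1
    rw [← hg]
    exact ((y - ∑ i ∈ F, g i).norm_coe_le_norm t).trans h1.le
  let Y : ℝ → E := fun t => y (projIcc 0 1 zero_le_one t)
  have hYc : Continuous Y := y.continuous.comp continuous_projIcc
  have hYm : MemLp Y 2 (volume.restrict (Icc (0 : ℝ) 1)) := memLp_of_continuousOn hYc.continuousOn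
  have hY : ∀ t (ht : t ∈ Icc (0 : ℝ) 1), Y t = y ⟨t, ht⟩ := fun t ht => by
    simp only [Y, projIcc_of_mem _ ht]
  have hYcoeff : ∀ i, coeff x Y i = c i := by
    intro i
    by_contra hne
    have hpos : 0 < (coeff x Y i - c i) ^ 2 := by
      have := sub_ne_zero.2 hne
      positivity
    obtain ⟨F₀, hF₀⟩ := hconv (|coeff x Y i - c i| / 2) (by
      have := abs_pos.2 (sub_ne_zero.2 hne)
      linarith)
    have h1 := h.sum_coeff_sq_le (hYm.sub (h.memLp_sum c (insert i F₀))) {i}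
    have h2 := integral_Icc_norm_sq_le (f := fun t => Y t - ∑ i ∈ insert i F₀, c i • x i t)
      fun t ht => by
        have := hF₀ (insert i F₀) (Finset.subset_insert _ _) ⟨t, ht⟩
        rwa [← hY t ht] at this
    rw [Finset.sum_singleton] at h1
    simp only [Pi.sub_def] at h1
    rw [h.coeff_sub hYm (h.memLp_sum c _), h.coeff_sum, if_pos (Finset.mem_insert_self _ _)] at h1
    rw [div_pow, sq_abs] at h2
    linarith
  have hfY : ∀ t ∈ Icc (0 : ℝ) 1, f t - Y t = 0 := by
    refine h.eigen.2.2.2.2.2 (fun t => f t - Y t) (hf.continuousOn.sub hYc.continuousOn) fun i => ?_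
    have h1 := h.coeff_sub hfm hYm i
    rw [hYcoeff, hc, sub_self] at h1
    exact h1
  obtain ⟨F₀, hF₀⟩ := hconv ε hε
  refine ⟨F₀, fun F hF t ht => ?_⟩
  rw [sub_eq_zero.1 (hfY t ht), hY t ht]
  exact hF₀ F hF ⟨t, ht⟩

theorem hasSum_coeff_sq [CompleteSpace E] (h : SpectralProblem J Λ S x μ) {f f' : ℝ → E}
    (hf : AdmissiblePath Λ f f') :
    HasSum (fun i => coeff x f i ^ 2) (∫ t in Icc (0 : ℝ) 1, ‖f t‖ ^ 2) := by
  have hfm := memLp_of_continuousOn hf.continuousOn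
  refine hasSum_of_forall_exists_sub_le (h.sum_coeff_sq_le hfm) fun ε hε => ?_
  obtain ⟨F₀, hF₀⟩ := h.exists_norm_sub_sum_le hf (Real.sqrt_pos.2 hε)
  refine ⟨F₀, fun F hF => ?_⟩
  rw [← h.integral_norm_residual_sq hfm]
  exact (integral_Icc_norm_sq_le (hF₀ F hF)).trans_eq (Real.sq_sqrt hε.le)

theorem hasSum_coeff_op_sq [FiniteDimensional ℝ E] (h : SpectralProblem J Λ S x μ)
    {f f' : ℝ → E} (hf : AdmissiblePath Λ f f') :
    HasSum (fun i => μ i ^ 2 * coeff x f i ^ 2)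
      (∫ t in Icc (0 : ℝ) 1, ‖J (f' t) + S t (f t)‖ ^ 2) := by
  have hgm := h.memLp_op hf.continuousOn hf.memLp
  set g : ℝ → E := fun t => J (f' t) + S t (f t) with hg
  have hcoeff : ∀ i, μ i ^ 2 * coeff x f i ^ 2 = coeff x g i ^ 2 := fun i => by
    rw [h.coeff_op hf, mul_pow]
  simp only [hcoeff]
  refine hasSum_of_forall_exists_sub_le (h.sum_coeff_sq_le hgm) fun ε hε => ?_
  set δ := Real.sqrt (ε / 2) with hδ
  have hδ0 : 0 < δ := Real.sqrt_pos.2 (half_pos hε)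
  obtain ⟨φ, -, hφ, hφg⟩ := hgm.exist_eLpNorm_sub_le ENNReal.ofNat_ne_top one_le_two hδ0
  have hφd : ∀ t, HasDerivAt φ (deriv φ t) t := fun t =>
    (hφ.differentiable (by simp)).differentiableAt.hasDerivAt
  have hφm : MemLp φ 2 (volume.restrict (Icc (0 : ℝ) 1)) :=
    memLp_of_continuousOn hφ.continuous.continuousOn
  have hφg2 := integral_norm_sq_le_of_eLpNorm_le (hgm.sub hφm) hδ0.le hφg
  rw [hδ, Real.sq_sqrt (half_pos hε).le] at hφg2
  have hφ' : Continuous (deriv φ) := hφ.continuous_deriv (by simp)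
  have hAφ : Continuous fun t => J (deriv φ t) + S t (φ t) :=
    (J.continuous.comp hφ').add (h.continuous_coefficient.clm_apply hφ.continuous)
  obtain ⟨K, hK⟩ := (isCompact_Icc (a := (0 : ℝ)) (b := 1)).exists_bound_of_continuousOn
    hAφ.continuousOn
  have hK0 : 0 ≤ K := (norm_nonneg _).trans (hK 0 (by simp))
  obtain ⟨F₀, hF₀⟩ := h.exists_norm_sub_sum_le hf (ε := ε / (4 * (‖φ 1‖ + ‖φ 0‖ + K + 1)))
    (by positivity)
  set η := ε / (4 * (‖φ 1‖ + ‖φ 0‖ + K + 1)) with hη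
  have hη0 : 0 < η := by positivity
  refine ⟨F₀, fun F hF => ?_⟩
  have hu := hF₀ F hF
  set u : ℝ → E := fun t => f t - ∑ i ∈ F, coeff x f i • x i t with hu_def
  set u' : ℝ → E := fun t => f' t - ∑ i ∈ F, coeff x f i • deriv (x i) t with hu'_def
  set r : ℝ → E := fun t => g t - ∑ i ∈ F, coeff x g i • x i t with hr
  have hru : ∀ t, r t = J (u' t) + S t (u t) := by
    intro t
    have h1 := h.op_sum (coeff x f) F t
    have h2 : ∑ i ∈ F, coeff x g i • x i t = ∑ i ∈ F, (μ i * coeff x f i) • x i t :=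
      Finset.sum_congr rfl fun i _ => by rw [h.coeff_op hf]
    simp only [hr, h2, ← h1, hu_def, hu'_def, map_sub]
    simp only [hg]
    abel
  have hud : ∀ t ∈ Icc (0 : ℝ) 1, HasDerivWithinAt u (u' t) (Icc 0 1) t := fun t ht =>
    (hf.deriv t ht).sub (h.hasDerivAt_sum _ F t).hasDerivWithinAt
  have hu'm : MemLp u' 2 (volume.restrict (Icc (0 : ℝ) 1)) := hf.memLp.sub (h.memLp_sum_deriv _ F)
  have hrm : MemLp r 2 (volume.restrict (Icc (0 : ℝ) 1)) := hgm.sub (h.memLp_sum _ F)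
  have hN := h.integral_norm_residual_sq hgm F
  have hrg : ∫ t in Icc (0 : ℝ) 1, ⟪r t, g t⟫ = ∫ t in Icc (0 : ℝ) 1, ‖r t‖ ^ 2 := by
    rw [hN]
    have h1 := h.integral_inner_sum hgm (coeff x g) F
    have h2 : ∀ t, ⟪r t, g t⟫ = ⟪g t, g t⟫ - ⟪g t, ∑ i ∈ F, coeff x g i • x i t⟫ := fun t => by
      rw [hr, inner_sub_left, real_inner_comm (g t) (∑ i ∈ F, coeff x g i • x i t)]
    simp only [h2]
    rw [integral_sub (MemLp.integrable_inner_two hgm hgm)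
      (MemLp.integrable_inner_two hgm (h.memLp_sum _ F)), h1]
    simp only [real_inner_self_eq_norm_sq, sq]
  have h1 : ∫ t in Icc (0 : ℝ) 1, ⟪r t, g t⟫ =
      (∫ t in Icc (0 : ℝ) 1, ⟪r t, φ t⟫) + ∫ t in Icc (0 : ℝ) 1, ⟪r t, g t - φ t⟫ := by
    have h2 : Integrable (fun t => ⟪r t, g t - φ t⟫) (volume.restrict (Icc (0 : ℝ) 1)) :=
      MemLp.integrable_inner_two hrm (hgm.sub hφm)
    rw [← integral_add (MemLp.integrable_inner_two hrm hφm) h2]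
    simp only [← inner_add_right, add_sub_cancel]
  have h2 := integral_inner_le hrm (hgm.sub hφm)
  simp only [Pi.sub_apply] at h2 hφg2
  have h3 : ∫ t in Icc (0 : ℝ) 1, ⟪r t, φ t⟫ ≤ ε / 4 := by
    simp only [hru]
    rw [h.green hud hu'm hφd hφ']
    have h4 : ∫ t in Icc (0 : ℝ) 1, ⟪u t, J (deriv φ t) + S t (φ t)⟫ ≤ η * K := by
      have := norm_setIntegral_le_of_norm_le_const (μ := volume) (s := Icc (0 : ℝ) 1)
        (f := fun t => ⟪u t, J (deriv φ t) + S t (φ t)⟫) (C := η * K) (by simp) fun t ht =>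
          (norm_inner_le_norm _ _).trans
            (mul_le_mul (hu t ht) (hK t ht) (norm_nonneg _) hη0.le)
      rw [Real.volume_real_Icc_of_le zero_le_one, sub_zero, mul_one] at this
      exact (le_abs_self _).trans this
    have h5 : ⟪J (u 1), φ 1⟫ ≤ η * ‖φ 1‖ := (real_inner_le_norm _ _).trans (by
      rw [h.norm_map]
      exact mul_le_mul_of_nonneg_right (hu 1 (by simp)) (norm_nonneg _))
    have h6 : -⟪J (u 0), φ 0⟫ ≤ η * ‖φ 0‖ := by
      rw [← inner_neg_left]
      refine (real_inner_le_norm _ _).trans ?_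
      rw [norm_neg, h.norm_map]
      exact mul_le_mul_of_nonneg_right (hu 0 (by simp)) (norm_nonneg _)
    have h7 : η * (‖φ 1‖ + ‖φ 0‖ + K + 1) = ε / 4 := by
      rw [hη]; field_simp
    nlinarith
  linarith

theorem exists_norm_sq_le_tsum [FiniteDimensional ℝ E] (h : SpectralProblem J Λ S x μ) :
    ∃ C : ℝ, 0 ≤ C ∧ ∀ f f' : ℝ → E, AdmissiblePath Λ f f' → ∀ t ∈ Icc (0 : ℝ) 1,
      ‖f t‖ ^ 2 ≤ C * ∑' i, μ i ^ 2 * coeff x f i ^ 2 := by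
  obtain ⟨C, hC, hb⟩ := h.exists_norm_sq_le
  obtain ⟨m, hm, hμ⟩ := h.exists_le_abs_eigenvalue
  refine ⟨C * ((m ^ 2)⁻¹ + 1), by positivity, fun f f' hf t ht => ?_⟩
  refine (hb f f' hf.deriv hf.memLp t ht).trans ?_
  rw [mul_assoc]
  refine mul_le_mul_of_nonneg_left ?_ hC
  rw [(h.hasSum_coeff_op_sq hf).tsum_eq, add_mul, one_mul]
  gcongr
  refine hasSum_le (fun i => ?_) (h.hasSum_coeff_sq hf) ((h.hasSum_coeff_op_sq hf).mul_left _)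
  have h1 : m ^ 2 ≤ μ i ^ 2 := by
    rw [← sq_abs (μ i)]; exact pow_le_pow_left₀ hm.le (hμ i) 2
  have h2 : 1 ≤ (m ^ 2)⁻¹ * μ i ^ 2 := by
    rw [inv_mul_eq_div, le_div_iff₀ (by positivity)]; linarith
  nlinarith [sq_nonneg (coeff x f i)]

end SpectralProblem

section Strip

theorem volume_restrict_Strip (I : Set ℝ) : (volume : Measure (ℝ × ℝ)).restrict (Strip I) =
    (volume.restrict I).prod (volume.restrict (Icc (0 : ℝ) 1)) := by
  rw [Strip, Measure.prod_restrict, Measure.volume_eq_prod]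

theorem isClosed_Strip {I : Set ℝ} (hI : IsClosed I) : IsClosed (Strip I) :=
  hI.prod isClosed_Icc

theorem ae_mem_interior_of_convex {V : Type*} [NormedAddCommGroup V] [NormedSpace ℝ V]
    [MeasurableSpace V] [BorelSpace V] [FiniteDimensional ℝ V] (ν : Measure V)
    [ν.IsAddHaarMeasure] {s : Set V} (hc : Convex ℝ s) (hs : IsClosed s) :
    ∀ᵐ p ∂ν.restrict s, p ∈ interior s := by
  rw [ae_restrict_iff' hs.measurableSet]
  filter_upwards [measure_eq_zero_iff_ae_notMem.1 (hc.addHaar_frontier ν)] with p hp hps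
  by_contra h
  exact hp (by rw [hs.frontier_eq]; exact ⟨hps, h⟩)

theorem ae_mem_interior_Strip {I : Set ℝ} (hc : Convex ℝ I) (hI : IsClosed I) :
    ∀ᵐ p ∂(volume : Measure (ℝ × ℝ)).restrict (Strip I), p ∈ interior (Strip I) :=
  have : (volume : Measure (ℝ × ℝ)).IsAddHaarMeasure := by
    rw [Measure.volume_eq_prod]; infer_instance
  ae_mem_interior_of_convex _ (hc.prod (convex_Icc 0 1)) (isClosed_Strip hI)

theorem aestronglyMeasurable_derivative {V : Type*} [NormedAddCommGroup V] [NormedSpace ℝ V]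
    [FiniteDimensional ℝ V] {I : Set ℝ} (hc : Convex ℝ I) (hI : IsClosed I)
    {u : ℝ × ℝ → V} {Du : ℝ × ℝ → ℝ × ℝ →L[ℝ] V}
    (hu : ∀ p ∈ Strip I, HasFDerivWithinAt u (Du p) (Strip I) p) (v : ℝ × ℝ) :
    AEStronglyMeasurable (fun p => Du p v) (volume.restrict (Strip I)) := by
  borelize V
  have : CompleteSpace V := FiniteDimensional.complete ℝ V
  have h1 : AEStronglyMeasurable (fun p => fderiv ℝ u p v) (volume.restrict (Strip I)) :=
    (measurable_fderiv_apply_const ℝ u v).aestronglyMeasurable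
  refine h1.congr ?_
  filter_upwards [ae_mem_interior_Strip hc hI] with p hp
  rw [((hu p (interior_subset hp)).hasFDerivAt (mem_interior_iff_mem_nhds.1 hp)).fderiv]

theorem aestronglyMeasurable_second_derivative [FiniteDimensional ℝ E] {I : Set ℝ}
    (hc : Convex ℝ I) (hI : IsClosed I) {Du : ℝ × ℝ → ℝ × ℝ →L[ℝ] E}
    {D2u : ℝ × ℝ → ℝ × ℝ →L[ℝ] ℝ × ℝ →L[ℝ] E}
    (hu : ∀ p ∈ Strip I, HasFDerivWithinAt Du (D2u p) (Strip I) p) (v w : ℝ × ℝ) :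
    AEStronglyMeasurable (fun p => D2u p v w) (volume.restrict (Strip I)) :=
  aestronglyMeasurable_derivative hc hI (u := fun p => Du p w)
    (Du := fun p => (ContinuousLinearMap.apply ℝ E w).comp (D2u p))
    (fun p hp => (ContinuousLinearMap.apply ℝ E w).hasFDerivAt.comp_hasFDerivWithinAt p (hu p hp)) v

theorem second_derivative_symm {I : Set ℝ} {u : ℝ × ℝ → E}
    {Du : ℝ × ℝ → ℝ × ℝ →L[ℝ] E} {D2u : ℝ × ℝ → ℝ × ℝ →L[ℝ] ℝ × ℝ →L[ℝ] E}
    (hu : ∀ p ∈ Strip I, HasFDerivWithinAt u (Du p) (Strip I) p)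
    (hDu : ∀ p ∈ Strip I, HasFDerivWithinAt Du (D2u p) (Strip I) p) {p : ℝ × ℝ}
    (hp : p ∈ interior (Strip I)) (v w : ℝ × ℝ) : D2u p v w = D2u p w v := by
  refine second_derivative_symmetric_of_eventually (f := u) (f' := Du) (𝕜 := ℝ) ?_
    ((hDu p (interior_subset hp)).hasFDerivAt (mem_interior_iff_mem_nhds.1 hp)) v w
  filter_upwards [isOpen_interior.mem_nhds hp] with q hq
  exact (hu q (interior_subset hq)).hasFDerivAt (mem_interior_iff_mem_nhds.1 hq)

theorem memLp_of_sq_integrableOn {V : Type*} [NormedAddCommGroup V] {I : Set ℝ} {v : ℝ × ℝ → V}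
    (hm : AEStronglyMeasurable v (volume.restrict (Strip I)))
    (hv : IntegrableOn (fun p => ‖v p‖ ^ 2) (Strip I)) :
    MemLp v 2 (volume.restrict (Strip I)) :=
  (memLp_two_iff_integrable_sq_norm hm).2 hv

theorem memLp_slice {V : Type*} [NormedAddCommGroup V] {I : Set ℝ} {v : ℝ × ℝ → V}
    (hv : MemLp v 2 (volume.restrict (Strip I))) :
    ∀ᵐ s ∂volume.restrict I, MemLp (fun t => v (s, t)) 2 (volume.restrict (Icc (0 : ℝ) 1)) := by
  rw [volume_restrict_Strip] at hv
  filter_upwards [hv.1.prodMk_left, (hv.integrable_norm_pow two_ne_zero).prod_right_ae] with s h1 h2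
  exact (memLp_two_iff_integrable_sq_norm h1).2 h2

theorem integrable_integral_slice {I : Set ℝ} {F : ℝ × ℝ → ℝ} (hF : IntegrableOn F (Strip I)) :
    IntegrableOn (fun s => ∫ t in Icc (0 : ℝ) 1, F (s, t)) I := by
  rw [IntegrableOn, volume_restrict_Strip] at hF
  exact hF.integral_prod_left

theorem integral_integral_slice {I : Set ℝ} {F : ℝ × ℝ → ℝ} (hF : IntegrableOn F (Strip I)) :
    ∫ s in I, ∫ t in Icc (0 : ℝ) 1, F (s, t) = ∫ p in Strip I, F p := by
  rw [IntegrableOn, volume_restrict_Strip] at hF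
  rw [volume_restrict_Strip, integral_prod _ hF]

theorem hasSum_integral_of_nonneg {α : Type*} {mα : MeasurableSpace α} {ν : Measure α} {ι : Type*}
    [Countable ι] {a : ι → α → ℝ} {b : α → ℝ} (hm : ∀ i, AEStronglyMeasurable (a i) ν)
    (ha : ∀ i s, 0 ≤ a i s) (hb : Integrable b ν)
    (h : ∀ᵐ s ∂ν, HasSum (fun i => a i s) (b s)) :
    HasSum (fun i => ∫ s, a i s ∂ν) (∫ s, b s ∂ν) := by
  refine hasSum_integral_of_dominated_convergence a hm
    (fun i => Filter.Eventually.of_forall fun s => (Real.norm_of_nonneg (ha i s)).le)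
    (h.mono fun s hs => hs.summable) (hb.congr (h.mono fun s hs => hs.tsum_eq.symm)) h

theorem le_of_hasSum_of_sum_le {ι : Type*} {a : ι → ℝ} {A B : ℝ} (h : HasSum a A)
    (hB : ∀ F : Finset ι, ∑ i ∈ F, a i ≤ B) : A ≤ B :=
  le_of_tendsto' (by simpa [HasSum] using h) hB

end Strip

section Slices

variable {I : Set ℝ} {V : Type*} [NormedAddCommGroup V] [NormedSpace ℝ V]

theorem hasDerivWithinAt_slice_right {v : ℝ × ℝ → V} {Dv : ℝ × ℝ → ℝ × ℝ →L[ℝ] V}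
    (hv : ∀ p ∈ Strip I, HasFDerivWithinAt v (Dv p) (Strip I) p) {s : ℝ} (hs : s ∈ I) {t : ℝ}
    (ht : t ∈ Icc (0 : ℝ) 1) :
    HasDerivWithinAt (fun t => v (s, t)) (Dv (s, t) (0, 1)) (Icc 0 1) t :=
  (hv (s, t) ⟨hs, ht⟩).comp_hasDerivWithinAt t
    ((hasDerivAt_const t s).prodMk (hasDerivAt_id t)).hasDerivWithinAt fun _ hr => ⟨hs, hr⟩

theorem hasDerivAt_slice_left {v : ℝ × ℝ → V} {Dv : ℝ × ℝ → ℝ × ℝ →L[ℝ] V}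
    (hv : ∀ p ∈ Strip I, HasFDerivWithinAt v (Dv p) (Strip I) p) {s : ℝ} (hs : s ∈ interior I)
    {t : ℝ} (ht : t ∈ Icc (0 : ℝ) 1) :
    HasDerivAt (fun s => v (s, t)) (Dv (s, t) (1, 0)) s :=
  have h1 : HasDerivWithinAt (fun s => v (s, t)) (Dv (s, t) (1, 0)) I s :=
    (hv (s, t) ⟨interior_subset hs, ht⟩).comp_hasDerivWithinAt s
      ((hasDerivAt_id s).prodMk (hasDerivAt_const s t)).hasDerivWithinAt fun _ hr => mk_mem_prod hr ht
  h1.hasDerivAt (mem_interior_iff_mem_nhds.1 hs)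

theorem continuousOn_slice {G : Type*} [NormedAddCommGroup G] {v : ℝ × ℝ → G}
    (hv : ContinuousOn v (Strip I)) {s : ℝ} (hs : s ∈ I) :
    ContinuousOn (fun t => v (s, t)) (Icc 0 1) :=
  hv.comp (by fun_prop) fun _ ht => ⟨hs, ht⟩

theorem HasDerivAt.mem_of_eventually_mem [FiniteDimensional ℝ E] {Λ : Submodule ℝ E} {γ : ℝ → E}
    {γ' : E} {s : ℝ} (hγ : HasDerivAt γ γ' s) (h : ∀ᶠ r in nhds s, γ r ∈ Λ) : γ' ∈ Λ := by
  have h1 : HasDerivAt (fun r => Λᗮ.starProjection (γ r)) (Λᗮ.starProjection γ') s :=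
    Λᗮ.starProjection.hasFDerivAt.comp_hasDerivAt s hγ
  have h2 : (fun r => Λᗮ.starProjection (γ r)) =ᶠ[nhds s] fun _ => 0 :=
    h.mono fun r hr => Submodule.starProjection_orthogonal_apply_eq_zero hr
  have h3 := h1.unique ((hasDerivAt_const s (0 : E)).congr_of_eventuallyEq h2)
  rwa [Submodule.starProjection_apply_eq_zero_iff, Submodule.orthogonal_orthogonal] at h3

variable {ι : Type*} {x : ι → ℝ → E} {i : ι}

theorem continuousOn_coeff_slice (hx : Continuous (x i)) {v : ℝ × ℝ → E}
    (hv : ContinuousOn v (Strip I)) :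
    ContinuousOn (fun s => coeff x (fun t => v (s, t)) i) I := by
  rw [continuousOn_iff_continuous_domRestrict]
  let F : I → ℝ → ℝ := fun s t => ⟪v (s, projIcc (0 : ℝ) 1 zero_le_one t), x i t⟫
  have hF : Continuous (Function.uncurry F) := by
    refine Continuous.inner ?_ (hx.comp continuous_snd)
    refine hv.comp_continuous (f := fun p : I × ℝ =>
      ((p.1 : ℝ), (projIcc (0 : ℝ) 1 zero_le_one p.2 : ℝ))) ?_ fun p => ⟨p.1.2, Subtype.prop _⟩
    exact (continuous_subtype_val.comp continuous_fst).prodMk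
      (continuous_subtype_val.comp (continuous_projIcc.comp continuous_snd))
  refine (intervalIntegral.continuous_parametric_intervalIntegral_of_continuous (a₀ := 0)
    (μ := volume) hF (continuous_const (y := (1 : ℝ)))).congr fun s => ?_
  rw [domRestrict_apply, coeff]
  refine intervalIntegral.integral_congr fun t ht => ?_
  rw [uIcc_of_le zero_le_one] at ht
  simp only [F, projIcc_of_mem _ ht]

theorem hasDerivAt_coeff_slice (hx : Continuous (x i)) {v : ℝ × ℝ → E}
    {Dv : ℝ × ℝ → ℝ × ℝ →L[ℝ] E}
    (hv : ∀ p ∈ Strip I, HasFDerivWithinAt v (Dv p) (Strip I) p)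
    (hDv : ContinuousOn (fun p => Dv p (1, 0)) (Strip I)) {s : ℝ} (hs : s ∈ interior I) :
    HasDerivAt (fun s => coeff x (fun t => v (s, t)) i)
      (coeff x (fun t => Dv (s, t) (1, 0)) i) s := by
  obtain ⟨δ, hδ, hball⟩ := Metric.isOpen_iff.1 isOpen_interior s hs
  have hvc : ContinuousOn v (Strip I) := fun p hp => (hv p hp).continuousWithinAt
  set K : Set ℝ := Icc (s - δ / 2) (s + δ / 2) with hK
  have hKI : K ⊆ interior I := fun r hr => hball (by
    rw [Metric.mem_ball, Real.dist_eq, abs_lt]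
    constructor <;> linarith [hr.1, hr.2])
  have hKs : K ∈ nhds s := Icc_mem_nhds (by linarith) (by linarith)
  obtain ⟨C, hC⟩ := (isCompact_Icc.prod isCompact_Icc : IsCompact (K ×ˢ Icc (0 : ℝ) 1))
    |>.exists_bound_of_continuousOn
      (hDv.mono (prod_mono (hKI.trans interior_subset) subset_rfl))
  have hcont : ∀ {w : ℝ × ℝ → E} (_ : ContinuousOn w (Strip I)) {r : ℝ} (_ : r ∈ I),
      IntegrableOn (fun t => ⟪w (r, t), x i t⟫) (Icc 0 1) := fun {_} hw {_} hr =>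
    ((continuousOn_slice hw hr).inner hx.continuousOn).integrableOn_Icc
  simp only [coeff_eq]
  refine (hasDerivAt_integral_of_dominated_loc_of_deriv_le (𝕜 := ℝ)
    (F := fun s t => ⟪v (s, t), x i t⟫) (F' := fun s t => ⟪Dv (s, t) (1, 0), x i t⟫)
    (bound := fun t => C * ‖x i t‖) hKs ?_ (hcont hvc (interior_subset hs))
    (hcont hDv (interior_subset hs)).aestronglyMeasurable ?_ ?_ ?_).2
  · filter_upwards [isOpen_interior.mem_nhds hs] with r hr
    exact (hcont hvc (interior_subset hr)).aestronglyMeasurable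
  · refine (ae_restrict_iff' measurableSet_Icc).2 (Filter.Eventually.of_forall fun t ht r hr => ?_)
    exact (norm_inner_le_norm _ _).trans
      (mul_le_mul_of_nonneg_right (hC (r, t) ⟨hr, ht⟩) (norm_nonneg _))
  · exact ((hx.norm.const_mul C).continuousOn).integrableOn_Icc
  · refine (ae_restrict_iff' measurableSet_Icc).2 (Filter.Eventually.of_forall fun t ht r hr => ?_)
    simpa using (hasDerivAt_slice_left hv (hKI hr) ht).inner ℝ (hasDerivAt_const r (x i t))

end Slices

/-- A square integrable field on the strip whose slices have coefficients `c i s`, continuous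
in `s`. -/
structure ModeField {ι : Type*} (x : ι → ℝ → E) (I : Set ℝ) (v : ℝ × ℝ → E) (c : ι → ℝ → ℝ) :
    Prop where
  memLp : MemLp v 2 (volume.restrict (Strip I))
  continuousOn : ∀ i, ContinuousOn (c i) I
  coeff : ∀ᵐ s ∂volume.restrict I, ∀ i, coeff x (fun t => v (s, t)) i = c i s

namespace ModeField

variable {J : E →L[ℝ] E} {Λ : Submodule ℝ E} {S : ℝ → E →L[ℝ] E} {ι : Type*} {x : ι → ℝ → E}
  {μ : ι → ℝ} {I : Set ℝ} {v : ℝ × ℝ → E} {c : ι → ℝ → ℝ}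

theorem integrableOn_norm_sq (hv : ModeField x I v c) :
    IntegrableOn (fun p => ‖v p‖ ^ 2) (Strip I) :=
  hv.memLp.integrable_norm_pow two_ne_zero

theorem integrableOn_sq (hv : ModeField x I v c) (h : SpectralProblem J Λ S x μ)
    (hI : IsClosed I) (i : ι) : IntegrableOn (fun s => c i s ^ 2) I := by
  refine (integrable_integral_slice hv.integrableOn_norm_sq).mono'
    (((hv.continuousOn i).pow 2).aestronglyMeasurable hI.measurableSet) ?_
  filter_upwards [hv.coeff, memLp_slice hv.memLp] with s h1 h2
  rw [Real.norm_of_nonneg (sq_nonneg _), ← h1]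
  simpa using h.sum_coeff_sq_le h2 {i}

theorem integrableOn_mul_norm_sq (hv : ModeField x I v c) (hI : IsClosed I) {g : ℝ → ℝ} {C : ℝ}
    (hg : ContinuousOn g I) (hgC : ∀ s ∈ I, |g s| ≤ C) :
    IntegrableOn (fun p => g p.1 * ‖v p‖ ^ 2) (Strip I) := by
  refine Integrable.bdd_mul hv.integrableOn_norm_sq
    (ContinuousOn.aestronglyMeasurable (hg.comp continuousOn_fst fun p hp => hp.1)
      (isClosed_Strip hI).measurableSet) (c := C) ?_
  exact (ae_restrict_iff' (isClosed_Strip hI).measurableSet).2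
    (Filter.Eventually.of_forall fun p hp => hgC p.1 hp.1)

theorem sum_weighted_le (hv : ModeField x I v c) (h : SpectralProblem J Λ S x μ)
    (hI : IsClosed I) {g : ℝ → ℝ} {C : ℝ} (hg : ContinuousOn g I) (hg0 : ∀ s, 0 ≤ g s)
    (hgC : ∀ s ∈ I, |g s| ≤ C) (F : Finset ι) :
    ∑ i ∈ F, ∫ s in I, g s * c i s ^ 2 ≤ ∫ p in Strip I, g p.1 * ‖v p‖ ^ 2 := by
  have h1 := hv.integrableOn_mul_norm_sq hI hg hgC
  have h2 : ∀ i, IntegrableOn (fun s => g s * c i s ^ 2) I := fun i =>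
    integrableOn_mul_of_bounded hI hg hgC (hv.integrableOn_sq h hI i)
  rw [← integral_finsetSum _ fun i _ => h2 i, ← integral_integral_slice h1]
  refine integral_mono_ae (integrable_finsetSum _ fun i _ => h2 i) (integrable_integral_slice h1) ?_
  filter_upwards [hv.coeff, memLp_slice hv.memLp] with s h3 h4
  simp only [← Finset.mul_sum, integral_const_mul, ← h3]
  exact mul_le_mul_of_nonneg_left (h.sum_coeff_sq_le h4 F) (hg0 s)

theorem sum_le (hv : ModeField x I v c) (h : SpectralProblem J Λ S x μ) (hI : IsClosed I)
    (F : Finset ι) : ∑ i ∈ F, ∫ s in I, c i s ^ 2 ≤ ∫ p in Strip I, ‖v p‖ ^ 2 := by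
  simpa using hv.sum_weighted_le h hI (g := fun _ => 1) (C := 1) continuousOn_const
    (fun _ => zero_le_one) (fun _ _ => by simp) F

theorem hasSum_weighted [Countable ι] (hv : ModeField x I v c)
    (hs : ∀ᵐ s ∂volume.restrict I,
      HasSum (fun i => c i s ^ 2) (∫ t in Icc (0 : ℝ) 1, ‖v (s, t)‖ ^ 2))
    (hI : IsClosed I) {g : ℝ → ℝ} {C : ℝ} (hg : ContinuousOn g I) (hg0 : ∀ s, 0 ≤ g s)
    (hgC : ∀ s ∈ I, |g s| ≤ C) :
    HasSum (fun i => ∫ s in I, g s * c i s ^ 2) (∫ p in Strip I, g p.1 * ‖v p‖ ^ 2) := by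
  have h1 := hv.integrableOn_mul_norm_sq hI hg hgC
  rw [← integral_integral_slice h1]
  refine hasSum_integral_of_nonneg (fun i => ?_) (fun i s => mul_nonneg (hg0 s) (sq_nonneg _))
    (integrable_integral_slice h1) ?_
  · exact (hg.mul ((hv.continuousOn i).pow 2)).aestronglyMeasurable hI.measurableSet
  · filter_upwards [hs] with s h2
    simp only [integral_const_mul]
    exact h2.mul_left _

theorem hasSum [Countable ι] (hv : ModeField x I v c)
    (hs : ∀ᵐ s ∂volume.restrict I,
      HasSum (fun i => c i s ^ 2) (∫ t in Icc (0 : ℝ) 1, ‖v (s, t)‖ ^ 2))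
    (hI : IsClosed I) : HasSum (fun i => ∫ s in I, c i s ^ 2) (∫ p in Strip I, ‖v p‖ ^ 2) := by
  simpa using hv.hasSum_weighted hs hI (g := fun _ => 1) (C := 1) continuousOn_const
    (fun _ => zero_le_one) (fun _ _ => by simp)

end ModeField

theorem AdmissiblePath.add {Λ : Submodule ℝ E} {f f' g g' : ℝ → E} (hf : AdmissiblePath Λ f f')
    (hg : AdmissiblePath Λ g g') :
    AdmissiblePath Λ (fun t => f t + g t) (fun t => f' t + g' t) where
  deriv t ht := (hf.deriv t ht).add (hg.deriv t ht)
  memLp := hf.memLp.add hg.memLp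
  left := Λ.add_mem hf.left hg.left
  right := Λ.add_mem hf.right hg.right

/-- The field `J ∂ₜu + S u` on the strip, given `u` and its derivative `ut` in the second
variable. -/
def opField (J : E →L[ℝ] E) (S : ℝ → E →L[ℝ] E) (u ut : ℝ × ℝ → E) (p : ℝ × ℝ) : E :=
  J (ut p) + S p.2 (u p)

/-- The derivative in the second variable of `opField J S u ut`, where `utt` is the derivative
of `ut`. -/
def opFieldDeriv (J : E →L[ℝ] E) (S : ℝ → E →L[ℝ] E) (u ut utt : ℝ × ℝ → E) (p : ℝ × ℝ) : E :=
  J (utt p) + (deriv S p.2 (u p) + S p.2 (ut p))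

theorem memLp_clm_apply {I : Set ℝ} {T : ℝ × ℝ → E →L[ℝ] E} {u : ℝ × ℝ → E} {K : ℝ}
    (hI : IsClosed I) (hT : AEStronglyMeasurable T (volume.restrict (Strip I)))
    (hK : ∀ p ∈ Strip I, ‖T p‖ ≤ K)
    (hu : MemLp u 2 (volume.restrict (Strip I))) :
    MemLp (fun p => T p (u p)) 2 (volume.restrict (Strip I)) := by
  refine hu.of_le_mul (c := K) ?_ ?_
  · exact isBoundedBilinearMap_apply.continuous.comp_aestronglyMeasurable (hT.prodMk hu.1)
  · exact (ae_restrict_iff' (isClosed_Strip hI).measurableSet).2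
      (Filter.Eventually.of_forall fun p hp => (T p).le_of_opNorm_le (hK p hp) _)

theorem memLp_coefficient_apply {I : Set ℝ} {S : ℝ → E →L[ℝ] E} {u : ℝ × ℝ → E}
    (hI : IsClosed I) (hS : Continuous S) (hu : MemLp u 2 (volume.restrict (Strip I))) :
    MemLp (fun p => S p.2 (u p)) 2 (volume.restrict (Strip I)) := by
  obtain ⟨K, hK⟩ := (isCompact_Icc (a := (0 : ℝ)) (b := 1)).exists_bound_of_continuousOn
    hS.continuousOn
  refine memLp_clm_apply hI (T := fun p => S p.2) (K := K) ?_ (fun p hp => hK _ hp.2) hu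
  exact (hS.comp continuous_snd).continuousOn.aestronglyMeasurable
    (isClosed_Strip hI).measurableSet

theorem memLp_opField {I : Set ℝ} (J : E →L[ℝ] E) {S : ℝ → E →L[ℝ] E} {u ut : ℝ × ℝ → E}
    (hI : IsClosed I) (hS : Continuous S) (hu : MemLp u 2 (volume.restrict (Strip I)))
    (hut : MemLp ut 2 (volume.restrict (Strip I))) :
    MemLp (opField J S u ut) 2 (volume.restrict (Strip I)) :=
  (J.comp_memLp' hut).add (memLp_coefficient_apply hI hS hu)

theorem memLp_opFieldDeriv {I : Set ℝ} (J : E →L[ℝ] E) {S : ℝ → E →L[ℝ] E}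
    {u ut utt : ℝ × ℝ → E} (hI : IsClosed I) (hS : ContDiff ℝ (⊤ : ℕ∞) S)
    (hu : MemLp u 2 (volume.restrict (Strip I))) (hut : MemLp ut 2 (volume.restrict (Strip I)))
    (hutt : MemLp utt 2 (volume.restrict (Strip I))) :
    MemLp (opFieldDeriv J S u ut utt) 2 (volume.restrict (Strip I)) :=
  (J.comp_memLp' hutt).add ((memLp_coefficient_apply hI (hS.continuous_deriv (by simp)) hu).add
    (memLp_coefficient_apply hI hS.continuous hut))

/-- A `W^{2,2}` map on the strip satisfying both boundary conditions. -/
structure StripSection (J : E →L[ℝ] E) (Λ : Submodule ℝ E) (S : ℝ → E →L[ℝ] E) (I : Set ℝ)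
    (u : ℝ × ℝ → E) (Du : ℝ × ℝ → ℝ × ℝ →L[ℝ] E)
    (D2u : ℝ × ℝ → ℝ × ℝ →L[ℝ] ℝ × ℝ →L[ℝ] E) : Prop where
  closed : IsClosed I
  convex : Convex ℝ I
  w22 : W22On I u Du D2u
  bc : LagBC Λ I u
  bc2 : LagBC2 Λ J S I u Du

namespace StripSection

variable {J : E →L[ℝ] E} {Λ : Submodule ℝ E} {S S' : ℝ → E →L[ℝ] E} {ι : Type*}
  {x : ι → ℝ → E} {μ : ι → ℝ} {I : Set ℝ} {u : ℝ × ℝ → E} {Du : ℝ × ℝ → ℝ × ℝ →L[ℝ] E}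
  {D2u : ℝ × ℝ → ℝ × ℝ →L[ℝ] ℝ × ℝ →L[ℝ] E}

theorem continuousOn (hu : StripSection J Λ S I u Du D2u) : ContinuousOn u (Strip I) :=
  fun p hp => (hu.w22.1.1 p hp).continuousWithinAt

theorem continuousOn_deriv (hu : StripSection J Λ S I u Du D2u) (w : ℝ × ℝ) :
    ContinuousOn (fun p => Du p w) (Strip I) :=
  ContinuousOn.clm_apply (fun p hp => (hu.w22.2.1 p hp).continuousWithinAt) continuousOn_const

theorem hasFDerivWithinAt_deriv (hu : StripSection J Λ S I u Du D2u) (w : ℝ × ℝ) {p : ℝ × ℝ}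
    (hp : p ∈ Strip I) : HasFDerivWithinAt (fun p => Du p w)
      ((ContinuousLinearMap.apply ℝ E w).comp (D2u p)) (Strip I) p :=
  (ContinuousLinearMap.apply ℝ E w).hasFDerivAt.comp_hasFDerivWithinAt p (hu.w22.2.1 p hp)

theorem memLp (hu : StripSection J Λ S I u Du D2u) : MemLp u 2 (volume.restrict (Strip I)) :=
  memLp_of_sq_integrableOn
    (hu.continuousOn.aestronglyMeasurable (isClosed_Strip hu.closed).measurableSet) hu.w22.1.2.1

theorem memLp_ds (hu : StripSection J Λ S I u Du D2u) :
    MemLp (fun p => Du p (1, 0)) 2 (volume.restrict (Strip I)) :=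
  memLp_of_sq_integrableOn ((hu.continuousOn_deriv _).aestronglyMeasurable
    (isClosed_Strip hu.closed).measurableSet) hu.w22.1.2.2.1

theorem memLp_dt (hu : StripSection J Λ S I u Du D2u) :
    MemLp (fun p => Du p (0, 1)) 2 (volume.restrict (Strip I)) :=
  memLp_of_sq_integrableOn ((hu.continuousOn_deriv _).aestronglyMeasurable
    (isClosed_Strip hu.closed).measurableSet) hu.w22.1.2.2.2

variable [FiniteDimensional ℝ E]

theorem memLp_dss (hu : StripSection J Λ S I u Du D2u) :
    MemLp (fun p => D2u p (1, 0) (1, 0)) 2 (volume.restrict (Strip I)) :=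
  memLp_of_sq_integrableOn (aestronglyMeasurable_second_derivative hu.convex hu.closed hu.w22.2.1
    _ _) hu.w22.2.2.1

theorem memLp_dst (hu : StripSection J Λ S I u Du D2u) :
    MemLp (fun p => D2u p (1, 0) (0, 1)) 2 (volume.restrict (Strip I)) :=
  memLp_of_sq_integrableOn (aestronglyMeasurable_second_derivative hu.convex hu.closed hu.w22.2.1
    _ _) hu.w22.2.2.2.1

theorem memLp_dtt (hu : StripSection J Λ S I u Du D2u) :
    MemLp (fun p => D2u p (0, 1) (0, 1)) 2 (volume.restrict (Strip I)) :=
  memLp_of_sq_integrableOn (aestronglyMeasurable_second_derivative hu.convex hu.closed hu.w22.2.1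
    _ _) hu.w22.2.2.2.2

omit [FiniteDimensional ℝ E] in
theorem dst_ae_eq (hu : StripSection J Λ S I u Du D2u) :
    (fun p => D2u p (1, 0) (0, 1)) =ᵐ[volume.restrict (Strip I)]
      fun p => D2u p (0, 1) (1, 0) := by
  filter_upwards [ae_mem_interior_Strip hu.convex hu.closed] with p hp
  exact second_derivative_symm hu.w22.1.1 hu.w22.2.1 hp _ _

theorem memLp_dts (hu : StripSection J Λ S I u Du D2u) :
    MemLp (fun p => D2u p (0, 1) (1, 0)) 2 (volume.restrict (Strip I)) :=
  hu.memLp_dst.ae_eq hu.dst_ae_eq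

omit [FiniteDimensional ℝ E] in
theorem admissiblePath (hu : StripSection J Λ S I u Du D2u) {s : ℝ} (hs : s ∈ I) :
    AdmissiblePath Λ (fun t => u (s, t)) (fun t => Du (s, t) (0, 1)) where
  deriv _ ht := hasDerivWithinAt_slice_right hu.w22.1.1 hs ht
  memLp := memLp_of_continuousOn (continuousOn_slice (hu.continuousOn_deriv _) hs)
  left := (hu.bc s hs).1
  right := (hu.bc s hs).2

theorem admissiblePath_ds (hu : StripSection J Λ S I u Du D2u) :
    ∀ᵐ s ∂volume.restrict I,
      AdmissiblePath Λ (fun t => Du (s, t) (1, 0)) (fun t => D2u (s, t) (0, 1) (1, 0)) := by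
  filter_upwards [ae_mem_interior_of_convex volume hu.convex hu.closed,
    memLp_slice hu.memLp_dts] with s hs h2
  refine ⟨fun t ht => hasDerivWithinAt_slice_right (fun p hp => hu.hasFDerivWithinAt_deriv (1, 0) hp)
    (interior_subset hs) ht, h2, ?_, ?_⟩
  · refine (hasDerivAt_slice_left hu.w22.1.1 hs (by simp : (0 : ℝ) ∈ Icc 0 1)).mem_of_eventually_mem
      ?_
    filter_upwards [isOpen_interior.mem_nhds hs] with r hr
    exact (hu.bc r (interior_subset hr)).1
  · refine (hasDerivAt_slice_left hu.w22.1.1 hs (by simp : (1 : ℝ) ∈ Icc 0 1)).mem_of_eventually_mem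
      ?_
    filter_upwards [isOpen_interior.mem_nhds hs] with r hr
    exact (hu.bc r (interior_subset hr)).2

theorem admissiblePath_op (hu : StripSection J Λ S I u Du D2u) (hS : ContDiff ℝ (⊤ : ℕ∞) S) :
    ∀ᵐ s ∂volume.restrict I,
      AdmissiblePath Λ (fun t => opField J S u (fun p => Du p (0, 1)) (s, t))
        (fun t => opFieldDeriv J S u (fun p => Du p (0, 1)) (fun p => D2u p (0, 1) (0, 1))
          (s, t)) := by
  filter_upwards [ae_mem_interior_of_convex volume hu.convex hu.closed, memLp_slice
    (memLp_opFieldDeriv J hu.closed hS hu.memLp hu.memLp_dt hu.memLp_dtt)] with s hs h2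
  refine ⟨fun t ht => ?_, h2, (hu.bc2 s (interior_subset hs)).1, (hu.bc2 s (interior_subset hs)).2⟩
  refine (J.hasFDerivAt.comp_hasDerivWithinAt t (hasDerivWithinAt_slice_right
    (fun p hp => hu.hasFDerivWithinAt_deriv (0, 1) hp) (interior_subset hs) ht)).add ?_
  exact ((hS.differentiable (by simp)).differentiableAt.hasDerivAt.hasDerivWithinAt).clm_apply
    (hasDerivWithinAt_slice_right hu.w22.1.1 (interior_subset hs) ht)

omit [FiniteDimensional ℝ E] in
theorem modeField (hu : StripSection J Λ S I u Du D2u) (h : SpectralProblem J Λ S' x μ) :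
    ModeField x I u fun i s => coeff x (fun t => u (s, t)) i :=
  ⟨hu.memLp, fun i => continuousOn_coeff_slice (h.continuous_eigenfunction i) hu.continuousOn,
    Filter.Eventually.of_forall fun _ _ => rfl⟩

omit [FiniteDimensional ℝ E] in
theorem modeField_ds (hu : StripSection J Λ S I u Du D2u) (h : SpectralProblem J Λ S' x μ) :
    ModeField x I (fun p => Du p (1, 0)) fun i s => coeff x (fun t => Du (s, t) (1, 0)) i :=
  ⟨hu.memLp_ds, fun i => continuousOn_coeff_slice (h.continuous_eigenfunction i)
    (hu.continuousOn_deriv _), Filter.Eventually.of_forall fun _ _ => rfl⟩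

omit [FiniteDimensional ℝ E] in
theorem modeField_op (hu : StripSection J Λ S I u Du D2u) (h : SpectralProblem J Λ S' x μ) :
    ModeField x I (opField J S' u fun p => Du p (0, 1))
      fun i s => μ i * coeff x (fun t => u (s, t)) i := by
  refine ⟨memLp_opField J hu.closed h.continuous_coefficient hu.memLp hu.memLp_dt,
    fun i => ((hu.modeField h).continuousOn i).const_mul _, ?_⟩
  filter_upwards [ae_restrict_mem hu.closed.measurableSet] with s hs i
  exact h.coeff_op (hu.admissiblePath hs) i

omit [FiniteDimensional ℝ E] in
theorem modeField_operator (hu : StripSection J Λ S I u Du D2u)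
    (h : SpectralProblem J Λ S' x μ) :
    ModeField x I (fun p => Du p (1, 0) + opField J S' u (fun p => Du p (0, 1)) p)
      fun i s => coeff x (fun t => Du (s, t) (1, 0)) i + μ i * coeff x (fun t => u (s, t)) i := by
  have h1 := hu.modeField_ds h
  have h2 := hu.modeField_op h
  refine ⟨h1.memLp.add h2.memLp, fun i => (h1.continuousOn i).add (h2.continuousOn i), ?_⟩
  filter_upwards [h2.coeff, memLp_slice h1.memLp, memLp_slice h2.memLp] with s hs h3 h4 i
  rw [← hs]
  exact h.coeff_add h3 h4 i

theorem modeField_op_op (hu : StripSection J Λ S I u Du D2u) (h : SpectralProblem J Λ S x μ) :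
    ModeField x I (opField J S (opField J S u fun p => Du p (0, 1))
        (opFieldDeriv J S u (fun p => Du p (0, 1)) fun p => D2u p (0, 1) (0, 1)))
      fun i s => μ i ^ 2 * coeff x (fun t => u (s, t)) i := by
  refine ⟨memLp_opField J hu.closed h.continuous_coefficient
    (memLp_opField J hu.closed h.continuous_coefficient hu.memLp hu.memLp_dt)
    (memLp_opFieldDeriv J hu.closed h.smooth hu.memLp hu.memLp_dt hu.memLp_dtt),
    fun i => ((hu.modeField h).continuousOn i).const_mul _, ?_⟩
  filter_upwards [(hu.modeField_op h).coeff, hu.admissiblePath_op h.smooth] with s h1 h2 i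
  refine (h.coeff_op h2 i).trans ?_
  rw [h1]
  ring

theorem modeField_op_operator (hu : StripSection J Λ S I u Du D2u)
    (h : SpectralProblem J Λ S x μ) :
    ModeField x I (opField J S (fun p => Du p (1, 0) + opField J S u (fun p => Du p (0, 1)) p)
        (fun p => D2u p (0, 1) (1, 0) +
          opFieldDeriv J S u (fun p => Du p (0, 1)) (fun p => D2u p (0, 1) (0, 1)) p))
      fun i s => μ i *
        (coeff x (fun t => Du (s, t) (1, 0)) i + μ i * coeff x (fun t => u (s, t)) i) := by
  have h0 := hu.modeField_operator h
  refine ⟨memLp_opField J hu.closed h.continuous_coefficient h0.memLp (hu.memLp_dts.add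
      (memLp_opFieldDeriv J hu.closed h.smooth hu.memLp hu.memLp_dt hu.memLp_dtt)),
    fun i => (h0.continuousOn i).const_mul _, ?_⟩
  filter_upwards [h0.coeff, hu.admissiblePath_op h.smooth, hu.admissiblePath_ds] with s h1 h2 h3 i
  rw [← h1]
  exact h.coeff_op (h3.add h2) i

theorem hasSum_slice (hu : StripSection J Λ S I u Du D2u) (h : SpectralProblem J Λ S' x μ) :
    ∀ᵐ s ∂volume.restrict I, HasSum (fun i => coeff x (fun t => u (s, t)) i ^ 2)
      (∫ t in Icc (0 : ℝ) 1, ‖u (s, t)‖ ^ 2) := by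
  have : CompleteSpace E := FiniteDimensional.complete ℝ E
  filter_upwards [ae_restrict_mem hu.closed.measurableSet] with s hs
  exact h.hasSum_coeff_sq (hu.admissiblePath hs)

theorem hasSum_slice_op (hu : StripSection J Λ S I u Du D2u) (h : SpectralProblem J Λ S' x μ) :
    ∀ᵐ s ∂volume.restrict I, HasSum (fun i => (μ i * coeff x (fun t => u (s, t)) i) ^ 2)
      (∫ t in Icc (0 : ℝ) 1, ‖opField J S' u (fun p => Du p (0, 1)) (s, t)‖ ^ 2) := by
  filter_upwards [ae_restrict_mem hu.closed.measurableSet] with s hs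
  simp only [mul_pow]
  exact h.hasSum_coeff_op_sq (hu.admissiblePath hs)

theorem hasSum_slice_op_op (hu : StripSection J Λ S I u Du D2u)
    (h : SpectralProblem J Λ S x μ) :
    ∀ᵐ s ∂volume.restrict I, HasSum (fun i => (μ i ^ 2 * coeff x (fun t => u (s, t)) i) ^ 2)
      (∫ t in Icc (0 : ℝ) 1, ‖opField J S (opField J S u fun p => Du p (0, 1))
        (opFieldDeriv J S u (fun p => Du p (0, 1)) fun p => D2u p (0, 1) (0, 1)) (s, t)‖ ^ 2) := by
  filter_upwards [(hu.modeField_op h).coeff, hu.admissiblePath_op h.smooth] with s h1 h2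
  have h3 := h.hasSum_coeff_op_sq h2
  simp only [h1] at h3
  have h4 : ∀ i, (μ i ^ 2 * coeff x (fun t => u (s, t)) i) ^ 2 =
      μ i ^ 2 * (μ i * coeff x (fun t => u (s, t)) i) ^ 2 := fun i => by ring
  simp only [h4]
  exact h3

end StripSection

theorem norm32_sq {ι : Type*} (x : ι → ℝ → E) (μ : ι → ℝ) (γ : ℝ → E) :
    norm32 x μ γ ^ 2 = ∑' i, |μ i| ^ 3 * coeff x γ i ^ 2 :=
  Real.sq_sqrt (tsum_nonneg fun i => by positivity)

namespace StripSection

variable {J : E →L[ℝ] E} {Λ : Submodule ℝ E} {S S' : ℝ → E →L[ℝ] E} {ι : Type*}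
  {x : ι → ℝ → E} {μ : ι → ℝ} {I : Set ℝ} {B : Finset ℝ} {u : ℝ × ℝ → E}
  {Du : ℝ × ℝ → ℝ × ℝ →L[ℝ] E} {D2u : ℝ × ℝ → ℝ × ℝ →L[ℝ] ℝ × ℝ →L[ℝ] E} {m : ℝ}

theorem hasDerivAt_coeff (hu : StripSection J Λ S I u Du D2u) (h : SpectralProblem J Λ S' x μ)
    (i : ι) {s : ℝ} (hs : s ∈ interior I) :
    HasDerivAt (fun s => coeff x (fun t => u (s, t)) i) (coeff x (fun t => Du (s, t) (1, 0)) i) s :=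
  hasDerivAt_coeff_slice (h.continuous_eigenfunction i) hu.w22.1.1 (hu.continuousOn_deriv _) hs

theorem mode_estimate (hu : StripSection J Λ S I u Du D2u) (h : SpectralProblem J Λ S' x μ)
    (hT : TraceInterval I B) (i : ι) :
    μ i ^ 2 * ∫ s in I, coeff x (fun t => u (s, t)) i ^ 2 ≤
      (∫ s in I, (coeff x (fun t => Du (s, t) (1, 0)) i +
        μ i * coeff x (fun t => u (s, t)) i) ^ 2) +
      ∑ b ∈ B, |μ i| * coeff x (fun t => u (b, t)) i ^ 2 :=
  hT.mode_estimate ((hu.modeField h).continuousOn i) ((hu.modeField_ds h).continuousOn i)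
    (fun _ hs => hu.hasDerivAt_coeff h i hs) ((hu.modeField h).integrableOn_sq h hu.closed i)
    ((hu.modeField_ds h).integrableOn_sq h hu.closed i)

variable [FiniteDimensional ℝ E]

theorem sum_sq_integral_le (hu : StripSection J Λ S I u Du D2u) (h : SpectralProblem J Λ S x μ)
    (F : Finset ι) : ∑ i ∈ F, μ i ^ 4 * ∫ s in I, coeff x (fun t => u (s, t)) i ^ 2 ≤
      ∫ p in Strip I, ‖opField J S (opField J S u fun p => Du p (0, 1))
        (opFieldDeriv J S u (fun p => Du p (0, 1)) fun p => D2u p (0, 1) (0, 1)) p‖ ^ 2 := by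
  refine le_trans (Finset.sum_le_sum fun i _ => ?_) ((hu.modeField_op_op h).sum_le h hu.closed F)
  rw [← integral_const_mul]
  exact le_of_eq (integral_congr_ae (Filter.Eventually.of_forall fun s => by simp only; ring))

theorem sum_sq_integral_ds_le (hu : StripSection J Λ S I u Du D2u)
    (h : SpectralProblem J Λ S x μ) (F : Finset ι) :
    ∑ i ∈ F, μ i ^ 2 * ∫ s in I, coeff x (fun t => Du (s, t) (1, 0)) i ^ 2 ≤
      2 * (∫ p in Strip I, ‖opField J S
        (fun p => Du p (1, 0) + opField J S u (fun p => Du p (0, 1)) p)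
        (fun p => D2u p (0, 1) (1, 0) +
          opFieldDeriv J S u (fun p => Du p (0, 1)) (fun p => D2u p (0, 1) (0, 1)) p) p‖ ^ 2) +
      2 * ∫ p in Strip I, ‖opField J S (opField J S u fun p => Du p (0, 1))
        (opFieldDeriv J S u (fun p => Du p (0, 1)) fun p => D2u p (0, 1) (0, 1)) p‖ ^ 2 := by
  have h1 := hu.modeField_op_operator h
  have h2 := hu.modeField_op_op h
  have h3 := h1.sum_le h hu.closed F
  have h4 := h2.sum_le h hu.closed F
  refine le_trans ?_
    (add_le_add (mul_le_mul_of_nonneg_left h3 two_pos.le)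
      (mul_le_mul_of_nonneg_left h4 two_pos.le))
  rw [Finset.mul_sum, Finset.mul_sum, ← Finset.sum_add_distrib]
  refine Finset.sum_le_sum fun i _ => ?_
  have h5 := (h1.integrableOn_sq h hu.closed i).const_mul 2
  have h6 := (h2.integrableOn_sq h hu.closed i).const_mul 2
  rw [← integral_const_mul, ← integral_const_mul, ← integral_const_mul, ← integral_add h5 h6]
  refine integral_mono (((hu.modeField_ds h).integrableOn_sq h hu.closed i).const_mul _)
    (h5.add h6) fun s => ?_
  simp only
  nlinarith [sq_nonneg (μ i * (coeff x (fun t => Du (s, t) (1, 0)) i +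
    μ i * coeff x (fun t => u (s, t)) i) + μ i ^ 2 * coeff x (fun t => u (s, t)) i)]

theorem summable_norm32 (hu : StripSection J Λ S I u Du D2u) (h : SpectralProblem J Λ S x μ)
    (hT : TraceInterval I B) (hm : 0 < m) (hμ : ∀ i, m ≤ |μ i|) {s : ℝ} (hs : s ∈ I) :
    Summable fun i => |μ i| ^ 3 * coeff x (fun t => u (s, t)) i ^ 2 := by
  obtain ⟨L, hL, h1⟩ := hT.sq_le
  have h2 := summable_of_sum_le (fun i => mul_nonneg (by positivity)
    (integral_nonneg fun s => by positivity)) (hu.sum_sq_integral_le h)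
  have h3 := summable_of_sum_le (fun i => mul_nonneg (by positivity)
    (integral_nonneg fun s => by positivity)) (hu.sum_sq_integral_ds_le h)
  refine Summable.of_nonneg_of_le (fun i => by positivity) (fun i => ?_)
    ((h2.mul_left (L / m + 1)).add h3)
  have hi : 0 < |μ i| := hm.trans_le (hμ i)
  have h4 := h1 |μ i|⁻¹ _ _ (by positivity) ((hu.modeField h).continuousOn i)
    ((hu.modeField_ds h).continuousOn i)
    (fun _ hs => hu.hasDerivAt_coeff h i hs) ((hu.modeField h).integrableOn_sq h hu.closed i)
    ((hu.modeField_ds h).integrableOn_sq h hu.closed i) s hs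
  have h5 : 0 ≤ ∫ s in I, coeff x (fun t => u (s, t)) i ^ 2 :=
    integral_nonneg fun s => by positivity
  rw [inv_inv] at h4
  refine (mul_le_mul_of_nonneg_left h4 (by positivity : 0 ≤ |μ i| ^ 3)).trans ?_
  have h6 : |μ i| ^ 3 * L ≤ L / m * |μ i| ^ 4 := by
    rw [div_mul_eq_mul_div, le_div_iff₀ hm]
    nlinarith [mul_le_mul_of_nonneg_left (hμ i) (by positivity : 0 ≤ |μ i| ^ 3 * L)]
  have h7 : |μ i| ^ 4 = μ i ^ 4 := by rw [← abs_pow]; exact abs_of_nonneg (by positivity)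
  have h8 : |μ i| ^ 3 * |μ i|⁻¹ = μ i ^ 2 := by rw [← sq_abs]; field_simp
  rw [h7] at h6
  calc _ = (|μ i| ^ 3 * L + |μ i| ^ 4) * (∫ s in I, coeff x (fun t => u (s, t)) i ^ 2) +
        (|μ i| ^ 3 * |μ i|⁻¹) * ∫ s in I, coeff x (fun t => Du (s, t) (1, 0)) i ^ 2 := by ring
    _ ≤ (L / m * μ i ^ 4 + μ i ^ 4) * (∫ s in I, coeff x (fun t => u (s, t)) i ^ 2) + _ := by
        rw [h7, h8]; gcongr
    _ = _ := by ring

theorem sum_mul_sq_le_norm32 (hu : StripSection J Λ S I u Du D2u)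
    (h : SpectralProblem J Λ S x μ) (hT : TraceInterval I B) (hm : 0 < m)
    (hμ : ∀ i, m ≤ |μ i|) {s : ℝ} (hs : s ∈ I) {a : ι → ℝ} {C : ℝ} (hC : 0 ≤ C)
    (ha : ∀ i, a i ≤ C * |μ i| ^ 3) (F : Finset ι) :
    ∑ i ∈ F, a i * coeff x (fun t => u (s, t)) i ^ 2 ≤
      C * norm32 x μ (fun t => u (s, t)) ^ 2 := by
  rw [norm32_sq]
  refine le_trans ?_ (mul_le_mul_of_nonneg_left ((hu.summable_norm32 h hT hm hμ hs).sum_le_tsum F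
    fun i _ => by positivity) hC)
  rw [Finset.mul_sum]
  refine Finset.sum_le_sum fun i _ => ?_
  rw [← mul_assoc]
  exact mul_le_mul_of_nonneg_right (ha i) (sq_nonneg _)

theorem integral_op_sq_le (hu : StripSection J Λ S I u Du D2u) (h : SpectralProblem J Λ S x μ)
    (hT : TraceInterval I B) (hm : 0 < m) (hμ : ∀ i, m ≤ |μ i|) :
    ∫ p in Strip I, ‖opField J S u (fun p => Du p (0, 1)) p‖ ^ 2 ≤
      (∫ p in Strip I, ‖Du p (1, 0) + opField J S u (fun p => Du p (0, 1)) p‖ ^ 2) +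
        (m ^ 2)⁻¹ * ∑ b ∈ B, norm32 x μ (fun t => u (b, t)) ^ 2 := by
  have := h.countable_index
  refine le_of_hasSum_of_sum_le ((hu.modeField_op h).hasSum (hu.hasSum_slice_op h) hu.closed)
    fun F => ?_
  have h1 := (hu.modeField_operator h).sum_le h hu.closed F
  have h2 : ∑ i ∈ F, ∑ b ∈ B, |μ i| * coeff x (fun t => u (b, t)) i ^ 2 ≤
      (m ^ 2)⁻¹ * ∑ b ∈ B, norm32 x μ (fun t => u (b, t)) ^ 2 := by
    rw [Finset.sum_comm, Finset.mul_sum]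
    refine Finset.sum_le_sum fun b hb => hu.sum_mul_sq_le_norm32 h hT hm hμ (hT.subset b hb)
      (by positivity) (fun i => ?_) F
    have h3 := pow_le_pow_left₀ hm.le (hμ i) 2
    rw [inv_mul_eq_div, le_div_iff₀ (by positivity)]
    nlinarith [mul_le_mul_of_nonneg_left h3 (abs_nonneg (μ i))]
  refine le_trans ?_ (add_le_add h1 h2)
  rw [← Finset.sum_add_distrib]
  refine Finset.sum_le_sum fun i _ => ?_
  simp only [mul_pow, integral_const_mul]
  exact hu.mode_estimate h hT i

theorem integral_op_op_sq_le (hu : StripSection J Λ S I u Du D2u)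
    (h : SpectralProblem J Λ S x μ) (hT : TraceInterval I B) (hm : 0 < m)
    (hμ : ∀ i, m ≤ |μ i|) :
    ∫ p in Strip I, ‖opField J S (opField J S u fun p => Du p (0, 1))
        (opFieldDeriv J S u (fun p => Du p (0, 1)) fun p => D2u p (0, 1) (0, 1)) p‖ ^ 2 ≤
      (∫ p in Strip I, ‖opField J S
        (fun p => Du p (1, 0) + opField J S u (fun p => Du p (0, 1)) p)
        (fun p => D2u p (0, 1) (1, 0) +
          opFieldDeriv J S u (fun p => Du p (0, 1)) (fun p => D2u p (0, 1) (0, 1)) p) p‖ ^ 2) +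
        ∑ b ∈ B, norm32 x μ (fun t => u (b, t)) ^ 2 := by
  have := h.countable_index
  refine le_of_hasSum_of_sum_le ((hu.modeField_op_op h).hasSum (hu.hasSum_slice_op_op h)
    hu.closed) fun F => ?_
  have h1 := (hu.modeField_op_operator h).sum_le h hu.closed F
  have h2 : ∑ i ∈ F, ∑ b ∈ B, |μ i| ^ 3 * coeff x (fun t => u (b, t)) i ^ 2 ≤
      ∑ b ∈ B, norm32 x μ (fun t => u (b, t)) ^ 2 := by
    rw [Finset.sum_comm]
    refine Finset.sum_le_sum fun b hb => (hu.sum_mul_sq_le_norm32 h hT hm hμ (hT.subset b hb)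
      zero_le_one (fun i => (one_mul _).ge) F).trans_eq (one_mul _)
  refine le_trans ?_ (add_le_add h1 h2)
  rw [← Finset.sum_add_distrib]
  refine Finset.sum_le_sum fun i _ => ?_
  simp only [mul_pow, integral_const_mul]
  have h3 := mul_le_mul_of_nonneg_left (hu.mode_estimate h hT i) (sq_nonneg (μ i))
  rw [mul_add, Finset.mul_sum] at h3
  refine le_trans (le_of_eq (by ring)) (h3.trans (le_of_eq ?_))
  congr 1
  refine Finset.sum_congr rfl fun b _ => ?_
  rw [← sq_abs (μ i)]
  ring

end StripSection

namespace StripSection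

variable {J : E →L[ℝ] E} {Λ : Submodule ℝ E} {S S' : ℝ → E →L[ℝ] E} {ι κ : Type*}
  {x : ι → ℝ → E} {μ : ι → ℝ} {y : κ → ℝ → E} {ν : κ → ℝ} {I : Set ℝ} {B : Finset ℝ}
  {u : ℝ × ℝ → E} {Du : ℝ × ℝ → ℝ × ℝ →L[ℝ] E} {D2u : ℝ × ℝ → ℝ × ℝ →L[ℝ] ℝ × ℝ →L[ℝ] E} {m : ℝ}
  [FiniteDimensional ℝ E]

theorem exists_norm_sq_le (h : SpectralProblem J Λ S x μ) (hT : TraceInterval I B) :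
    ∃ C : ℝ, 0 ≤ C ∧ ∃ L : ℝ, 0 ≤ L ∧ ∀ (ε : ℝ) (u : ℝ × ℝ → E) (Du : ℝ × ℝ → ℝ × ℝ →L[ℝ] E)
      (D2u : ℝ × ℝ → ℝ × ℝ →L[ℝ] ℝ × ℝ →L[ℝ] E), 0 < ε → StripSection J Λ S I u Du D2u →
      ∀ p ∈ Strip I, ‖u p‖ ^ 2 ≤
        C * ((L + ε⁻¹) * (∫ p in Strip I, ‖opField J S u (fun p => Du p (0, 1)) p‖ ^ 2) +
        ε * (2 * (∫ p in Strip I, ‖opField J S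
          (fun p => Du p (1, 0) + opField J S u (fun p => Du p (0, 1)) p)
          (fun p => D2u p (0, 1) (1, 0) +
            opFieldDeriv J S u (fun p => Du p (0, 1)) (fun p => D2u p (0, 1) (0, 1)) p) p‖ ^ 2) +
        2 * ∫ p in Strip I, ‖opField J S (opField J S u fun p => Du p (0, 1))
          (opFieldDeriv J S u (fun p => Du p (0, 1)) fun p => D2u p (0, 1) (0, 1)) p‖ ^ 2)) := by
  obtain ⟨C, hC, h1⟩ := h.exists_norm_sq_le_tsum
  obtain ⟨L, hL, h2⟩ := hT.sq_le
  refine ⟨C, hC, L, hL, fun ε u Du D2u hε hu p hp => ?_⟩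
  have h3 := h.hasSum_coeff_op_sq (hu.admissiblePath hp.1)
  refine (h1 _ _ (hu.admissiblePath hp.1) p.2 hp.2).trans (mul_le_mul_of_nonneg_left ?_ hC)
  refine h3.summable.tsum_le_of_sum_le fun F => ?_
  have h4 := mul_le_mul_of_nonneg_left ((hu.modeField_op h).sum_le h hu.closed F)
    (by positivity : 0 ≤ L + ε⁻¹)
  have h5 := mul_le_mul_of_nonneg_left (hu.sum_sq_integral_ds_le h F) hε.le
  refine le_trans ?_ (add_le_add h4 h5)
  rw [Finset.mul_sum, Finset.mul_sum, ← Finset.sum_add_distrib]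
  refine Finset.sum_le_sum fun i _ => ?_
  have h6 := h2 ε _ _ hε ((hu.modeField h).continuousOn i)
    ((hu.modeField_ds h).continuousOn i)
    (fun _ hs => hu.hasDerivAt_coeff h i hs) ((hu.modeField h).integrableOn_sq h hu.closed i)
    ((hu.modeField_ds h).integrableOn_sq h hu.closed i) p.1 hp.1
  simp only [mul_pow, integral_const_mul]
  refine (mul_le_mul_of_nonneg_left h6 (sq_nonneg (μ i))).trans (le_of_eq ?_)
  ring

theorem integral_slice_norm_sq_le (hu : StripSection J Λ S I u Du D2u)
    (h : SpectralProblem J Λ S x μ) (hT : TraceInterval I B) (hm : 0 < m)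
    (hμ : ∀ i, m ≤ |μ i|) {s : ℝ} (hs : s ∈ I) :
    ∫ t in Icc (0 : ℝ) 1, ‖u (s, t)‖ ^ 2 ≤ (m ^ 3)⁻¹ * norm32 x μ (fun t => u (s, t)) ^ 2 := by
  have : CompleteSpace E := FiniteDimensional.complete ℝ E
  refine le_of_hasSum_of_sum_le (h.hasSum_coeff_sq (hu.admissiblePath hs)) fun F => ?_
  refine le_trans (le_of_eq ?_) (hu.sum_mul_sq_le_norm32 h hT hm hμ hs (a := fun _ => 1)
    (by positivity) (fun i => ?_) F)
  · simp
  · rw [inv_mul_eq_div, le_div_iff₀ (by positivity), one_mul]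
    exact pow_le_pow_left₀ hm.le (hμ i) 3

theorem integral_slice_op_norm_sq_le (hu : StripSection J Λ S I u Du D2u)
    (h : SpectralProblem J Λ S x μ) (hT : TraceInterval I B) (hm : 0 < m)
    (hμ : ∀ i, m ≤ |μ i|) {s : ℝ} (hs : s ∈ I) :
    ∫ t in Icc (0 : ℝ) 1, ‖J (Du (s, t) (0, 1)) + S t (u (s, t))‖ ^ 2 ≤
      m⁻¹ * norm32 x μ (fun t => u (s, t)) ^ 2 := by
  refine le_of_hasSum_of_sum_le (h.hasSum_coeff_op_sq (hu.admissiblePath hs)) fun F => ?_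
  refine hu.sum_mul_sq_le_norm32 h hT hm hμ hs (by positivity) (fun i => ?_) F
  rw [inv_mul_eq_div, le_div_iff₀ (by positivity), ← sq_abs]
  nlinarith [mul_le_mul_of_nonneg_left (hμ i) (sq_nonneg |μ i|)]

/-- Coefficients with respect to another spectral problem are controlled by the `E^{3/2}`-norm. -/
theorem exists_sum_abs_mul_sq_le (h : SpectralProblem J Λ S x μ) (h' : SpectralProblem J Λ S' y ν)
    (hT : TraceInterval I B) (hm : 0 < m) (hμ : ∀ i, m ≤ |μ i|) (M : ℝ) :
    ∃ C : ℝ, 0 ≤ C ∧ ∀ (u : ℝ × ℝ → E) (Du : ℝ × ℝ → ℝ × ℝ →L[ℝ] E)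
      (D2u : ℝ × ℝ → ℝ × ℝ →L[ℝ] ℝ × ℝ →L[ℝ] E), StripSection J Λ S I u Du D2u →
      ∀ s ∈ I, ∀ r : ℝ, |r| ≤ M → ∀ F : Finset κ,
      ∑ i ∈ F, |ν i + r| * coeff y (fun t => u (s, t)) i ^ 2 ≤
        C * norm32 x μ (fun t => u (s, t)) ^ 2 := by
  obtain ⟨m', hm', hν⟩ := h'.exists_le_abs_eigenvalue
  obtain ⟨K₁, hK₁, h1⟩ := h.exists_norm_coefficient_le
  obtain ⟨K₂, hK₂, h2⟩ := h'.exists_norm_coefficient_le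
  refine ⟨m'⁻¹ * (2 * m⁻¹ + 2 * (K₁ + K₂) ^ 2 * (m ^ 3)⁻¹) + |M| * (m ^ 3)⁻¹, by positivity,
    fun u Du D2u hu s hs r hr F => ?_⟩
  have hf := hu.admissiblePath hs
  have e1 := hu.integral_slice_norm_sq_le h hT hm hμ hs
  have e2 := hu.integral_slice_op_norm_sq_le h hT hm hμ hs
  have p0 : MemLp (fun t => u (s, t)) 2 (volume.restrict (Icc (0 : ℝ) 1)) :=
    memLp_of_continuousOn hf.continuousOn
  have p1 := h.memLp_op hf.continuousOn hf.memLp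
  have p2 := h'.memLp_op hf.continuousOn hf.memLp
  have e3 := h'.sum_coeff_sq_le p0 F
  have e4 := h'.sum_coeff_sq_le p2 F
  simp only [h'.coeff_op hf] at e4
  have e5 : ∫ t in Icc (0 : ℝ) 1, ‖J (Du (s, t) (0, 1)) + S' t (u (s, t))‖ ^ 2 ≤
      2 * (∫ t in Icc (0 : ℝ) 1, ‖J (Du (s, t) (0, 1)) + S t (u (s, t))‖ ^ 2) +
      2 * (K₁ + K₂) ^ 2 * ∫ t in Icc (0 : ℝ) 1, ‖u (s, t)‖ ^ 2 := by
    have q0 := (p0.integrable_norm_pow two_ne_zero).const_mul (2 * (K₁ + K₂) ^ 2)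
    have q1 := (p1.integrable_norm_pow two_ne_zero).const_mul 2
    have q2 := p2.integrable_norm_pow two_ne_zero
    rw [← integral_const_mul, ← integral_const_mul, ← integral_add q1 q0]
    refine setIntegral_mono_on q2 (q1.add q0) measurableSet_Icc fun t ht => ?_
    have q3 : ‖J (Du (s, t) (0, 1)) + S' t (u (s, t))‖ ≤
        ‖J (Du (s, t) (0, 1)) + S t (u (s, t))‖ + (K₁ + K₂) * ‖u (s, t)‖ := by
      have q4 : J (Du (s, t) (0, 1)) + S' t (u (s, t)) =
        (J (Du (s, t) (0, 1)) + S t (u (s, t))) + (S' t (u (s, t)) - S t (u (s, t))) := by abel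
      rw [q4]
      refine (norm_add_le _ _).trans (add_le_add_right ((norm_sub_le _ _).trans ?_) _)
      have := (S t).le_of_opNorm_le (h1 t ht) (u (s, t))
      have := (S' t).le_of_opNorm_le (h2 t ht) (u (s, t))
      linarith
    have q5 := pow_le_pow_left₀ (norm_nonneg _) q3 2
    simp only
    nlinarith [sq_nonneg (‖J (Du (s, t) (0, 1)) + S t (u (s, t))‖ - (K₁ + K₂) * ‖u (s, t)‖)]
  have e6 : ∑ i ∈ F, |ν i + r| * coeff y (fun t => u (s, t)) i ^ 2 ≤
      m'⁻¹ * (∑ i ∈ F, (ν i * coeff y (fun t => u (s, t)) i) ^ 2) +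
        |M| * ∑ i ∈ F, coeff y (fun t => u (s, t)) i ^ 2 := by
    rw [Finset.mul_sum, Finset.mul_sum, ← Finset.sum_add_distrib]
    refine Finset.sum_le_sum fun i _ => ?_
    have q1 : |ν i| ≤ m'⁻¹ * ν i ^ 2 := by
      rw [inv_mul_eq_div, le_div_iff₀ hm', ← sq_abs]
      nlinarith [mul_le_mul_of_nonneg_left (hν i) (abs_nonneg (ν i))]
    have q2 := abs_add_le (ν i) r
    have q3 := le_abs_self M
    calc _ ≤ (m'⁻¹ * ν i ^ 2 + |M|) * coeff y (fun t => u (s, t)) i ^ 2 := by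
          gcongr; linarith
      _ = _ := by ring
  refine e6.trans ((add_le_add (mul_le_mul_of_nonneg_left (e4.trans (e5.trans (add_le_add
    (mul_le_mul_of_nonneg_left e2 two_pos.le) (mul_le_mul_of_nonneg_left e1 (by positivity)))))
    (by positivity)) (mul_le_mul_of_nonneg_left (e3.trans e1) (abs_nonneg M))).trans
    (le_of_eq (by ring)))

end StripSection

namespace StripSection

variable {J : E →L[ℝ] E} {Λ : Submodule ℝ E} {S S' : ℝ → E →L[ℝ] E} {ι κ : Type*}
  {x : ι → ℝ → E} {μ : ι → ℝ} {y : κ → ℝ → E} {ν : κ → ℝ} {I : Set ℝ} {B : Finset ℝ}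
  {u : ℝ × ℝ → E} {Du : ℝ × ℝ → ℝ × ℝ →L[ℝ] E} {D2u : ℝ × ℝ → ℝ × ℝ →L[ℝ] ℝ × ℝ →L[ℝ] E}
  {R : ℝ × ℝ → E →L[ℝ] E} {K σ M₀ : ℝ}

theorem memLp_Dop (hu : StripSection J Λ S I u Du D2u) (hS : Continuous S)
    (hR : ContinuousOn R (Strip I)) (hK : ∀ p ∈ Strip I, ‖R p‖ ≤ K) :
    MemLp (fun p => Dop J (fun s t => S t + R (s, t)) u Du p) 2 (volume.restrict (Strip I)) := by
  have h1 := (hu.memLp_ds.add (J.comp_memLp' hu.memLp_dt)).add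
    ((memLp_coefficient_apply hu.closed hS hu.memLp).add (memLp_clm_apply hu.closed
    (hR.aestronglyMeasurable (isClosed_Strip hu.closed).measurableSet) hK hu.memLp))
  exact h1

variable [FiniteDimensional ℝ E]

/-- The `L²` estimate, proved with a weight that is large where the operator is far from its
limit. -/
theorem exists_integral_norm_sq_le (h : SpectralProblem J Λ S x μ)
    (h' : SpectralProblem J Λ S' y ν) (hT : TraceInterval I B) (hσ : σ ^ 2 = 1)
    (hM₀ : ∀ s ∈ I, Real.exp (-σ * s) ≤ M₀) (hR : ContinuousOn R (Strip I))
    (hK : ∀ p ∈ Strip I, ‖R p‖ ≤ K)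
    (hlim : ∀ δ : ℝ, 0 < δ → ∃ s₀ : ℝ, ∀ q ∈ Strip I, s₀ ≤ |q.1| →
      ‖S q.2 + R q - S' q.2‖ ≤ δ) :
    ∃ C : ℝ, 0 ≤ C ∧ ∀ (u : ℝ × ℝ → E) (Du : ℝ × ℝ → ℝ × ℝ →L[ℝ] E)
      (D2u : ℝ × ℝ → ℝ × ℝ →L[ℝ] ℝ × ℝ →L[ℝ] E), StripSection J Λ S I u Du D2u →
      ∫ p in Strip I, ‖u p‖ ^ 2 ≤
        C * ((∫ p in Strip I, ‖Dop J (fun s t => S t + R (s, t)) u Du p‖ ^ 2) +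
          ∑ b ∈ B, norm32 x μ (fun t => u (b, t)) ^ 2) := by
  obtain ⟨m, hm, hμ⟩ := h.exists_le_abs_eigenvalue
  obtain ⟨m', hm', hν⟩ := h'.exists_le_abs_eigenvalue
  obtain ⟨K₁, hK₁, hS₁⟩ := h.exists_norm_coefficient_le
  obtain ⟨K₂, hK₂, hS₂⟩ := h'.exists_norm_coefficient_le
  set c₀ : ℝ := min (m' / 2) (m' ^ 2 / 4) with hc₀
  have hc₀pos : 0 < c₀ := lt_min (by positivity) (by positivity)
  obtain ⟨s₀, hs₀⟩ := hlim (Real.sqrt c₀ / 4) (by positivity)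
  set l : ℝ := Real.exp |s₀| * (8 * (K₁ + |K| + K₂) ^ 2) with hl
  have hl0 : 0 ≤ l := by positivity
  set φ : ℝ → ℝ := fun s => l * Real.exp (-σ * s) with hφ
  set M : ℝ := l * |M₀| with hM
  have hφ0 : ∀ s, 0 ≤ φ s := fun s => by positivity
  have hφM : ∀ s ∈ I, φ s ≤ M := fun s hs =>
    mul_le_mul_of_nonneg_left ((hM₀ s hs).trans (le_abs_self _)) hl0
  have hφd : ∀ s, HasDerivAt φ (-σ * φ s) s := fun s => by
    have := (((hasDerivAt_id s).const_mul (-σ)).exp).const_mul l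
    refine this.congr_deriv ?_
    simp only [hφ, id]
    ring
  have hφc : Continuous φ := by fun_prop
  set w : ℝ → ℝ := fun s => (c₀ + φ s) / 2 with hw
  have hw0 : ∀ s, 0 ≤ w s := fun s => by have := hφ0 s; simp only [hw]; positivity
  have hwc : Continuous w := by fun_prop
  have hpert : ∀ p ∈ Strip I, 2 * ‖S p.2 + R p - S' p.2‖ ^ 2 ≤ w p.1 / 2 := by
    intro p hp
    have h0 := hφ0 p.1
    rcases le_or_gt s₀ |p.1| with h1 | h1
    · have h2 := pow_le_pow_left₀ (norm_nonneg _) (hs₀ p hp h1) 2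
      rw [div_pow, Real.sq_sqrt hc₀pos.le] at h2
      simp only [hw]
      linarith
    · have h2 : ‖S p.2 + R p - S' p.2‖ ≤ K₁ + |K| + K₂ :=
        (norm_sub_le _ _).trans (add_le_add ((norm_add_le _ _).trans (add_le_add (hS₁ _ hp.2)
          ((hK p hp).trans (le_abs_self K)))) (hS₂ _ hp.2))
      have h3 := pow_le_pow_left₀ (norm_nonneg _) h2 2
      have h4 : 1 ≤ Real.exp |s₀| * Real.exp (-σ * p.1) := by
        rw [← Real.exp_add]
        refine Real.one_le_exp ?_
        have h5 : |σ * p.1| = |p.1| := by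
          rw [abs_mul, (by rw [← abs_one, ← sq_eq_sq_iff_abs_eq_abs, hσ, one_pow] : |σ| = 1),
            one_mul]
        have h6 := le_abs_self (σ * p.1)
        have h7 := le_abs_self s₀
        linarith
      have h5 : 8 * (K₁ + |K| + K₂) ^ 2 ≤ φ p.1 := by
        have h6 := mul_le_mul_of_nonneg_left h4
          (by positivity : 0 ≤ 8 * (K₁ + |K| + K₂) ^ 2)
        simp only [hφ, hl]
        linarith
      simp only [hw]
      linarith
  obtain ⟨Cb, hCb, hbd⟩ := exists_sum_abs_mul_sq_le h h' hT hm hμ M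
  refine ⟨2 / c₀ * (2 * (2 * Real.exp (2 * M) + Real.exp (2 * M) * Cb)), by positivity,
    fun u Du D2u hu => ?_⟩
  have := h'.countable_index
  have hI := hu.closed
  have hexpM : ∀ s ∈ I, Real.exp (2 * φ s) ≤ Real.exp (2 * M) := fun s hs =>
    Real.exp_le_exp.2 (by have := hφM s hs; linarith)
  have hexpc : Continuous fun s => Real.exp (2 * φ s) := by fun_prop
  have hexpb : ∀ s ∈ I, |Real.exp (2 * φ s)| ≤ Real.exp (2 * M) := fun s hs => by
    rw [abs_of_pos (Real.exp_pos _)]; exact hexpM s hs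
  have hgb : ∀ s ∈ I, |w s * Real.exp (2 * φ s)| ≤ (c₀ + M) / 2 * Real.exp (2 * M) := by
    intro s hs
    have h1 : w s ≤ (c₀ + M) / 2 := by have := hφM s hs; simp only [hw]; linarith
    rw [abs_of_nonneg (mul_nonneg (hw0 s) (Real.exp_pos _).le)]
    exact mul_le_mul h1 (hexpM s hs) (Real.exp_pos _).le ((hw0 s).trans h1)
  have hg0 : ∀ s, 0 ≤ w s * Real.exp (2 * φ s) := fun s => mul_nonneg (hw0 s) (Real.exp_pos _).le
  have hgc : Continuous fun s => w s * Real.exp (2 * φ s) := hwc.mul hexpc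
  set N : ℝ := ∑ b ∈ B, norm32 x μ (fun t => u (b, t)) ^ 2 with hN
  have hN0 : 0 ≤ N := Finset.sum_nonneg fun b _ => sq_nonneg _
  have hmode := hu.modeField h'
  have hop := hu.modeField_operator h'
  have main : ∫ p in Strip I, (w p.1 * Real.exp (2 * φ p.1)) * ‖u p‖ ^ 2 ≤
      (∫ p in Strip I, Real.exp (2 * φ p.1) *
        ‖Du p (1, 0) + opField J S' u (fun p => Du p (0, 1)) p‖ ^ 2) +
      Real.exp (2 * M) * Cb * N := by
    refine le_of_hasSum_of_sum_le (hmode.hasSum_weighted (hu.hasSum_slice h') hI hgc.continuousOn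
      hg0 hgb) fun F => ?_
    have h1 := hop.sum_weighted_le h' hI hexpc.continuousOn (fun s => (Real.exp_pos _).le) hexpb F
    have h2 : ∑ i ∈ F, ∑ b ∈ B, |ν i + σ * φ b| * Real.exp (2 * φ b) *
        coeff y (fun t => u (b, t)) i ^ 2 ≤ Real.exp (2 * M) * Cb * N := by
      rw [Finset.sum_comm, hN, Finset.mul_sum]
      refine Finset.sum_le_sum fun b hb => ?_
      have hbI := hT.subset b hb
      have h3 : |σ * φ b| ≤ M := by
        rw [abs_mul, (by rw [← abs_one, ← sq_eq_sq_iff_abs_eq_abs, hσ, one_pow] : |σ| = 1),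
            one_mul, abs_of_nonneg (hφ0 b)]
        exact hφM b hbI
      rw [mul_assoc]
      refine le_trans ?_ (mul_le_mul_of_nonneg_left (hbd u Du D2u hu b hbI _ h3 F)
        (Real.exp_pos _).le)
      rw [Finset.mul_sum]
      refine Finset.sum_le_sum fun i _ => ?_
      have h4 := mul_le_mul_of_nonneg_right (hexpM b hbI) (by positivity :
        0 ≤ |ν i + σ * φ b| * coeff y (fun t => u (b, t)) i ^ 2)
      linarith
    refine le_trans ?_ (add_le_add h1 h2)
    rw [← Finset.sum_add_distrib]
    refine Finset.sum_le_sum fun i _ => ?_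
    exact hT.weighted_mode_estimate hσ hφd hφ0 hφM hwc.continuousOn hw0
      (fun s => weight_lower_bound hm' (hν i) hσ (hφ0 s)) (hmode.continuousOn i)
      ((hu.modeField_ds h').continuousOn i) (fun _ hs => hu.hasDerivAt_coeff h' i hs)
      (hmode.integrableOn_sq h' hI i) ((hu.modeField_ds h').integrableOn_sq h' hI i)
  have hD := hu.memLp_Dop h.continuous_coefficient hR hK
  have i1 : IntegrableOn (fun p => ‖Dop J (fun s t => S t + R (s, t)) u Du p‖ ^ 2) (Strip I) :=
    hD.integrable_norm_pow two_ne_zero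
  have i2 := hmode.integrableOn_mul_norm_sq hI hgc.continuousOn hgb
  have i3 := hop.integrableOn_mul_norm_sq hI hexpc.continuousOn hexpb
  have split : ∫ p in Strip I, Real.exp (2 * φ p.1) *
        ‖Du p (1, 0) + opField J S' u (fun p => Du p (0, 1)) p‖ ^ 2 ≤
      2 * Real.exp (2 * M) *
        (∫ p in Strip I, ‖Dop J (fun s t => S t + R (s, t)) u Du p‖ ^ 2) +
      1 / 2 * ∫ p in Strip I, (w p.1 * Real.exp (2 * φ p.1)) * ‖u p‖ ^ 2 := by
    rw [← integral_const_mul, ← integral_const_mul,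
      ← integral_add (i1.const_mul _) (i2.const_mul _)]
    refine setIntegral_mono_on i3 ((i1.const_mul _).add (i2.const_mul _))
      (isClosed_Strip hI).measurableSet fun p hp => ?_
    have h1 : Du p (1, 0) + opField J S' u (fun p => Du p (0, 1)) p =
        Dop J (fun s t => S t + R (s, t)) u Du p - (S p.2 + R p - S' p.2) (u p) := by
      simp only [Dop, opField, sub_apply, add_apply]
      abel
    have h2 : ‖Du p (1, 0) + opField J S' u (fun p => Du p (0, 1)) p‖ ≤
        ‖Dop J (fun s t => S t + R (s, t)) u Du p‖ + ‖S p.2 + R p - S' p.2‖ * ‖u p‖ := by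
      rw [h1]
      exact (norm_sub_le _ _).trans (add_le_add_right ((S p.2 + R p - S' p.2).le_opNorm _) _)
    have h3 := pow_le_pow_left₀ (norm_nonneg _) h2 2
    have h4 := mul_le_mul_of_nonneg_right (hpert p hp) (sq_nonneg ‖u p‖)
    have h5 : ‖Du p (1, 0) + opField J S' u (fun p => Du p (0, 1)) p‖ ^ 2 ≤
        2 * ‖Dop J (fun s t => S t + R (s, t)) u Du p‖ ^ 2 + w p.1 / 2 * ‖u p‖ ^ 2 := by
      nlinarith [sq_nonneg (‖Dop J (fun s t => S t + R (s, t)) u Du p‖ -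
        ‖S p.2 + R p - S' p.2‖ * ‖u p‖)]
    have h6 := mul_le_mul_of_nonneg_left h5 (Real.exp_pos (2 * φ p.1)).le
    have h7 := mul_le_mul_of_nonneg_right (hexpM p.1 hp.1)
      (sq_nonneg ‖Dop J (fun s t => S t + R (s, t)) u Du p‖)
    linarith
  have low : c₀ / 2 * ∫ p in Strip I, ‖u p‖ ^ 2 ≤
      ∫ p in Strip I, (w p.1 * Real.exp (2 * φ p.1)) * ‖u p‖ ^ 2 := by
    rw [← integral_const_mul]
    refine setIntegral_mono_on (hmode.integrableOn_norm_sq.const_mul _) i2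
      (isClosed_Strip hI).measurableSet fun p _ => ?_
    refine mul_le_mul_of_nonneg_right ?_ (sq_nonneg _)
    have h1 : c₀ / 2 ≤ w p.1 := by have := hφ0 p.1; simp only [hw]; linarith
    have h2 : 1 ≤ Real.exp (2 * φ p.1) := Real.one_le_exp (by have := hφ0 p.1; linarith)
    nlinarith [hw0 p.1]
  set F : ℝ := ∫ p in Strip I, ‖Dop J (fun s t => S t + R (s, t)) u Du p‖ ^ 2 with hF
  have hF0 : 0 ≤ F := integral_nonneg fun p => sq_nonneg _
  have fin : c₀ / 2 * (∫ p in Strip I, ‖u p‖ ^ 2) ≤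
      2 * (2 * Real.exp (2 * M) * F + Real.exp (2 * M) * Cb * N) := by linarith
  have e1 : 0 ≤ Real.exp (2 * M) * N := by positivity
  have e2 : 0 ≤ Real.exp (2 * M) * Cb * F := by positivity
  rw [div_mul_eq_mul_div, div_mul_eq_mul_div, le_div_iff₀ hc₀pos]
  linarith

end StripSection

omit [InnerProductSpace ℝ E] in
theorem integral_norm_sq_le_two {α : Type*} {mα : MeasurableSpace α} {τ : Measure α}
    {f g₁ g₂ : α → E} {a₁ a₂ : ℝ} (hf : MemLp f 2 τ) (h₁ : MemLp g₁ 2 τ) (h₂ : MemLp g₂ 2 τ)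
    (h : ∀ᵐ p ∂τ, ‖f p‖ ≤ a₁ * ‖g₁ p‖ + a₂ * ‖g₂ p‖) :
    ∫ p, ‖f p‖ ^ 2 ∂τ ≤
      2 * a₁ ^ 2 * (∫ p, ‖g₁ p‖ ^ 2 ∂τ) + 2 * a₂ ^ 2 * ∫ p, ‖g₂ p‖ ^ 2 ∂τ := by
  have i₁ := (h₁.integrable_norm_pow two_ne_zero).const_mul (2 * a₁ ^ 2)
  have i₂ := (h₂.integrable_norm_pow two_ne_zero).const_mul (2 * a₂ ^ 2)
  rw [← integral_const_mul, ← integral_const_mul, ← integral_add i₁ i₂]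
  refine integral_mono_ae (hf.integrable_norm_pow two_ne_zero) (i₁.add i₂) ?_
  filter_upwards [h] with p hp
  have := pow_le_pow_left₀ (norm_nonneg _) hp 2
  nlinarith [sq_nonneg (a₁ * ‖g₁ p‖ - a₂ * ‖g₂ p‖)]

omit [InnerProductSpace ℝ E] in
theorem integral_norm_sq_le_four {α : Type*} {mα : MeasurableSpace α} {τ : Measure α}
    {f g₁ g₂ g₃ g₄ : α → E} {a₁ a₂ a₃ a₄ : ℝ} (hf : MemLp f 2 τ) (h₁ : MemLp g₁ 2 τ)
    (h₂ : MemLp g₂ 2 τ) (h₃ : MemLp g₃ 2 τ) (h₄ : MemLp g₄ 2 τ)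
    (h : ∀ᵐ p ∂τ, ‖f p‖ ≤ a₁ * ‖g₁ p‖ + a₂ * ‖g₂ p‖ + a₃ * ‖g₃ p‖ + a₄ * ‖g₄ p‖) :
    ∫ p, ‖f p‖ ^ 2 ∂τ ≤
      4 * a₁ ^ 2 * (∫ p, ‖g₁ p‖ ^ 2 ∂τ) + 4 * a₂ ^ 2 * (∫ p, ‖g₂ p‖ ^ 2 ∂τ) +
      4 * a₃ ^ 2 * (∫ p, ‖g₃ p‖ ^ 2 ∂τ) + 4 * a₄ ^ 2 * ∫ p, ‖g₄ p‖ ^ 2 ∂τ := by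
  have i₁ := (h₁.integrable_norm_pow two_ne_zero).const_mul (4 * a₁ ^ 2)
  have i₂ := (h₂.integrable_norm_pow two_ne_zero).const_mul (4 * a₂ ^ 2)
  have i₃ := (h₃.integrable_norm_pow two_ne_zero).const_mul (4 * a₃ ^ 2)
  have i₄ := (h₄.integrable_norm_pow two_ne_zero).const_mul (4 * a₄ ^ 2)
  have i₁₂ : Integrable (fun p => 4 * a₁ ^ 2 * ‖g₁ p‖ ^ 2 + 4 * a₂ ^ 2 * ‖g₂ p‖ ^ 2) τ := i₁.add i₂
  have i₁₂₃ : Integrable (fun p => 4 * a₁ ^ 2 * ‖g₁ p‖ ^ 2 + 4 * a₂ ^ 2 * ‖g₂ p‖ ^ 2 +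
    4 * a₃ ^ 2 * ‖g₃ p‖ ^ 2) τ := i₁₂.add i₃
  rw [← integral_const_mul, ← integral_const_mul, ← integral_const_mul, ← integral_const_mul,
    ← integral_add i₁ i₂, ← integral_add i₁₂ i₃, ← integral_add i₁₂₃ i₄]
  refine integral_mono_ae (hf.integrable_norm_pow two_ne_zero) (i₁₂₃.add i₄) ?_
  filter_upwards [h] with p hp
  have := pow_le_pow_left₀ (norm_nonneg _) hp 2
  nlinarith [sq_nonneg (a₁ * ‖g₁ p‖ - a₂ * ‖g₂ p‖), sq_nonneg (a₁ * ‖g₁ p‖ - a₃ * ‖g₃ p‖),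
    sq_nonneg (a₁ * ‖g₁ p‖ - a₄ * ‖g₄ p‖), sq_nonneg (a₂ * ‖g₂ p‖ - a₃ * ‖g₃ p‖),
    sq_nonneg (a₂ * ‖g₂ p‖ - a₄ * ‖g₄ p‖), sq_nonneg (a₃ * ‖g₃ p‖ - a₄ * ‖g₄ p‖)]

theorem memLp_clm_apply_of_bounded {I : Set ℝ} (hI : IsClosed I) {T : ℝ × ℝ → E →L[ℝ] E}
    {u : ℝ × ℝ → E} {U : ℝ} (hT : MemLp T 2 (volume.restrict (Strip I)))
    (hu : AEStronglyMeasurable u (volume.restrict (Strip I))) (hU : ∀ p ∈ Strip I, ‖u p‖ ^ 2 ≤ U) :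
    MemLp (fun p => T p (u p)) 2 (volume.restrict (Strip I)) ∧
      ∫ p in Strip I, ‖T p (u p)‖ ^ 2 ≤ (∫ p in Strip I, ‖T p‖ ^ 2) * U := by
  have h1 : MemLp (fun p => T p (u p)) 2 (volume.restrict (Strip I)) := by
    refine hT.of_le_mul (c := Real.sqrt U)
      (isBoundedBilinearMap_apply.continuous.comp_aestronglyMeasurable (hT.1.prodMk hu)) ?_
    filter_upwards [ae_restrict_mem (isClosed_Strip hI).measurableSet] with p hp
    rw [mul_comm]
    exact (T p).le_opNorm_of_le (Real.le_sqrt_of_sq_le (hU p hp))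
  refine ⟨h1, ?_⟩
  rw [← integral_mul_const]
  refine setIntegral_mono_on (h1.integrable_norm_pow two_ne_zero)
    ((hT.integrable_norm_pow two_ne_zero).mul_const _) (isClosed_Strip hI).measurableSet
    fun p hp => ?_
  refine (pow_le_pow_left₀ (norm_nonneg _) ((T p).le_opNorm _) 2).trans ?_
  rw [mul_pow]
  exact mul_le_mul_of_nonneg_left (hU p hp) (sq_nonneg _)

namespace StripSection

variable {J : E →L[ℝ] E} {Λ : Submodule ℝ E} {S S' : ℝ → E →L[ℝ] E} {ι κ : Type*}
  {x : ι → ℝ → E} {μ : ι → ℝ} {y : κ → ℝ → E} {ν : κ → ℝ} {I : Set ℝ} {B : Finset ℝ}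
  {R : ℝ × ℝ → E →L[ℝ] E} {DR : ℝ × ℝ → ℝ × ℝ →L[ℝ] E →L[ℝ] E} {K σ M₀ : ℝ}
  [FiniteDimensional ℝ E]

theorem exists_integral_w22_le (h : SpectralProblem J Λ S x μ)
    (h' : SpectralProblem J Λ S' y ν) (hT : TraceInterval I B) (hσ : σ ^ 2 = 1)
    (hM₀ : ∀ s ∈ I, Real.exp (-σ * s) ≤ M₀)
    (hR : ∀ p ∈ Strip I, HasFDerivWithinAt R (DR p) (Strip I) p)
    (hK : ∀ p ∈ Strip I, ‖R p‖ ≤ K)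
    (hDRs : IntegrableOn (fun p => ‖DR p (1, 0)‖ ^ 2) (Strip I))
    (hDRt : IntegrableOn (fun p => ‖DR p (0, 1)‖ ^ 2) (Strip I))
    (hlim : ∀ δ : ℝ, 0 < δ → ∃ s₀ : ℝ, ∀ q ∈ Strip I, s₀ ≤ |q.1| →
      ‖S q.2 + R q - S' q.2‖ ≤ δ) :
    ∃ C : ℝ, 0 ≤ C ∧ ∀ (u : ℝ × ℝ → E) (Du : ℝ × ℝ → ℝ × ℝ →L[ℝ] E)
      (D2u : ℝ × ℝ → ℝ × ℝ →L[ℝ] ℝ × ℝ →L[ℝ] E), StripSection J Λ S I u Du D2u →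
      ∫ p in Strip I, (‖u p‖ ^ 2 + ‖Du p (1, 0)‖ ^ 2 + ‖Du p (0, 1)‖ ^ 2
          + ‖D2u p (1, 0) (1, 0)‖ ^ 2 + ‖D2u p (1, 0) (0, 1)‖ ^ 2
          + ‖D2u p (0, 1) (0, 1)‖ ^ 2) ≤
        C * ((∫ p in Strip I, (‖Dop J (fun s t => S t + R (s, t)) u Du p‖ ^ 2
            + ‖DDop J S R DR u Du D2u p (1, 0)‖ ^ 2 + ‖DDop J S R DR u Du D2u p (0, 1)‖ ^ 2)) +
          ∑ b ∈ B, norm32 x μ (fun t => u (b, t)) ^ 2) := by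
  have hI := hT.closed
  have hRc : ContinuousOn R (Strip I) := fun p hp => (hR p hp).continuousWithinAt
  have hRm := hRc.aestronglyMeasurable (μ := volume) (isClosed_Strip hI).measurableSet
  have mDRs := memLp_of_sq_integrableOn
    (aestronglyMeasurable_derivative hT.convex hI hR (1, 0)) hDRs
  have mDRt := memLp_of_sq_integrableOn
    (aestronglyMeasurable_derivative hT.convex hI hR (0, 1)) hDRt
  obtain ⟨m, hm, hμ⟩ := h.exists_le_abs_eigenvalue
  have hS'c : Continuous (deriv S) := h.smooth.continuous_deriv (by simp)
  obtain ⟨K₁, hK₁⟩ := (isCompact_Icc (a := (0 : ℝ)) (b := 1)).exists_bound_of_continuousOn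
    h.continuous_coefficient.continuousOn
  obtain ⟨K₂, hK₂⟩ := (isCompact_Icc (a := (0 : ℝ)) (b := 1)).exists_bound_of_continuousOn
    hS'c.continuousOn
  obtain ⟨k, hk0, hkR, hkS, hkS'⟩ : ∃ k : ℝ, 0 ≤ k ∧ (∀ p ∈ Strip I, ‖R p‖ ≤ k) ∧
      (∀ t ∈ Icc (0 : ℝ) 1, ‖S t‖ ≤ k) ∧ ∀ t ∈ Icc (0 : ℝ) 1, ‖deriv S t‖ ≤ k :=
    ⟨max (max 0 K) (max K₁ K₂), by simp, fun p hp => by simp [hK p hp],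
      fun t ht => by simp [hK₁ t ht], fun t ht => by simp [hK₂ t ht]⟩
  obtain ⟨c₁, hc₁, hL2⟩ := exists_integral_norm_sq_le h h' hT hσ hM₀ hRc hK hlim
  obtain ⟨C, hC, L, hL, hsup⟩ := exists_norm_sq_le h hT
  obtain ⟨M₁, hM₁⟩ : ∃ M, M = ∫ p in Strip I, ‖DR p (1, 0)‖ ^ 2 := ⟨_, rfl⟩
  obtain ⟨M₂, hM₂⟩ : ∃ M, M = ∫ p in Strip I, ‖DR p (0, 1)‖ ^ 2 := ⟨_, rfl⟩
  have hM₁0 : 0 ≤ M₁ := hM₁ ▸ integral_nonneg fun p => sq_nonneg _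
  have hM₂0 : 0 ≤ M₂ := hM₂ ▸ integral_nonneg fun p => sq_nonneg _
  obtain ⟨ε, hε, hεM⟩ : ∃ ε : ℝ, 0 < ε ∧ 16 * M₂ * C * ε ≤ 1 / 2 := by
    refine ⟨(32 * M₂ * C + 1)⁻¹, by positivity, ?_⟩
    rw [← div_eq_mul_inv, div_le_div_iff₀ (by positivity) two_pos]
    linarith
  obtain ⟨c₂, hc₂⟩ : ∃ c, c = 2 + 2 * k ^ 2 * c₁ := ⟨_, rfl⟩
  obtain ⟨c₃, hc₃⟩ : ∃ c, c = c₂ + (m ^ 2)⁻¹ := ⟨_, rfl⟩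
  obtain ⟨c₄, hc₄⟩ : ∃ c, c = 2 * c₃ + 2 * k ^ 2 * c₁ := ⟨_, rfl⟩
  obtain ⟨c₅, hc₅⟩ : ∃ c, c = 2 * c₂ + 2 * c₃ := ⟨_, rfl⟩
  obtain ⟨c₆, hc₆⟩ : ∃ c, c = 2 * (4 + 4 * M₂ * (C * ((L + ε⁻¹) * c₃ + 2 * ε)) +
    4 * k ^ 2 * c₄ + 4 * k ^ 2 * c₂) := ⟨_, rfl⟩
  obtain ⟨c₇, hc₇⟩ : ∃ c, c = c₆ + 1 := ⟨_, rfl⟩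
  obtain ⟨c₈, hc₈⟩ : ∃ c, c = C * ((L + ε⁻¹) * c₃ + ε * (2 * c₆ + 2 * c₇)) := ⟨_, rfl⟩
  obtain ⟨c₉, hc₉⟩ : ∃ c, c = 4 * c₆ + 4 * c₇ + 4 * k ^ 2 * c₅ + 4 * k ^ 2 * c₁ := ⟨_, rfl⟩
  obtain ⟨c₁₀, hc₁₀⟩ : ∃ c, c = 4 * c₇ + 4 * k ^ 2 * c₃ + 4 * k ^ 2 * c₁ + 4 * k ^ 2 * c₄ :=
    ⟨_, rfl⟩
  obtain ⟨c₁₁, hc₁₁⟩ : ∃ c, c = 4 + 4 * c₉ + 4 * (M₁ * c₈) + 4 * (2 * k) ^ 2 * c₅ := ⟨_, rfl⟩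
  have hc₂0 : 0 ≤ c₂ := by rw [hc₂]; positivity
  have hc₃0 : 0 ≤ c₃ := by rw [hc₃]; positivity
  have hc₄0 : 0 ≤ c₄ := by rw [hc₄]; positivity
  have hc₅0 : 0 ≤ c₅ := by rw [hc₅]; positivity
  have hc₆0 : 0 ≤ c₆ := by rw [hc₆]; positivity
  have hc₇0 : 0 ≤ c₇ := by rw [hc₇]; positivity
  have hc₈0 : 0 ≤ c₈ := by rw [hc₈]; positivity
  have hc₉0 : 0 ≤ c₉ := by rw [hc₉]; positivity
  have hc₁₀0 : 0 ≤ c₁₀ := by rw [hc₁₀]; positivity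
  have hc₁₁0 : 0 ≤ c₁₁ := by rw [hc₁₁]; positivity
  refine ⟨c₁ + c₅ + c₄ + c₁₁ + c₉ + c₁₀, by positivity, fun u Du D2u hu => ?_⟩
  have hmem := ae_restrict_mem (μ := volume) (isClosed_Strip hI).measurableSet
  obtain ⟨a, ha⟩ : ∃ a : ℝ × ℝ → E, a = opField J S u fun p => Du p (0, 1) := ⟨_, rfl⟩
  obtain ⟨a', ha'⟩ : ∃ a' : ℝ × ℝ → E, a' = opFieldDeriv J S u (fun p => Du p (0, 1))
    fun p => D2u p (0, 1) (0, 1) := ⟨_, rfl⟩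
  obtain ⟨η, hη⟩ : ∃ η : ℝ × ℝ → E, η = fun p => Du p (1, 0) + a p := ⟨_, rfl⟩
  obtain ⟨η', hη'⟩ : ∃ η' : ℝ × ℝ → E, η' = fun p => D2u p (0, 1) (1, 0) + a' p := ⟨_, rfl⟩
  obtain ⟨N, hN⟩ : ∃ N, N = ∑ b ∈ B, norm32 x μ (fun t => u (b, t)) ^ 2 := ⟨_, rfl⟩
  have hN0 : 0 ≤ N := hN ▸ Finset.sum_nonneg fun b _ => sq_nonneg _
  have b3 := hu.integral_op_sq_le h hT hm hμ
  have b7 := hu.integral_op_op_sq_le h hT hm hμ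
  have b8 := hsup ε u Du D2u hε hu
  have b1 := hL2 u Du D2u hu
  simp only [← ha, ← ha', ← hη, ← hη', ← hN] at b1 b3 b7 b8
  have e3 : ∀ p, a p = J (Du p (0, 1)) + S p.2 (u p) := fun p => by rw [ha]; rfl
  have hSc := h.smooth.continuous
  have ma : MemLp a 2 (volume.restrict (Strip I)) := by
    rw [ha]; exact memLp_opField J hI hSc hu.memLp hu.memLp_dt
  have ma' : MemLp a' 2 (volume.restrict (Strip I)) := by
    rw [ha']; exact memLp_opFieldDeriv J hI h.smooth hu.memLp hu.memLp_dt hu.memLp_dtt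
  have mη : MemLp η 2 (volume.restrict (Strip I)) := by rw [hη]; exact hu.memLp_ds.add ma
  have mη' : MemLp η' 2 (volume.restrict (Strip I)) := by rw [hη']; exact hu.memLp_dts.add ma'
  have mAη := memLp_opField J hI hSc mη mη'
  have mAA := memLp_opField J hI hSc ma ma'
  have mF := hu.memLp_Dop hSc hRc hK
  obtain ⟨U, hU⟩ : ∃ U, U = C * ((L + ε⁻¹) * (∫ p in Strip I, ‖a p‖ ^ 2) +
      ε * (2 * (∫ p in Strip I, ‖opField J S η η' p‖ ^ 2) +
        2 * ∫ p in Strip I, ‖opField J S a a' p‖ ^ 2)) := ⟨_, rfl⟩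
  rw [← hU] at b8
  obtain ⟨mVs, bVs⟩ := memLp_clm_apply_of_bounded hI mDRs hu.memLp.1 b8
  obtain ⟨mVt, bVt⟩ := memLp_clm_apply_of_bounded hI mDRt hu.memLp.1 b8
  rw [← hM₁] at bVs
  rw [← hM₂] at bVt
  have mFs : MemLp (fun p => DDop J S R DR u Du D2u p (1, 0)) 2 (volume.restrict (Strip I)) := by
    refine (((hu.memLp_dss.add (J.comp_memLp' hu.memLp_dst)).add mVs).add
      ((memLp_coefficient_apply hI hSc hu.memLp_ds).add
        (memLp_clm_apply hI hRm hK hu.memLp_ds))).ae_eq (Filter.Eventually.of_forall fun p => ?_)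
    simp [DDop]
  have mFt : MemLp (fun p => DDop J S R DR u Du D2u p (0, 1)) 2 (volume.restrict (Strip I)) := by
    refine (mη'.add (mVt.add (memLp_clm_apply hI hRm hK hu.memLp_dt))).ae_eq
      (Filter.Eventually.of_forall fun p => ?_)
    simp only [hη', ha', Pi.add_apply, DDop, opFieldDeriv, one_smul, add_apply]
    abel
  obtain ⟨T, hTdef⟩ : ∃ T, T = (∫ p in Strip I,
      (‖Dop J (fun s t => S t + R (s, t)) u Du p‖ ^ 2 +
        ‖DDop J S R DR u Du D2u p (1, 0)‖ ^ 2 + ‖DDop J S R DR u Du D2u p (0, 1)‖ ^ 2)) + N :=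
    ⟨_, rfl⟩
  rw [← hN, ← hTdef]
  have iF := mF.integrable_norm_pow two_ne_zero
  have iFs := mFs.integrable_norm_pow two_ne_zero
  have iFt := mFt.integrable_norm_pow two_ne_zero
  have iFFs : Integrable (fun p => ‖Dop J (fun s t => S t + R (s, t)) u Du p‖ ^ 2 +
    ‖DDop J S R DR u Du D2u p (1, 0)‖ ^ 2) (volume.restrict (Strip I)) := iF.add iFs
  rw [integral_add iFFs iFt, integral_add iF iFs] at hTdef
  have i0 := hu.memLp.integrable_norm_pow two_ne_zero
  have i1 := hu.memLp_ds.integrable_norm_pow two_ne_zero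
  have i2 := hu.memLp_dt.integrable_norm_pow two_ne_zero
  have i3 := hu.memLp_dss.integrable_norm_pow two_ne_zero
  have i4 := hu.memLp_dst.integrable_norm_pow two_ne_zero
  have i5 := hu.memLp_dtt.integrable_norm_pow two_ne_zero
  have i01 : Integrable (fun p => ‖u p‖ ^ 2 + ‖Du p (1, 0)‖ ^ 2)
    (volume.restrict (Strip I)) := i0.add i1
  have i02 : Integrable (fun p => ‖u p‖ ^ 2 + ‖Du p (1, 0)‖ ^ 2 + ‖Du p (0, 1)‖ ^ 2)
    (volume.restrict (Strip I)) := i01.add i2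
  have i03 : Integrable (fun p => ‖u p‖ ^ 2 + ‖Du p (1, 0)‖ ^ 2 + ‖Du p (0, 1)‖ ^ 2
    + ‖D2u p (1, 0) (1, 0)‖ ^ 2) (volume.restrict (Strip I)) := i02.add i3
  have i04 : Integrable (fun p => ‖u p‖ ^ 2 + ‖Du p (1, 0)‖ ^ 2 + ‖Du p (0, 1)‖ ^ 2
    + ‖D2u p (1, 0) (1, 0)‖ ^ 2 + ‖D2u p (1, 0) (0, 1)‖ ^ 2)
    (volume.restrict (Strip I)) := i03.add i4
  rw [integral_add i04 i5, integral_add i03 i4, integral_add i02 i3, integral_add i01 i2,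
    integral_add i0 i1]
  have nF : 0 ≤ ∫ p in Strip I, ‖Dop J (fun s t => S t + R (s, t)) u Du p‖ ^ 2 :=
    integral_nonneg fun p => sq_nonneg _
  have nFs : 0 ≤ ∫ p in Strip I, ‖DDop J S R DR u Du D2u p (1, 0)‖ ^ 2 :=
    integral_nonneg fun p => sq_nonneg _
  have nFt : 0 ≤ ∫ p in Strip I, ‖DDop J S R DR u Du D2u p (0, 1)‖ ^ 2 :=
    integral_nonneg fun p => sq_nonneg _
  have nAη : 0 ≤ ∫ p in Strip I, ‖opField J S η η' p‖ ^ 2 :=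
    integral_nonneg fun p => sq_nonneg _
  have hk : 0 ≤ k ^ 2 := sq_nonneg k
  have le_apply : ∀ (T : E →L[ℝ] E) (v : E), ‖T‖ ≤ k → ‖T v‖ ≤ k * ‖v‖ :=
    fun T v hT => T.le_of_opNorm_le hT v
  have q₁ : (∫ p in Strip I, ‖u p‖ ^ 2) ≤ c₁ * T :=
    b1.trans (mul_le_mul_of_nonneg_left (by linarith) hc₁)
  have q₂ : (∫ p in Strip I, ‖η p‖ ^ 2) ≤ c₂ * T := by
    have := integral_norm_sq_le_two (a₁ := 1) (a₂ := k) mη mF hu.memLp (by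
      filter_upwards [hmem] with p hp
      have e : η p = Dop J (fun s t => S t + R (s, t)) u Du p - R p (u p) := by
        simp only [hη, e3, Dop, add_apply]
        abel
      rw [e, one_mul]
      exact (norm_sub_le _ _).trans (add_le_add_right (le_apply _ _ (hkR p hp)) _))
    have := mul_le_mul_of_nonneg_left q₁ hk
    rw [hc₂]
    linarith
  have q₃ : (∫ p in Strip I, ‖a p‖ ^ 2) ≤ c₃ * T := by
    have : (m ^ 2)⁻¹ * N ≤ (m ^ 2)⁻¹ * T :=
      mul_le_mul_of_nonneg_left (by linarith) (by positivity)
    have e : (∫ p in Strip I, ‖Du p (1, 0) + a p‖ ^ 2) = ∫ p in Strip I, ‖η p‖ ^ 2 := by rw [hη]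
    rw [e] at b3
    rw [hc₃]
    linarith
  have q₄ : (∫ p in Strip I, ‖Du p (0, 1)‖ ^ 2) ≤ c₄ * T := by
    have := integral_norm_sq_le_two (a₁ := 1) (a₂ := k) hu.memLp_dt ma hu.memLp (by
      filter_upwards [hmem] with p hp
      have e : J (Du p (0, 1)) = a p - S p.2 (u p) := by rw [e3]; abel
      rw [← h.norm_map, e, one_mul]
      exact (norm_sub_le _ _).trans (add_le_add_right (le_apply _ _ (hkS _ hp.2)) _))
    have := mul_le_mul_of_nonneg_left q₁ hk
    rw [hc₄]
    linarith
  have q₅ : (∫ p in Strip I, ‖Du p (1, 0)‖ ^ 2) ≤ c₅ * T := by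
    have := integral_norm_sq_le_two (a₁ := 1) (a₂ := 1) hu.memLp_ds mη ma (by
      filter_upwards with p
      have e : Du p (1, 0) = η p - a p := by rw [hη]; simp
      rw [e, one_mul, one_mul]
      exact norm_sub_le _ _)
    rw [hc₅]
    linarith
  have q₆ : (∫ p in Strip I, ‖opField J S η η' p‖ ^ 2) ≤ c₆ * T := by
    have r := integral_norm_sq_le_four (a₁ := 1) (a₂ := 1) (a₃ := k) (a₄ := k) mAη mFt mVt
      hu.memLp_dt mη (by
      filter_upwards [hmem] with p hp
      have e : η' p = DDop J S R DR u Du D2u p (0, 1) - DR p (0, 1) (u p)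
          - R p (Du p (0, 1)) := by
        simp only [hη', ha', DDop, opFieldDeriv, one_smul, add_apply]
        abel
      have e₁ : ‖η' p‖ ≤ ‖DDop J S R DR u Du D2u p (0, 1)‖ + ‖DR p (0, 1) (u p)‖ +
          k * ‖Du p (0, 1)‖ := by
        rw [e]
        exact (norm_sub_le _ _).trans (add_le_add (norm_sub_le _ _) (le_apply _ _ (hkR p hp)))
      have e₂ : ‖opField J S η η' p‖ ≤ ‖J (η' p)‖ + ‖S p.2 (η p)‖ := norm_add_le _ _
      rw [h.norm_map] at e₂
      linarith [le_apply _ (η p) (hkS _ hp.2)])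
    have r₁ := mul_le_mul_of_nonneg_left q₄ hk
    have r₂ := mul_le_mul_of_nonneg_left q₂ hk
    have r₃ : U ≤ C * ((L + ε⁻¹) * c₃ + 2 * ε) * T +
        4 * C * ε * ∫ p in Strip I, ‖opField J S η η' p‖ ^ 2 := by
      have s₁ := mul_le_mul_of_nonneg_left q₃ (by positivity : 0 ≤ C * (L + ε⁻¹))
      have s₂ := mul_le_mul_of_nonneg_left b7 (by positivity : 0 ≤ C * (ε * 2))
      have s₃ : C * (ε * 2) * N ≤ C * (ε * 2) * T :=
        mul_le_mul_of_nonneg_left (by linarith) (by positivity)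
      rw [hU]
      linarith
    have r₄ := mul_le_mul_of_nonneg_left r₃ hM₂0
    have r₅ := mul_le_mul_of_nonneg_right hεM nAη
    rw [hc₆]
    linarith
  have q₇ : (∫ p in Strip I, ‖opField J S a a' p‖ ^ 2) ≤ c₇ * T := by
    rw [hc₇]
    linarith
  have q₈ : U ≤ c₈ * T := by
    have s₁ := mul_le_mul_of_nonneg_left q₃ (by positivity : 0 ≤ C * (L + ε⁻¹))
    have s₂ := mul_le_mul_of_nonneg_left q₆ (by positivity : 0 ≤ C * (ε * 2))
    have s₃ := mul_le_mul_of_nonneg_left q₇ (by positivity : 0 ≤ C * (ε * 2))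
    rw [hU, hc₈]
    linarith
  have q₉ : (∫ p in Strip I, ‖D2u p (1, 0) (0, 1)‖ ^ 2) ≤ c₉ * T := by
    have := integral_norm_sq_le_four (a₁ := 1) (a₂ := 1) (a₃ := k) (a₄ := k) hu.memLp_dst mAη mAA
      hu.memLp_ds hu.memLp (by
      filter_upwards [hmem, hu.dst_ae_eq] with p hp hst
      have e : J (D2u p (0, 1) (1, 0)) =
          opField J S η η' p - opField J S a a' p - S p.2 (Du p (1, 0)) := by
        simp only [opField, hη, hη', map_add]
        abel
      have e₁ := norm_sub_le (opField J S η η' p - opField J S a a' p) (S p.2 (Du p (1, 0)))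
      have e₂ := norm_sub_le (opField J S η η' p) (opField J S a a' p)
      rw [hst, ← h.norm_map, e]
      linarith [le_apply _ (Du p (1, 0)) (hkS _ hp.2), mul_nonneg hk0 (norm_nonneg (u p))])
    have r₁ := mul_le_mul_of_nonneg_left q₅ hk
    have r₂ := mul_le_mul_of_nonneg_left q₁ hk
    rw [hc₉]
    linarith
  have q₁₀ : (∫ p in Strip I, ‖D2u p (0, 1) (0, 1)‖ ^ 2) ≤ c₁₀ * T := by
    have := integral_norm_sq_le_four (a₁ := 1) (a₂ := k) (a₃ := k) (a₄ := k) hu.memLp_dtt mAA ma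
      hu.memLp hu.memLp_dt (by
      filter_upwards [hmem] with p hp
      have e : J (D2u p (0, 1) (0, 1)) =
          a' p - deriv S p.2 (u p) - S p.2 (Du p (0, 1)) := by
        simp only [ha', opFieldDeriv]
        abel
      have e' : J (a' p) = opField J S a a' p - S p.2 (a p) := by
        simp only [opField]
        abel
      have e₀ := norm_sub_le (opField J S a a' p) (S p.2 (a p))
      rw [← e', h.norm_map] at e₀
      have e₁ := norm_sub_le (a' p - deriv S p.2 (u p)) (S p.2 (Du p (0, 1)))
      have e₂ := norm_sub_le (a' p) (deriv S p.2 (u p))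
      rw [← h.norm_map, e]
      linarith [le_apply _ (Du p (0, 1)) (hkS _ hp.2), le_apply _ (u p) (hkS' _ hp.2),
        le_apply _ (a p) (hkS _ hp.2)])
    have r₁ := mul_le_mul_of_nonneg_left q₃ hk
    have r₂ := mul_le_mul_of_nonneg_left q₁ hk
    have r₃ := mul_le_mul_of_nonneg_left q₄ hk
    rw [hc₁₀]
    linarith
  have q₁₁ : (∫ p in Strip I, ‖D2u p (1, 0) (1, 0)‖ ^ 2) ≤ c₁₁ * T := by
    have := integral_norm_sq_le_four (a₁ := 1) (a₂ := 1) (a₃ := 1) (a₄ := 2 * k) hu.memLp_dss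
      mFs hu.memLp_dst mVs hu.memLp_ds (by
      filter_upwards [hmem] with p hp
      have e : D2u p (1, 0) (1, 0) = DDop J S R DR u Du D2u p (1, 0) - J (D2u p (1, 0) (0, 1))
          - DR p (1, 0) (u p) - (S p.2 (Du p (1, 0)) + R p (Du p (1, 0))) := by
        simp only [DDop, zero_smul, zero_add, add_apply]
        abel
      have e₀ := norm_sub_le (DDop J S R DR u Du D2u p (1, 0) - J (D2u p (1, 0) (0, 1))
          - DR p (1, 0) (u p)) (S p.2 (Du p (1, 0)) + R p (Du p (1, 0)))
      have e₁ := norm_sub_le (DDop J S R DR u Du D2u p (1, 0) - J (D2u p (1, 0) (0, 1)))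
        (DR p (1, 0) (u p))
      have e₂ := norm_sub_le (DDop J S R DR u Du D2u p (1, 0)) (J (D2u p (1, 0) (0, 1)))
      have e₃ := norm_add_le (S p.2 (Du p (1, 0))) (R p (Du p (1, 0)))
      rw [h.norm_map] at e₂
      rw [← e] at e₀
      linarith [le_apply _ (Du p (1, 0)) (hkS _ hp.2), le_apply _ (Du p (1, 0)) (hkR _ hp)])
    have r₁ := mul_le_mul_of_nonneg_left q₅ hk
    have r₂ := mul_le_mul_of_nonneg_left q₈ hM₁0
    rw [hc₁₁]
    linarith
  linarith

end StripSection

theorem sqrt_le_sqrt_mul_add_sum {α : Type*} {s : Finset α} {f : α → ℝ} (hf : ∀ i ∈ s, 0 ≤ f i)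
    {C D Q : ℝ} (hC : 0 ≤ C) (hD : 0 ≤ D) (h : Q ≤ C * (D + ∑ i ∈ s, f i ^ 2)) :
    Real.sqrt Q ≤ Real.sqrt C * (Real.sqrt D + ∑ i ∈ s, f i) := by
  have hs := Finset.sum_nonneg hf
  rw [← Real.sqrt_sq (add_nonneg (Real.sqrt_nonneg D) hs), ← Real.sqrt_mul hC]
  refine Real.sqrt_le_sqrt (h.trans (mul_le_mul_of_nonneg_left ?_ hC))
  rw [add_sq, Real.sq_sqrt hD]
  have := Finset.sum_sq_le_sq_sum_of_nonneg hf
  have := mul_nonneg (Real.sqrt_nonneg D) hs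
  linarith

section Estimate

variable {J : E →L[ℝ] E} {Λ : Submodule ℝ E} {S S' : ℝ → E →L[ℝ] E} {ι κ : Type*}
  {x : ι → ℝ → E} {μ : ι → ℝ} {y : κ → ℝ → E} {ν : κ → ℝ} {I : Set ℝ} {B : Finset ℝ}
  {R : ℝ × ℝ → E →L[ℝ] E} {DR : ℝ × ℝ → ℝ × ℝ →L[ℝ] E →L[ℝ] E} {K σ M₀ : ℝ}

theorem exists_normW22_le [FiniteDimensional ℝ E] (h : SpectralProblem J Λ S x μ)
    (h' : SpectralProblem J Λ S' y ν) (hT : TraceInterval I B) (hσ : σ ^ 2 = 1)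
    (hM₀ : ∀ s ∈ I, Real.exp (-σ * s) ≤ M₀)
    (hR : ∀ p ∈ Strip I, HasFDerivWithinAt R (DR p) (Strip I) p)
    (hK : ∀ p ∈ Strip I, ‖R p‖ ≤ K)
    (hDRs : IntegrableOn (fun p => ‖DR p (1, 0)‖ ^ 2) (Strip I))
    (hDRt : IntegrableOn (fun p => ‖DR p (0, 1)‖ ^ 2) (Strip I))
    (hlim : ∀ δ : ℝ, 0 < δ → ∃ s₀ : ℝ, ∀ q ∈ Strip I, s₀ ≤ |q.1| →
      ‖S q.2 + R q - S' q.2‖ ≤ δ) :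
    ∃ c : ℝ, 0 < c ∧ ∀ (u : ℝ × ℝ → E) (Du : ℝ × ℝ → ℝ × ℝ →L[ℝ] E)
      (D2u : ℝ × ℝ → ℝ × ℝ →L[ℝ] ℝ × ℝ →L[ℝ] E),
      W22On I u Du D2u → LagBC Λ I u → LagBC2 Λ J S I u Du →
      normW22 I u Du D2u ≤
        c * (Real.sqrt (∫ p in Strip I, (‖Dop J (fun s t => S t + R (s, t)) u Du p‖ ^ 2
            + ‖DDop J S R DR u Du D2u p (1, 0)‖ ^ 2 + ‖DDop J S R DR u Du D2u p (0, 1)‖ ^ 2)) +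
          ∑ b ∈ B, norm32 x μ (fun t => u (b, t))) := by
  obtain ⟨C, hC, hbound⟩ :=
    StripSection.exists_integral_w22_le h h' hT hσ hM₀ hR hK hDRs hDRt hlim
  refine ⟨Real.sqrt C + 1, by positivity, fun u Du D2u h₁ h₂ h₃ => ?_⟩
  have hN : ∀ b ∈ B, 0 ≤ norm32 x μ (fun t => u (b, t)) := fun b _ => Real.sqrt_nonneg _
  refine (sqrt_le_sqrt_mul_add_sum hN hC (integral_nonneg fun p => by positivity)
    (hbound u Du D2u ⟨hT.closed, hT.convex, h₁, h₂, h₃⟩)).trans ?_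
  exact mul_le_mul_of_nonneg_right (by linarith)
    (add_nonneg (Real.sqrt_nonneg _) (Finset.sum_nonneg hN))

theorem exists_norm_le_of_limit [FiniteDimensional ℝ E] (hI : IsClosed I) (hS : Continuous S)
    (hS' : Continuous S') (hR : ContinuousOn R (Strip I))
    (hlim : ∀ δ : ℝ, 0 < δ → ∃ s₀ : ℝ, ∀ q ∈ Strip I, s₀ ≤ |q.1| →
      ‖S q.2 + R q - S' q.2‖ ≤ δ) :
    ∃ K : ℝ, ∀ p ∈ Strip I, ‖R p‖ ≤ K := by
  obtain ⟨s₀, hs₀⟩ := hlim 1 one_pos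
  obtain ⟨K₁, hK₁⟩ := (isCompact_Icc (a := (0 : ℝ)) (b := 1)).exists_bound_of_continuousOn
    (hS'.sub hS).continuousOn
  have hc : IsCompact (Strip (I ∩ Icc (-s₀) s₀)) :=
    (isCompact_Icc.inter_left hI).prod isCompact_Icc
  obtain ⟨K₂, hK₂⟩ := hc.exists_bound_of_continuousOn
    (hR.mono (prod_mono inter_subset_left Subset.rfl))
  refine ⟨max (1 + K₁) K₂, fun p hp => ?_⟩
  by_cases hps : s₀ ≤ |p.1|
  · refine le_max_of_le_left ?_
    have e : R p = (S p.2 + R p - S' p.2) + (S' p.2 - S p.2) := by abel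
    rw [e]
    exact (norm_add_le _ _).trans (add_le_add (hs₀ p hp hps) (hK₁ _ hp.2))
  · exact le_max_of_le_right (hK₂ p ⟨⟨hp.1, abs_le.1 (not_le.1 hps).le⟩, hp.2⟩)

end Estimate

theorem normW22_Icc_self (a : ℝ) (u : ℝ × ℝ → E) (Du : ℝ × ℝ → ℝ × ℝ →L[ℝ] E)
    (D2u : ℝ × ℝ → ℝ × ℝ →L[ℝ] ℝ × ℝ →L[ℝ] E) : normW22 (Icc a a) u Du D2u = 0 := by
  have h : volume (Strip (Icc a a)) = 0 := by
    rw [Strip, Measure.volume_eq_prod, Measure.prod_prod]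
    simp
  rw [normW22, Measure.restrict_eq_zero.2 h, integral_zero_measure, Real.sqrt_zero]

/-- Let `D` be the time-dependent operator
`Dξ = ∂_sξ + J₀∂_tξ + S(s,t)ξ = ∂_sξ + Aξ + R(s,t)ξ` (`A = J₀∂_t + S₁(t)` satisfying
(HA), `R ∈ W^{1,2}`).  (i) For `I = [a,b]` there is `c > 0` such that all
`ξ ∈ H²_bc(I×[0,1])` satisfy
`‖ξ‖_{W^{2,2}} ≤ c(‖Dξ‖_{W^{1,2}} + ‖ξ(a,·)‖_{3/2} + ‖ξ(b,·)‖_{3/2})`.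
(ii) For `I = ℝ^±`, assuming (H1), there is `c > 0` such that all
`ξ ∈ H²_bc(ℝ^±×[0,1])` satisfy `‖ξ‖_{W^{2,2}} ≤ c(‖Dξ‖_{W^{1,2}} + ‖ξ(0,·)‖_{3/2})`. -/
theorem stmt_16
    {E : Type*} [NormedAddCommGroup E] [InnerProductSpace ℝ E] [FiniteDimensional ℝ E]
    (n : ℕ) (hdim : Module.finrank ℝ E = 2 * n)
    (J : E →L[ℝ] E) (hJiso : ∀ v : E, ‖J v‖ = ‖v‖) (hJ2 : ∀ v : E, J (J v) = -v)
    (Λ : Submodule ℝ E) (hΛdim : Module.finrank ℝ Λ = n)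
    (hJΛ : ∀ v : E, v ∈ Λ ↔ J v ∈ Λᗮ)
    (S1 : ℝ → E →L[ℝ] E) (hS1 : ContDiff ℝ (⊤ : ℕ∞) S1)
    (hS1sym : ∀ (t : ℝ) (v w : E), ⟪S1 t v, w⟫ = ⟪v, S1 t w⟫)
    {ι : Type*} (x : ι → ℝ → E) (μ : ι → ℝ)
    (hEig : EigenData J Λ S1 x μ)
    :
    -- (i) the estimate on a compact interval `[a,b]`
    ((∀ a b : ℝ, a ≤ b →
      ∀ (R : ℝ × ℝ → E →L[ℝ] E) (DR : ℝ × ℝ → ℝ × ℝ →L[ℝ] E →L[ℝ] E),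
        (∀ q ∈ Strip (Icc a b), HasFDerivWithinAt R (DR q) (Strip (Icc a b)) q) →
        IntegrableOn (fun q => ‖R q‖ ^ 2) (Strip (Icc a b)) volume →
        IntegrableOn (fun q => ‖DR q (1, 0)‖ ^ 2) (Strip (Icc a b)) volume →
        IntegrableOn (fun q => ‖DR q (0, 1)‖ ^ 2) (Strip (Icc a b)) volume →
        ∃ c : ℝ, 0 < c ∧
          ∀ (ξ : ℝ × ℝ → E) (Dξ : ℝ × ℝ → ℝ × ℝ →L[ℝ] E)
            (D2ξ : ℝ × ℝ → ℝ × ℝ →L[ℝ] ℝ × ℝ →L[ℝ] E),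
            W22On (Icc a b) ξ Dξ D2ξ → LagBC Λ (Icc a b) ξ →
            LagBC2 Λ J S1 (Icc a b) ξ Dξ →
            normW22 (Icc a b) ξ Dξ D2ξ
              ≤ c * (Real.sqrt (∫ q in Strip (Icc a b),
                      (‖Dop J (fun s t => S1 t + R (s, t)) ξ Dξ q‖ ^ 2
                        + ‖DDop J S1 R DR ξ Dξ D2ξ q (1, 0)‖ ^ 2
                        + ‖DDop J S1 R DR ξ Dξ D2ξ q (0, 1)‖ ^ 2))
                  + norm32 x μ (fun t => ξ (a, t))
                  + norm32 x μ (fun t => ξ (b, t)))))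
    ∧
    -- (ii) the estimate on the half strips `ℝ^±`, assuming (H1)
    ((∀ I : Set ℝ, I = Ici (0:ℝ) ∨ I = Iic (0:ℝ) →
      ∀ (R : ℝ × ℝ → E →L[ℝ] E) (DR : ℝ × ℝ → ℝ × ℝ →L[ℝ] E →L[ℝ] E),
        (∀ q ∈ Strip I, HasFDerivWithinAt R (DR q) (Strip I) q) →
        IntegrableOn (fun q => ‖R q‖ ^ 2) (Strip I) volume →
        IntegrableOn (fun q => ‖DR q (1, 0)‖ ^ 2) (Strip I) volume →
        IntegrableOn (fun q => ‖DR q (0, 1)‖ ^ 2) (Strip I) volume →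
        -- hypothesis (H1)
        (∃ Sinf : ℝ → E →L[ℝ] E, ContDiff ℝ (⊤ : ℕ∞) Sinf ∧
          (∀ (t : ℝ) (v w : E), ⟪Sinf t v, w⟫ = ⟪v, Sinf t w⟫) ∧
          (∃ (ι' : Type) (xinf : ι' → ℝ → E) (μinf : ι' → ℝ),
            EigenData J Λ Sinf xinf μinf) ∧
          ∀ δ : ℝ, 0 < δ → ∃ s₀ : ℝ, ∀ q ∈ Strip I, s₀ ≤ |q.1| →
            ‖S1 q.2 + R q - Sinf q.2‖ ≤ δ ∧ ‖DR q (1, 0)‖ ≤ δ ∧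
            ‖deriv S1 q.2 + DR q (0, 1) - deriv Sinf q.2‖ ≤ δ) →
        ∃ c : ℝ, 0 < c ∧
          ∀ (ξ : ℝ × ℝ → E) (Dξ : ℝ × ℝ → ℝ × ℝ →L[ℝ] E)
            (D2ξ : ℝ × ℝ → ℝ × ℝ →L[ℝ] ℝ × ℝ →L[ℝ] E),
            W22On I ξ Dξ D2ξ → LagBC Λ I ξ →
            LagBC2 Λ J S1 I ξ Dξ →
            normW22 I ξ Dξ D2ξ
              ≤ c * (Real.sqrt (∫ q in Strip I,
                      (‖Dop J (fun s t => S1 t + R (s, t)) ξ Dξ q‖ ^ 2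
                        + ‖DDop J S1 R DR ξ Dξ D2ξ q (1, 0)‖ ^ 2
                        + ‖DDop J S1 R DR ξ Dξ D2ξ q (0, 1)‖ ^ 2))
                  + norm32 x μ (fun t => ξ (0, t))))) := by
  have hJL : ∀ v ∈ Λ, J v ∈ Λᗮ := fun v => (hJΛ v).1
  have hP : SpectralProblem J Λ S1 x μ := ⟨hJiso, hJ2, hJL, hS1, hS1sym, hEig⟩
  refine ⟨fun a b hab R DR hR _ hDRs hDRt => ?_, fun I hI R DR hR _ hDRs hDRt hlim => ?_⟩
  · rcases hab.eq_or_lt with rfl | hab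
    · refine ⟨1, one_pos, fun ξ Dξ D2ξ _ _ _ => ?_⟩
      rw [normW22_Icc_self, one_mul]
      exact add_nonneg (add_nonneg (Real.sqrt_nonneg _) (Real.sqrt_nonneg _)) (Real.sqrt_nonneg _)
    · obtain ⟨K, hK⟩ := (isCompact_Icc.prod isCompact_Icc).exists_bound_of_continuousOn
        (s := Strip (Icc a b)) fun q hq => (hR q hq).continuousWithinAt
      obtain ⟨c, hc, hbound⟩ := exists_normW22_le (σ := 1) (M₀ := Real.exp (-a)) hP hP
        (traceInterval_Icc hab) (by norm_num)
        (fun s hs => Real.exp_le_exp.2 (by linarith [hs.1])) hR hK hDRs hDRt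
        fun δ _ => ⟨|a| + |b| + 1, fun q hq hqs => by
          have : |q.1| ≤ max |a| |b| := abs_le_max_abs_abs hq.1.1 hq.1.2
          linarith [max_le_add_of_nonneg (abs_nonneg a) (abs_nonneg b)]⟩
      refine ⟨c, hc, fun ξ Dξ D2ξ h₁ h₂ h₃ => (hbound ξ Dξ D2ξ h₁ h₂ h₃).trans_eq ?_⟩
      rw [Finset.sum_pair hab.ne, add_assoc]
  · obtain ⟨Sinf, hSinf, hSinfsym, ⟨ι', xinf, μinf, hEinf⟩, hlim⟩ := hlim
    have hP' : SpectralProblem J Λ Sinf xinf μinf := ⟨hJiso, hJ2, hJL, hSinf, hSinfsym, hEinf⟩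
    have hlim' : ∀ δ : ℝ, 0 < δ → ∃ s₀ : ℝ, ∀ q ∈ Strip I, s₀ ≤ |q.1| →
        ‖S1 q.2 + R q - Sinf q.2‖ ≤ δ := fun δ hδ =>
      (hlim δ hδ).imp fun s₀ hs₀ q hq hqs => (hs₀ q hq hqs).1
    obtain ⟨hT, σ, hσ, hM₀⟩ : TraceInterval I {0} ∧
        ∃ σ : ℝ, σ ^ 2 = 1 ∧ ∀ s ∈ I, Real.exp (-σ * s) ≤ 1 := by
      rcases hI with rfl | rfl
      · exact ⟨traceInterval_Ici, 1, by norm_num, fun s hs =>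
          Real.exp_le_one_iff.2 (by linarith [mem_Ici.1 hs])⟩
      · exact ⟨traceInterval_Iic, -1, by norm_num, fun s hs =>
          Real.exp_le_one_iff.2 (by linarith [mem_Iic.1 hs])⟩
    obtain ⟨K, hK⟩ := exists_norm_le_of_limit hT.closed hS1.continuous hSinf.continuous
      (fun q hq => (hR q hq).continuousWithinAt) hlim'
    obtain ⟨c, hc, hbound⟩ := exists_normW22_le hP hP' hT hσ hM₀ hR hK hDRs hDRt hlim'
    refine ⟨c, hc, fun ξ Dξ D2ξ h₁ h₂ h₃ => (hbound ξ Dξ D2ξ h₁ h₂ h₃).trans_eq ?_⟩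
    rw [Finset.sum_singleton]
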